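/- arXiv:2406.17371 — 5 statements merged into one kernel-verified Lean document; each statement's English description precedes it below -/
import Mathlib

section
/- If G is a simple graph on n vertices with more than C(n-1,2)+1 edges, then G contains a Hamilton cycle. -/
/-- A cyclic ordering of length `n` avoiding the pairs in `S`. -/
def CycAvoid {V : Type*} (n : ℕ) (S : Finset (Sym2 V)) (f : ℕ → V) : Prop :=
  (∀ i j, i < n → j < n → f i = f j → i = j) ∧
  (∀ i, i + 1 < n → s(f i, f (i + 1)) ∉ S) ∧ s(f (n - 1), f 0) ∉ S

/-- Rotation of a cyclic ordering. -/
lemma CycAvoid.rot {V : Type*} {n : ℕ} {S : Finset (Sym2 V)} {f : ℕ → V}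
    (h : CycAvoid n S f) (i : ℕ) (hi : i + 1 < n) :
    ∃ g, CycAvoid n S g ∧ g (n - 1) = f i ∧ g 0 = f (i + 1) := by
  obtain ⟨h1, h2, h3⟩ := h
  refine ⟨fun j => if i + 1 + j < n then f (i + 1 + j) else f (i + 1 + j - n),
    ⟨?_, ?_, ?_⟩, ?_, ?_⟩
  · intro a b ha hb hab
    dsimp only at hab
    split_ifs at hab <;> have := h1 _ _ (by omega) (by omega) hab <;> omega
  · intro j hj
    dsimp only
    by_cases c1 : i + 1 + (j + 1) < n
    · rw [if_pos (by omega), if_pos c1]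
      exact h2 _ (by omega)
    · by_cases c2 : i + 1 + j < n
      · rw [if_pos c2, if_neg c1]
        rw [show i + 1 + j = n - 1 by omega, show i + 1 + (j + 1) - n = 0 by omega]
        exact h3
      · rw [if_neg c2, if_neg c1]
        rw [show i + 1 + (j + 1) - n = (i + 1 + j - n) + 1 by omega]
        exact h2 _ (by omega)
  · dsimp only
    rw [if_neg (by omega), if_pos (by omega), show i + 1 + (n - 1) - n = i by omega]
    exact h2 _ hi
  · dsimp only
    rw [if_neg (by omega), show i + 1 + (n - 1) - n = i by omega]
  · dsimp only
    rw [if_pos (by omega)]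

/-- Repairing the closing pair of a cyclic ordering by reversing an initial segment. -/
lemma CycAvoid.fix {V : Type*} [DecidableEq V] {n : ℕ} (h3 : 3 ≤ n) {S : Finset (Sym2 V)}
    {f : ℕ → V} (h : CycAvoid n S f) (hc : (insert s(f (n - 1), f 0) S).card ≤ n - 3) :
    ∃ g, CycAvoid n (insert s(f (n - 1), f 0) S) g := by
  obtain ⟨h1, h2, -⟩ := h
  set T := insert s(f (n - 1), f 0) S with hT
  have hT2 : ∀ i, i + 1 < n → s(f i, f (i + 1)) ∉ T := by
    intro i hi hm
    rw [hT, Finset.mem_insert] at hm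
    rcases hm with hm | hm
    · rw [Sym2.eq_iff] at hm
      rcases hm with ⟨a, b⟩ | ⟨a, b⟩
      · have := h1 _ _ (by omega) (by omega) a; omega
      · have := h1 _ _ (by omega) (by omega) a
        have := h1 _ _ (by omega) (by omega) b
        omega
    · exact h2 i hi hm
  by_cases hk : ∃ k, k + 1 < n ∧ s(f (n - 1), f k) ∉ T ∧ s(f 0, f (k + 1)) ∉ T
  · obtain ⟨k, hk, hu, hv⟩ := hk
    refine ⟨fun j => if j ≤ k then f (k - j) else f j, ?_, ?_, ?_⟩
    · intro a b ha hb hab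
      dsimp only at hab
      split_ifs at hab <;> have := h1 _ _ (by omega) (by omega) hab <;> omega
    · intro j hj
      dsimp only
      by_cases c1 : j + 1 ≤ k
      · rw [if_pos (by omega), if_pos c1, Sym2.eq_swap,
          show k - j = (k - (j + 1)) + 1 by omega]
        exact hT2 _ (by omega)
      · by_cases c2 : j ≤ k
        · rw [if_pos c2, if_neg c1, show k - j = 0 by omega, show j = k by omega]
          exact hv
        · rw [if_neg c2, if_neg c1]
          exact hT2 _ hj
    · dsimp only
      rw [if_neg (by omega), if_pos (by omega)]
      exact hu
  · exfalso
    push Not at hk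
    have : (Finset.range (n - 2)).card ≤ T.card := by
      apply Finset.card_le_card_of_injOn
        (fun k => if s(f (n - 1), f k) ∈ T then s(f (n - 1), f k) else s(f 0, f (k + 1)))
      · intro k hk'
        have hk' : k < n - 2 := by simpa using hk'
        dsimp only
        split_ifs with c
        · exact c
        · exact hk k (by omega) c
      · intro a ha b hb hab
        have ha : a < n - 2 := by simpa using ha
        have hb : b < n - 2 := by simpa using hb
        dsimp only at hab
        split_ifs at hab <;> rw [Sym2.eq_iff] at hab <;> rcases hab with ⟨p, q⟩ | ⟨p, q⟩ <;>
          have p := h1 _ _ (by omega) (by omega) p <;>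
          have q := h1 _ _ (by omega) (by omega) q <;> omega
    rw [Finset.card_range] at this
    omega

lemma exists_cycAvoid {V : Type*} [Fintype V] [DecidableEq V] (n : ℕ)
    (hn : Fintype.card V = n) (h3 : 3 ≤ n) (S : Finset (Sym2 V)) :
    S.card ≤ n - 3 → ∃ f, CycAvoid n S f := by
  induction S using Finset.induction_on with
  | empty =>
    intro _
    have e := Fintype.equivFinOfCardEq hn
    refine ⟨fun i => if h : i < n then e.symm ⟨i, h⟩ else e.symm ⟨0, by omega⟩, ?_, ?_, ?_⟩
    · intro i j hi hj hij
      simpa [hi, hj] using hij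
    · simp
    · simp
  | insert e S he ih =>
    intro hc
    obtain ⟨f, hf⟩ := ih ((Finset.card_le_card (Finset.subset_insert _ _)).trans hc)
    by_cases hl : s(f (n - 1), f 0) = e
    · subst hl; exact hf.fix h3 hc
    by_cases hm : ∃ i, i + 1 < n ∧ s(f i, f (i + 1)) = e
    · obtain ⟨i, hi, rfl⟩ := hm
      obtain ⟨g, hg, g1, g0⟩ := hf.rot i hi
      rw [← g1, ← g0] at hc ⊢
      exact hg.fix h3 hc
    · push Not at hm
      refine ⟨f, hf.1, fun i hi => ?_, ?_⟩
      · simp only [Finset.mem_insert, not_or]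
        exact ⟨hm i hi, hf.2.1 i hi⟩
      · simp only [Finset.mem_insert, not_or]
        exact ⟨hl, hf.2.2⟩

lemma exists_walk_of_seq {V : Type*} (G : SimpleGraph V) (f : ℕ → V) (k : ℕ)
    (h : ∀ i < k, G.Adj (f i) (f (i + 1))) :
    ∃ p : G.Walk (f 0) (f k), p.support = (List.range (k + 1)).map f ∧
      p.edges = (List.range k).map (fun i => s(f i, f (i + 1))) := by
  induction k with
  | zero => exact ⟨.nil, by simp, by simp⟩
  | succ k ih =>
    obtain ⟨p, hp, hq⟩ := ih (fun i hi => h i (by omega))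
    refine ⟨p.concat (h k (by omega)), ?_, ?_⟩
    · rw [SimpleGraph.Walk.support_concat, hp, List.range_succ (n := k + 1)]; simp
    · rw [SimpleGraph.Walk.edges_concat, hq, List.range_succ (n := k)]; simp

/-- **Ore's theorem (1961).** If a simple graph on `n ≥ 3` vertices has more than
`C(n-1,2) + 1` edges, then it contains a Hamilton cycle. -/
theorem stmt_0 {V : Type*} [Fintype V] [DecidableEq V]
    (G : SimpleGraph V) [DecidableRel G.Adj] (n : ℕ)
    (hn : Fintype.card V = n) (h3 : 3 ≤ n)
    (he : (n - 1).choose 2 + 1 < G.edgeFinset.card) :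
    ∃ (v : V) (c : G.Walk v v), c.IsHamiltonianCycle := by
  have hcard : Gᶜ.edgeFinset.card ≤ n - 3 := by
    have h1 : G.edgeFinset.card + Gᶜ.edgeFinset.card ≤ n.choose 2 := by
      rw [← Finset.card_union_of_disjoint, ← hn, ← SimpleGraph.card_edgeFinset_top_eq_card_choose_two]
      · apply Finset.card_le_card
        exact Finset.union_subset (SimpleGraph.edgeFinset_mono le_top)
          (SimpleGraph.edgeFinset_mono le_top)
      · rw [SimpleGraph.disjoint_edgeFinset]
        exact disjoint_compl_right
    have h2 : n.choose 2 = (n - 1) + (n - 1).choose 2 := by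
      obtain ⟨m, rfl⟩ : ∃ m, n = m + 1 := ⟨n - 1, by omega⟩
      rw [Nat.choose_succ_succ' m 1]; simp
    omega
  obtain ⟨f, f1, f2, f3⟩ := exists_cycAvoid n hn h3 _ hcard
  have key : ∀ a b, a ≠ b → s(a, b) ∉ Gᶜ.edgeFinset → G.Adj a b := by
    intro a b hab h
    by_contra hc
    exact h (by simp [hab, hc])
  have hadj : ∀ i < n - 1, G.Adj (f i) (f (i + 1)) := fun i hi =>
    key _ _ (fun h => by have := f1 _ _ (by omega) (by omega) h; omega) (f2 i (by omega))
  have hlast : G.Adj (f (n - 1)) (f 0) :=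
    key _ _ (fun h => by have := f1 _ _ (by omega) (by omega) h; omega) f3
  obtain ⟨p, hp, hq⟩ := exists_walk_of_seq G f (n - 1) hadj
  refine ⟨_, .cons hlast p, ?_⟩
  rw [SimpleGraph.Walk.isHamiltonianCycle_iff_isCycle_and_length_eq,
    SimpleGraph.Walk.cons_isCycle_iff]
  refine ⟨⟨?_, ?_⟩, ?_⟩
  · rw [SimpleGraph.Walk.isPath_def, hp]
    apply List.Nodup.map_on _ List.nodup_range
    intro a ha b hb hab
    rw [List.mem_range] at ha hb
    exact f1 _ _ (by omega) (by omega) hab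
  · rw [hq]
    intro hm
    obtain ⟨i, hi, hh⟩ := List.mem_map.1 hm
    rw [List.mem_range] at hi
    rw [Sym2.eq_iff] at hh
    rcases hh with ⟨a, b⟩ | ⟨a, b⟩ <;>
      have a := f1 _ _ (by omega) (by omega) a <;>
      have b := f1 _ _ (by omega) (by omega) b <;> omega
  · rw [SimpleGraph.Walk.length_cons, ← SimpleGraph.Walk.length_edges, hq]
    simp; omega
end

section
/- Let G be a graph on n vertices with minimum degree δ(G) ≥ r, where 1 ≤ r ≤ (n-1)/2. If e(G) > max{ C(n-r,2) + r², C(n - ⌊(n-1)/2⌋, 2) + ⌊(n-1)/2⌋² }, then G contains a Hamilton cycle. -/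
namespace ErdosHam
open SimpleGraph Finset

/-- A cyclic spanning list `u :: m`. -/
def HL {V : Type*} (G : SimpleGraph V) (u : V) (m : List V) : Prop :=
  (u :: m).Nodup ∧ (∀ w, w ∈ u :: m) ∧ (u :: (m ++ [u])).IsChain G.Adj

theorem HL.rotate {V : Type*} {G : SimpleGraph V} {u : V} {m : List V} (h : HL G u m) (x : V) :
    ∃ m', HL G x m' := by
  obtain ⟨h1, h2, h3⟩ := h
  rcases List.mem_cons.1 (h2 x) with rfl | hx
  · exact ⟨m, h1, h2, h3⟩
  · obtain ⟨A, B, rfl⟩ := List.append_of_mem hx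
    refine ⟨B ++ u :: A, ?_, ?_, ?_⟩
    · refine (List.Perm.nodup_iff ?_).1 h1
      have : (u :: A ++ (x :: B)).Perm ((x :: B) ++ u :: A) := List.perm_append_comm
      simpa using this
    · intro w
      have := h2 w
      simp at this ⊢
      tauto
    · have e1 : u :: (A ++ x :: B ++ [u]) = (u :: A) ++ x :: (B ++ [u]) := by simp
      have e2 : x :: (B ++ u :: A ++ [x]) = (x :: B) ++ u :: (A ++ [x]) := by simp
      rw [e1, List.isChain_split] at h3
      rw [e2, List.isChain_split]
      exact ⟨by simpa using h3.2, by simpa using h3.1⟩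

theorem HL.toWalk {V : Type*} [Fintype V] [DecidableEq V] {G : SimpleGraph V} {u : V} {m : List V}
    (h : HL G u m) (hc : 3 ≤ Fintype.card V) :
    ∃ (v : V) (c : G.Walk v v), c.IsHamiltonianCycle := by
  obtain ⟨h1, h2, h3⟩ := h
  have hq : ∃ q : G.Walk u u, q.support = u :: (m ++ [u]) := by
    have key : ∀ (a b : V) (w : G.Walk a b), a = u → b = u →
        ∃ q : G.Walk u u, q.support = w.support := by
      rintro a b w rfl rfl
      exact ⟨w, rfl⟩
    have hne : u :: (m ++ [u]) ≠ [] := List.cons_ne_nil _ _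
    obtain ⟨q, hq⟩ := key _ _ (Walk.ofSupport (u :: (m ++ [u])) hne h3) (by simp)
      (by simp [List.getLast_cons])
    exact ⟨q, hq.trans (Walk.support_ofSupport hne h3)⟩
  obtain ⟨q, hq⟩ := hq
  have hlen : (u :: m).length = Fintype.card V := by
    rw [← List.toFinset_card_of_nodup h1, ← Finset.card_univ]
    congr 1
    ext w
    simpa using h2 w
  have hql : q.length = Fintype.card V := by
    have := q.length_support
    rw [hq] at this
    simp at this hlen
    omega
  refine ⟨u, q, ?_⟩
  have hnn : ¬ q.Nil := by
    intro hnil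
    have := Walk.length_eq_zero_iff.2 hnil
    omega
  rw [Walk.isHamiltonianCycle_iff_isCycle_and_length_eq]
  refine ⟨Walk.isCycle_iff_isPath_tail_and_le_length.2 ⟨?_, by omega⟩, hql⟩
  rw [Walk.isPath_def, Walk.support_tail_of_not_nil _ hnn, hq, List.tail_cons]
  exact (List.Perm.nodup_iff (List.perm_append_comm (l₁ := [u]) (l₂ := m))).1 h1

/-- The crossover argument. -/
theorem cross {V : Type*} [Fintype V] [DecidableEq V] (G : SimpleGraph V) [DecidableRel G.Adj]
    (x y : V) (L : List V) (hnd : L.Nodup) (hall : ∀ w, w ∈ L) (hch : L.IsChain G.Adj)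
    (hx : L.head? = some x) (hy : L.getLast? = some y)
    (hd : Fintype.card V ≤ G.degree x + G.degree y) : ∃ u m, HL G u m := by
  have hlen : L.length = Fintype.card V := by
    rw [← List.toFinset_card_of_nodup hnd, ← Finset.card_univ]
    congr 1
    ext w
    simpa using hall w
  have hpos : 0 < L.length := List.length_pos_of_mem (hall x)
  have hx0 : L[0] = x := by
    rw [List.head?_eq_getElem?] at hx
    exact (List.getElem?_eq_some_iff.1 hx).2
  have hy0 : L[L.length - 1] = y := by
    rw [List.getLast?_eq_getElem?] at hy
    exact (List.getElem?_eq_some_iff.1 hy).2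
  let g : ℕ → V := fun i => L.getD i x
  have hg : ∀ i (h : i < L.length), g i = L[i] := fun i h => by simp [g, h]
  let S := (range (L.length - 1)).filter (fun i => G.Adj (g i) y)
  let T := (range (L.length - 1)).filter (fun i => G.Adj (g (i+1)) x)
  have hS : G.degree y ≤ S.card := by
    refine le_trans (Finset.card_le_card (t := S.image g) ?_) Finset.card_image_le
    intro w hw
    rw [mem_neighborFinset] at hw
    obtain ⟨i, hi, rfl⟩ := List.mem_iff_getElem.1 (hall w)
    have : i ≠ L.length - 1 := by
      rintro rfl
      exact hw.ne hy0.symm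
    refine mem_image.2 ⟨i, ?_, hg i hi⟩
    simp only [S, mem_filter, mem_range]
    exact ⟨by omega, by rw [hg i hi]; exact hw.symm⟩
  have hT : G.degree x ≤ T.card := by
    refine le_trans (Finset.card_le_card (t := T.image (fun i => g (i+1))) ?_) Finset.card_image_le
    intro w hw
    rw [mem_neighborFinset] at hw
    obtain ⟨i, hi, rfl⟩ := List.mem_iff_getElem.1 (hall w)
    have : i ≠ 0 := by
      rintro rfl
      exact hw.ne hx0.symm
    obtain ⟨j, rfl⟩ := Nat.exists_eq_succ_of_ne_zero this
    refine mem_image.2 ⟨j, ?_, hg _ hi⟩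
    simp only [T, mem_filter, mem_range]
    exact ⟨by omega, by rw [hg _ hi]; exact hw.symm⟩
  have hne : (S ∩ T).Nonempty := by
    rw [← card_pos]
    have h1 := card_union_add_card_inter S T
    have h2 : (S ∪ T).card ≤ L.length - 1 := by
      conv_rhs => rw [← card_range (L.length - 1)]
      exact card_le_card (union_subset (filter_subset _ _) (filter_subset _ _))
    omega
  obtain ⟨i, hi⟩ := hne
  simp only [S, T, mem_inter, mem_filter, mem_range] at hi
  obtain ⟨⟨hi1, hiy⟩, -, hix⟩ := hi
  rw [hg i (by omega)] at hiy
  rw [hg (i+1) (by omega)] at hix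
  -- split the list
  have hA : (L.take (i+1)).IsChain G.Adj := hch.take _
  have hB : (L.drop (i+1)).IsChain G.Adj := hch.drop _
  have hAl : (L.take (i+1)).getLast? = some L[i] := by
    grind
  have hBh : (L.drop (i+1)).head? = some L[i+1] := by
    simp
  have hBl : (L.drop (i+1)).getLast? = some y := by
    rw [List.getLast?_drop, hy]
    simp
    omega
  have hAh : (L.take (i+1)).head? = some x := by
    rw [List.head?_take, hx]
    simp
  have hAB := List.take_append_drop (i+1) L
  generalize L.take (i+1) = A at *
  generalize L.drop (i+1) = B at *
  cases A with
  | nil => simp at hAh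
  | cons a A =>
  simp at hAh
  subst hAh
  refine ⟨a, A ++ B.reverse, ?_, ?_, ?_⟩
  · refine (List.Perm.nodup_iff ?_).1 hnd
    rw [← hAB]
    exact (List.reverse_perm B).symm.append_left (a :: A)
  · intro w
    have := hall w
    rw [← hAB] at this
    simpa using this
  · have e : a :: (A ++ B.reverse ++ [a]) = (a :: A) ++ (B.reverse ++ [a]) := by simp
    rw [e, List.isChain_append, List.isChain_append, List.isChain_reverse]
    refine ⟨hA, ⟨hB.imp fun _ _ h => h.symm, by simp, ?_⟩, ?_⟩
    · intro p hp q hq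
      rw [List.getLast?_reverse, hBh] at hp
      simp at hp hq
      subst hp hq
      exact hix
    · intro p hp q hq
      rw [hAl] at hp
      rw [List.head?_append, List.head?_reverse, hBl] at hq
      simp at hp hq
      subst hp hq
      exact hiy

/-- Bondy–Chvátal step. -/
theorem ore {V : Type*} [Fintype V] [DecidableEq V] (G : SimpleGraph V) [DecidableRel G.Adj]
    (hc : 3 ≤ Fintype.card V) (u v : V)
    (hH : ∃ a m, HL (G ⊔ SimpleGraph.edge u v) a m)
    (hd : Fintype.card V ≤ G.degree u + G.degree v) : ∃ u m, HL G u m := by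
  obtain ⟨a, m, h⟩ := hH
  obtain ⟨m, h⟩ := h.rotate u
  have ⟨h1, h2, h3⟩ := h
  have hadj : ∀ p q, (G ⊔ SimpleGraph.edge u v).Adj p q → G.Adj p q ∨ (p = u ∧ q = v) ∨
      (p = v ∧ q = u) := by
    intro p q hpq
    rw [sup_adj, edge_adj] at hpq
    tauto
  have hlen : (u :: m).length = Fintype.card V := by
    rw [← List.toFinset_card_of_nodup h1, ← Finset.card_univ]
    congr 1
    ext w
    simpa using h2 w
  have hum : u ∉ m := (List.nodup_cons.1 h1).1
  obtain ⟨b, m', rfl⟩ : ∃ b m', m = b :: m' := by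
    cases m with
    | nil => simp at hlen; omega
    | cons b m' => exact ⟨b, m', rfl⟩
  rw [← List.cons_append, List.isChain_append] at h3
  obtain ⟨h3, -, h4⟩ := h3
  rw [List.isChain_cons_cons] at h3
  obtain ⟨hub, hm⟩ := h3
  have hmG : (b :: m').IsChain G.Adj := by
    refine List.IsChain.imp_of_mem_imp ?_ hm
    intro p q hp hq hpq
    rcases hadj _ _ hpq with h | ⟨rfl, -⟩ | ⟨-, rfl⟩
    · exact h
    · exact absurd hp hum
    · exact absurd hq hum
  obtain ⟨l, hl⟩ : ∃ l, (b :: m').getLast? = some l := by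
    cases hh : (b :: m').getLast? with
    | none => simp at hh
    | some l => exact ⟨l, rfl⟩
  have hlu := h4 l (by rw [List.getLast?_cons_cons, hl]; rfl) u rfl
  have hlm : l ∈ b :: m' := List.mem_of_getLast? hl
  have hbl : b ≠ l := by
    rintro rfl
    cases m' with
    | nil => simp at hlen; omega
    | cons c m' =>
      rw [List.getLast?_cons_cons] at hl
      have := List.mem_of_getLast? hl
      have := (List.nodup_cons.1 (List.nodup_cons.1 h1).2).1
      contradiction
  by_cases hb : G.Adj u b
  · by_cases hlG : G.Adj l u
    · refine ⟨u, b :: m', h1, h2, ?_⟩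
      rw [← List.cons_append, List.isChain_append]
      refine ⟨List.isChain_cons_cons.2 ⟨hb, hmG⟩, by simp, ?_⟩
      intro p hp q hq
      rw [List.getLast?_cons_cons, hl] at hp
      simp at hp hq
      subst hp hq
      exact hlG
    · have : l = v := by
        rcases hadj _ _ hlu with h | ⟨rfl, -⟩ | ⟨h, -⟩
        · exact absurd h hlG
        · exact absurd hlm hum
        · exact h
      subst this
      exact cross G u l (u :: b :: m') h1 h2 (List.isChain_cons_cons.2 ⟨hb, hmG⟩) rfl
        (by rw [List.getLast?_cons_cons, hl]) hd
  · have hbv : b = v := by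
      rcases hadj _ _ hub with h | ⟨-, h⟩ | ⟨-, rfl⟩
      · exact absurd h hb
      · exact h
      · simp at hum
    subst hbv
    have hlG : G.Adj l u := by
      rcases hadj _ _ hlu with h | ⟨rfl, -⟩ | ⟨h, -⟩
      · exact h
      · exact absurd hlm hum
      · exact absurd h.symm hbl
    refine cross G b u (b :: m' ++ [u]) ?_ ?_ ?_ rfl List.getLast?_concat (by omega)
    · exact (List.Perm.nodup_iff (List.perm_append_comm (l₁ := [u]) (l₂ := b :: m'))).1 h1
    · intro w
      have := h2 w
      simp at this ⊢
      tauto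
    · rw [List.isChain_append]
      refine ⟨hmG, by simp, ?_⟩
      intro p hp q hq
      rw [hl] at hp
      simp at hp hq
      subst hp hq
      exact hlG

theorem top_HL {V : Type*} [Fintype V] [DecidableEq V] (hc : 3 ≤ Fintype.card V) :
    ∃ u m, HL (⊤ : SimpleGraph V) u m := by
  have hnd := Finset.nodup_toList (univ : Finset V)
  have hall : ∀ w, w ∈ (univ : Finset V).toList := by simp
  have hlen : (univ : Finset V).toList.length = Fintype.card V := by simp
  generalize (univ : Finset V).toList = L at *
  cases L with
  | nil => simp at hlen; omega
  | cons a m =>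
    refine ⟨a, m, hnd, hall, ?_⟩
    have : m ≠ [] := by rintro rfl; simp at hlen; omega
    rw [← List.cons_append, List.isChain_append]
    refine ⟨List.Pairwise.isChain (hnd.imp fun h => by simpa using h), by simp, ?_⟩
    intro p hp q hq
    have hp' : p ∈ m := by
      cases m with
      | nil => exact absurd rfl this
      | cons b m' =>
        rw [List.getLast?_cons_cons] at hp
        exact List.mem_of_getLast? hp
    simp at hq
    subst hq
    rw [top_adj]
    rintro rfl
    exact (List.nodup_cons.1 hnd).1 hp'

theorem edge_count {V : Type*} [Fintype V] [DecidableEq V] (G : SimpleGraph V) [DecidableRel G.Adj]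
    (S : Finset V) (k : ℕ) (hS : S.card = k) (hd : ∀ w ∈ S, G.degree w ≤ k) :
    G.edgeFinset.card ≤ (Fintype.card V - k).choose 2 + k ^ 2 := by
  have hsub : G.edgeFinset ⊆ (Sᶜ.offDiag.image Sym2.mk.uncurry) ∪ S.biUnion (fun w => G.incidenceFinset w) := by
    intro e
    induction e using Sym2.ind with
    | _ x y =>
    intro h
    rw [mem_edgeFinset, mem_edgeSet] at h
    rw [mem_union]
    by_cases hx : x ∈ S
    · right
      refine mem_biUnion.2 ⟨x, hx, ?_⟩
      simp [mem_incidenceFinset, incidenceSet, h]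
    by_cases hy : y ∈ S
    · right
      refine mem_biUnion.2 ⟨y, hy, ?_⟩
      simp [mem_incidenceFinset, incidenceSet, h]
    left
    refine mem_image.2 ⟨(x, y), ?_, rfl⟩
    simp [hx, hy, h.ne]
  refine (card_le_card hsub).trans ((card_union_le _ _).trans (add_le_add ?_ ?_))
  · rw [Sym2.card_image_offDiag, card_compl, hS]
  · refine card_biUnion_le.trans ?_
    calc _ ≤ ∑ w ∈ S, k := sum_le_sum fun w hw => by
            rw [card_incidenceFinset_eq_degree]; exact hd w hw
      _ = k ^ 2 := by rw [sum_const, hS, smul_eq_mul, sq]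

theorem numeric (n r k m : ℕ) (h1 : r ≤ k) (h2 : k ≤ m) (h3 : m ≤ n) :
    (n - k).choose 2 + k ^ 2 ≤ max ((n - r).choose 2 + r ^ 2) ((n - m).choose 2 + m ^ 2) := by
  have key : ∀ j, j ≤ n → (2 * ((n - j).choose 2 + j ^ 2 : ℕ) : ℤ) =
      3 * j ^ 2 - (2 * n - 1) * j + n * (n - 1) := by
    intro j hj
    obtain ⟨a, rfl⟩ := Nat.exists_eq_add_of_le hj
    have : (2 * (a.choose 2 : ℕ) : ℤ) = a * (a - 1) := by
      have h := Nat.triangle_succ (a - 1)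
      have h2 := Nat.choose_two_right a
      have h3 : 2 ∣ a * (a - 1) := (Nat.even_mul_pred_self a).two_dvd
      have h4 : 2 * a.choose 2 = a * (a - 1) := by omega
      cases a with
      | zero => simp
      | succ b =>
        simp at h4 ⊢
        exact_mod_cast h4
    rw [Nat.add_sub_cancel_left]
    push_cast
    linear_combination this
  rw [le_max_iff]
  by_contra! hcon
  obtain ⟨c1, c2⟩ := hcon
  have kr := key r (by omega)
  have kk := key k (by omega)
  have km := key m h3
  zify at c1 c2 h1 h2
  push_cast at kr kk km c1 c2
  have d1 : (0:ℤ) < (k - r) * (3 * (k + r) - (2 * n - 1)) := by nlinarith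
  have d2 : ((m:ℤ) - k) * (3 * (m + k) - (2 * n - 1)) < 0 := by nlinarith
  have e1 : (0:ℤ) < 3 * (k + r) - (2 * n - 1) := pos_of_mul_pos_right d1 (by linarith)
  have e2 : (0:ℤ) ≤ ((m:ℤ) - k) * (3 * (m + k) - (2 * n - 1)) :=
    mul_nonneg (by linarith) (by linarith)
  linarith

end ErdosHam

open ErdosHam in
theorem stmt_1 {V : Type*} [Fintype V] [DecidableEq V]
    (G : SimpleGraph V) [DecidableRel G.Adj] (n r : ℕ)
    (hn : Fintype.card V = n) (hr1 : 1 ≤ r) (hr2 : r ≤ (n - 1) / 2)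
    (hδ : ∀ v : V, r ≤ G.degree v)
    (he : max ((n - r).choose 2 + r ^ 2)
              ((n - (n - 1) / 2).choose 2 + ((n - 1) / 2) ^ 2)
          < G.edgeFinset.card) :
    ∃ (v : V) (c : G.Walk v v), c.IsHamiltonianCycle := by
  classical
  have hc : 3 ≤ Fintype.card V := by omega
  suffices h : ∃ u m, HL G u m by
    obtain ⟨u, m, h⟩ := h
    exact h.toWalk hc
  by_contra hG
  obtain ⟨H, hGH, hmax⟩ := Finite.exists_le_maximal (p := fun H : SimpleGraph V => ¬ ∃ u m, HL H u m) hG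
  have hHtop : H ≠ ⊤ := by
    rintro rfl
    exact hmax.1 (top_HL hc)
  have hore : ∀ u v, u ≠ v → ¬ H.Adj u v → H.degree u + H.degree v < n := by
    intro u v huv hnadj
    by_contra! hd
    apply hmax.1
    refine ore H hc u v ?_ (by omega)
    by_contra hno
    have hle := hmax.2 hno le_sup_left
    apply hnadj
    apply hle
    rw [SimpleGraph.sup_adj, SimpleGraph.edge_adj]
    exact Or.inr ⟨Or.inl ⟨rfl, rfl⟩, huv⟩
  let N : Finset (V × V) := Finset.univ.filter fun p => p.1 ≠ p.2 ∧ ¬ H.Adj p.1 p.2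
  have hN : N.Nonempty := by
    by_contra hN
    rw [Finset.not_nonempty_iff_eq_empty] at hN
    apply hHtop
    ext a b
    rw [SimpleGraph.top_adj]
    refine ⟨fun h => h.ne, fun hab => ?_⟩
    by_contra hadj
    have : (a, b) ∈ N := by simp [N, hab, hadj]
    simp [hN] at this
  obtain ⟨⟨u, v⟩, huv, hbest⟩ := Finset.exists_max_image N (fun p => H.degree p.1 + H.degree p.2) hN
  simp only [N, Finset.mem_filter, Finset.mem_univ, true_and, Prod.forall] at huv hbest
  obtain ⟨u, v, hne, hnadj, hbest, hle⟩ : ∃ u v, u ≠ v ∧ ¬ H.Adj u v ∧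
      (∀ a b, a ≠ b ∧ ¬ H.Adj a b → H.degree a + H.degree b ≤ H.degree u + H.degree v) ∧
      H.degree u ≤ H.degree v := by
    rcases le_total (H.degree u) (H.degree v) with h | h
    · exact ⟨u, v, huv.1, huv.2, hbest, h⟩
    · exact ⟨v, u, huv.1.symm, fun h => huv.2 h.symm, fun a b hab => by
        rw [add_comm (H.degree v)]; exact hbest a b hab, h⟩
  have hsum := hore u v hne hnadj
  have hru : r ≤ H.degree u := (hδ u).trans (SimpleGraph.degree_le_of_le hGH)
  have hcard : H.degree u ≤ (insert v (H.neighborFinset v))ᶜ.card := by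
    rw [Finset.card_compl, Finset.card_insert_of_notMem (by simp), SimpleGraph.card_neighborFinset_eq_degree]
    omega
  obtain ⟨S, hS, hSc⟩ := Finset.exists_subset_card_eq hcard
  have h1 := edge_count H S (H.degree u) hSc (by
    intro w hw
    have hw' := hS hw
    simp only [Finset.mem_compl, Finset.mem_insert, SimpleGraph.mem_neighborFinset, not_or] at hw'
    have := hbest w v ⟨hw'.1, fun h => hw'.2 h.symm⟩
    omega)
  have h2 := numeric n r (H.degree u) ((n - 1) / 2) hru (by omega) (by omega)
  have h3 : G.edgeFinset.card ≤ H.edgeFinset.card :=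
    Finset.card_le_card (SimpleGraph.edgeFinset_mono hGH)
  rw [hn] at h1
  omega
end

section
/- Let G be a balanced bipartite graph on 2n vertices with minimum degree δ(G) ≥ r, where 1 ≤ r ≤ n/2. If e(G) > n(n-r) + r², then G contains a Hamilton cycle. -/
/-- `f 0, …, f (N-1)` is a path in `G`. -/
def MMPath {V : Type*} (G : SimpleGraph V) (N : ℕ) (f : ℕ → V) : Prop :=
  (∀ i j, i < N → j < N → f i = f j → i = j) ∧ ∀ i, i + 1 < N → G.Adj (f i) (f (i + 1))

/-- `f 0, …, f (N-1)` is a cycle in `G`. -/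
def MMCycle {V : Type*} (G : SimpleGraph V) (N : ℕ) : Prop :=
  ∃ f : ℕ → V, MMPath G N f ∧ G.Adj (f (N - 1)) (f 0)

/-- Bipartite with parts `X`, `Y` of size `n`. -/
structure MMBip {V : Type*} [Fintype V] [DecidableEq V]
    (G : SimpleGraph V) (n : ℕ) (X Y : Finset V) : Prop where
  disj : Disjoint X Y
  union : X ∪ Y = Finset.univ
  hX : X.card = n
  hY : Y.card = n
  bip : ∀ x y : V, G.Adj x y → (x ∈ X ∧ y ∈ Y) ∨ (x ∈ Y ∧ y ∈ X)

lemma MMBip.symm {V : Type*} [Fintype V] [DecidableEq V] {G : SimpleGraph V} {n : ℕ}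
    {X Y : Finset V} (h : MMBip G n X Y) : MMBip G n Y X :=
  ⟨h.disj.symm, by rw [Finset.union_comm]; exact h.union, h.hY, h.hX,
    fun x y hxy => (h.bip x y hxy).symm⟩

lemma MMBip.card {V : Type*} [Fintype V] [DecidableEq V] {G : SimpleGraph V} {n : ℕ}
    {X Y : Finset V} (h : MMBip G n X Y) : Fintype.card V = 2 * n := by
  rw [← Finset.card_univ, ← h.union, Finset.card_union_of_disjoint h.disj, h.hX, h.hY]; ring

lemma MMPath.surj {V : Type*} [Fintype V] [DecidableEq V] {G : SimpleGraph V} {N : ℕ}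
    {f : ℕ → V} (h : MMPath G N f) (hN : Fintype.card V = N) (v : V) : ∃ i < N, f i = v := by
  have h1 : (Finset.range N).image f = Finset.univ := by
    apply Finset.eq_univ_of_card
    rw [Finset.card_image_of_injOn, Finset.card_range, hN]
    intro i hi j hj hij
    simp only [Finset.coe_range, Set.mem_Iio] at hi hj
    exact h.1 i j hi hj hij
  have := h1 ▸ Finset.mem_univ v
  simpa using this

lemma MMPath.walk {V : Type*} {G : SimpleGraph V} {N : ℕ}
    {f : ℕ → V} (h : MMPath G N f) (k : ℕ) (hk : k < N) :
    ∃ w : G.Walk (f 0) (f k), w.support = (List.range (k + 1)).map f ∧ w.length = k := by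
  induction k with
  | zero => exact ⟨.nil, by simp, by simp⟩
  | succ k ih =>
    obtain ⟨w, hw, hl⟩ := ih (by omega)
    refine ⟨w.concat (h.2 k hk), ?_, by simp [hl]⟩
    rw [SimpleGraph.Walk.support_concat, hw, List.range_succ (n := k + 1)]
    simp

lemma MMCycle.ham {V : Type*} [Fintype V] [DecidableEq V] {G : SimpleGraph V} {N : ℕ}
    (h : MMCycle G N) (hN : Fintype.card V = N) (h3 : 3 ≤ N) :
    ∃ (v : V) (c : G.Walk v v), c.IsHamiltonianCycle := by
  obtain ⟨f, hf, hc⟩ := h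
  obtain ⟨w, hw, hl⟩ := hf.walk (N - 1) (by omega)
  have hp : w.IsPath := by
    rw [SimpleGraph.Walk.isPath_def, hw]
    refine List.Nodup.map_on ?_ List.nodup_range
    intro i hi j hj hij
    simp only [List.mem_range] at hi hj
    exact hf.1 i j (by omega) (by omega) hij
  refine ⟨_, .cons hc w, ?_⟩
  rw [SimpleGraph.Walk.isHamiltonianCycle_iff_isCycle_and_length_eq]
  refine ⟨(SimpleGraph.Walk.cons_isCycle_iff _ _).2 ⟨hp, fun he => ?_⟩, ?_⟩
  · rw [Sym2.eq_swap] at he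
    have := hp.length_eq_one_of_mem_edges he
    omega
  · rw [SimpleGraph.Walk.length_cons, hl, hN]; omega

lemma MMBip.alt {V : Type*} [Fintype V] [DecidableEq V] {G : SimpleGraph V} {n : ℕ}
    {X Y : Finset V} (h : MMBip G n X Y) {f : ℕ → V} (hf : MMPath G (2 * n) f)
    (h0 : f 0 ∈ X) (k : ℕ) (hk : k < n) : f (2 * k) ∈ X ∧ f (2 * k + 1) ∈ Y := by
  have hd : ∀ v, v ∈ X → v ∈ Y → False := fun v => by
    have := h.disj
    rw [Finset.disjoint_left] at this
    exact this (a := v)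
  induction k with
  | zero =>
    refine ⟨h0, ?_⟩
    rcases h.bip _ _ (hf.2 0 (by omega)) with h1 | h1
    · exact h1.2
    · exact (hd _ h0 h1.1).elim
  | succ k ih =>
    have ih := ih (by omega)
    have e1 : f (2 * (k + 1)) ∈ X := by
      rcases h.bip _ _ (hf.2 (2 * k + 1) (by omega)) with h1 | h1
      · exact (hd _ h1.1 ih.2).elim
      · exact h1.2
    refine ⟨e1, ?_⟩
    rcases h.bip _ _ (hf.2 (2 * (k + 1)) (by omega)) with h1 | h1
    · exact h1.2
    · exact (hd _ e1 h1.1).elim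

open Classical in
lemma MMBip.cross {V : Type*} [Fintype V] [DecidableEq V] {G : SimpleGraph V} {n : ℕ}
    {X Y : Finset V} (h : MMBip G n X Y) {f : ℕ → V} (hf : MMPath G (2 * n) f)
    (h0 : f 0 ∈ X)
    (hd : n < (Finset.univ.filter (G.Adj (f 0))).card +
      (Finset.univ.filter (G.Adj (f (2 * n - 1)))).card) : MMCycle G (2 * n) := by
  have hdj : ∀ v, v ∈ X → v ∈ Y → False := fun v => by
    have := h.disj
    rw [Finset.disjoint_left] at this
    exact this (a := v)
  have hn : 0 < n := by
    rcases Nat.eq_zero_or_pos n with h1 | h1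
    · have := h.hX
      rw [h1, Finset.card_eq_zero] at this
      simp [this] at h0
    · exact h1
  have hlast : f (2 * n - 1) ∈ Y := by
    have := (h.alt hf h0 (n - 1) (by omega)).2
    rwa [show 2 * (n - 1) + 1 = 2 * n - 1 by omega] at this
  set A := (Finset.range n).filter (fun k => G.Adj (f 0) (f (2 * k + 1))) with hA
  set B := (Finset.range n).filter (fun k => G.Adj (f (2 * n - 1)) (f (2 * k))) with hB
  have cA : (Finset.univ.filter (G.Adj (f 0))).card ≤ A.card := by
    refine (Finset.card_le_card ?_).trans (Finset.card_image_le (f := fun k => f (2 * k + 1)))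
    intro v hv
    simp only [Finset.mem_filter, Finset.mem_univ, true_and] at hv
    obtain ⟨i, hi, rfl⟩ := hf.surj h.card v
    obtain ⟨k, hk | hk⟩ := i.even_or_odd'
    · subst hk
      have := (h.alt hf h0 k (by omega)).1
      rcases h.bip _ _ hv with h1 | h1
      · exact (hdj _ this h1.2).elim
      · exact (hdj _ h0 h1.1).elim
    · subst hk
      simp only [Finset.mem_image, hA, Finset.mem_filter, Finset.mem_range]
      exact ⟨k, ⟨by omega, hv⟩, rfl⟩
  have cB : (Finset.univ.filter (G.Adj (f (2 * n - 1)))).card ≤ B.card := by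
    refine (Finset.card_le_card ?_).trans (Finset.card_image_le (f := fun k => f (2 * k)))
    intro v hv
    simp only [Finset.mem_filter, Finset.mem_univ, true_and] at hv
    obtain ⟨i, hi, rfl⟩ := hf.surj h.card v
    obtain ⟨k, hk | hk⟩ := i.even_or_odd'
    · subst hk
      simp only [Finset.mem_image, hB, Finset.mem_filter, Finset.mem_range]
      exact ⟨k, ⟨by omega, hv⟩, rfl⟩
    · subst hk
      have := (h.alt hf h0 k (by omega)).2
      rcases h.bip _ _ hv with h1 | h1
      · exact (hdj _ h1.1 hlast).elim
      · exact (hdj _ h1.2 this).elim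
  have hnd : ¬ Disjoint A B := by
    intro hAB
    have h1 := Finset.card_union_of_disjoint hAB
    have h2 : (A ∪ B).card ≤ (Finset.range n).card :=
      Finset.card_le_card (Finset.union_subset (Finset.filter_subset _ _)
        (Finset.filter_subset _ _))
    rw [Finset.card_range] at h2
    omega
  obtain ⟨k, hkA, hkB⟩ := Finset.not_disjoint_iff.1 hnd
  simp only [hA, hB, Finset.mem_filter, Finset.mem_range] at hkA hkB
  obtain ⟨hk, hkA⟩ := hkA
  have hkB := hkB.2
  refine ⟨fun j => if j ≤ 2 * k then f j else f (2 * n + 2 * k - j), ⟨?_, ?_⟩, ?_⟩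
  · intro i j hi hj hij
    dsimp only at hij
    split_ifs at hij with h1 h2 h2 <;> have := hf.1 _ _ (by omega) (by omega) hij <;> omega
  · intro i hi
    dsimp only
    split_ifs with h1 h2 h2
    · exact hf.2 i hi
    · have e1 : i = 2 * k := by omega
      have e2 : 2 * n + 2 * k - (i + 1) = 2 * n - 1 := by omega
      rw [e2, e1]
      exact hkB.symm
    · omega
    · have := hf.2 (2 * n + 2 * k - (i + 1)) (by omega)
      rw [show 2 * n + 2 * k - (i + 1) + 1 = 2 * n + 2 * k - i by omega] at this
      exact this.symm
  · dsimp only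
    rw [if_neg (by omega), if_pos (by omega),
      show 2 * n + 2 * k - (2 * n - 1) = 2 * k + 1 by omega]
    exact hkA.symm

/-- Removing an edge from a cycle. -/
lemma MMCycle.remove {V : Type*} {G : SimpleGraph V} {N : ℕ} (hN : 3 ≤ N) {x y : V}
    (h : MMCycle (G ⊔ SimpleGraph.edge x y) N) (hno : ¬ MMCycle G N) :
    ∃ g, MMPath G N g ∧ ((g 0 = x ∧ g (N - 1) = y) ∨ (g 0 = y ∧ g (N - 1) = x)) := by
  obtain ⟨f, hf, hc⟩ := h
  have hadj : ∀ u v, (G ⊔ SimpleGraph.edge x y).Adj u v →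
      G.Adj u v ∨ (u = x ∧ v = y) ∨ (u = y ∧ v = x) := by
    intro u v huv
    rw [SimpleGraph.sup_adj, SimpleGraph.edge_adj] at huv
    tauto
  have hcyc : ∀ i, i < N → (G ⊔ SimpleGraph.edge x y).Adj (f i) (f ((i + 1) % N)) := by
    intro i hi
    by_cases h1 : i + 1 < N
    · rw [Nat.mod_eq_of_lt h1]; exact hf.2 i h1
    · have e : i = N - 1 := by omega
      have e2 : (i + 1) % N = 0 := by rw [show i + 1 = N by omega, Nat.mod_self]
      rw [e2, e]; exact hc
  by_cases hall : ∀ i, i < N → G.Adj (f i) (f ((i + 1) % N))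
  · exfalso
    apply hno
    refine ⟨f, ⟨hf.1, fun i hi => ?_⟩, ?_⟩
    · have := hall i (by omega)
      rwa [Nat.mod_eq_of_lt hi] at this
    · have := hall (N - 1) (by omega)
      rwa [show N - 1 + 1 = N by omega, Nat.mod_self] at this
  push Not at hall
  obtain ⟨i, hi, hna⟩ := hall
  have hxy := (hadj _ _ (hcyc i hi)).resolve_left hna
  have hlt : ∀ m, m % N < N := fun m => Nat.mod_lt _ (by omega)
  have hmod : ∀ m, m < 2 * N → (m < N ∧ m % N = m) ∨ (N ≤ m ∧ m % N = m - N) := by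
    intro m hm
    by_cases h1 : m < N
    · exact Or.inl ⟨h1, Nat.mod_eq_of_lt h1⟩
    · refine Or.inr ⟨by omega, ?_⟩
      rw [Nat.mod_eq_sub_mod (by omega), Nat.mod_eq_of_lt (by omega)]
  refine ⟨fun j => f ((i + 1 + j) % N), ⟨?_, ?_⟩, ?_⟩
  · intro a b ha hb hab
    have := hf.1 _ _ (hlt _) (hlt _) hab
    have h1 := hmod (i + 1 + a) (by omega)
    have h2 := hmod (i + 1 + b) (by omega)
    omega
  · intro j hj
    dsimp only
    have h1 := hmod (i + 1 + j) (by omega)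
    have h2 := hmod (i + 1 + (j + 1)) (by omega)
    have h3 := hmod ((i + 1 + j) % N + 1) (by have := hlt (i + 1 + j); omega)
    have h4 := hmod (i + 1) (by omega)
    have e : ((i + 1 + j) % N + 1) % N = (i + 1 + (j + 1)) % N := by omega
    have := hcyc ((i + 1 + j) % N) (hlt _)
    rw [e] at this
    rcases hadj _ _ this with h5 | h5
    · exact h5
    · exfalso
      have key : (f ((i + 1 + j) % N) = f i) ∨
          (f ((i + 1 + j) % N) = f ((i + 1) % N) ∧ f ((i + 1 + (j + 1)) % N) = f i) := by
        rcases h5 with ⟨a, b⟩ | ⟨a, b⟩ <;> rcases hxy with ⟨c, d⟩ | ⟨c, d⟩ <;>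
          simp only [a, b, c, d, and_self, true_or, or_true]
      rcases key with h6 | ⟨h6, h7⟩
      · have := hf.1 _ _ (hlt _) hi h6
        omega
      · have := hf.1 _ _ (hlt _) (hlt _) h6
        have := hf.1 _ _ (hlt _) hi h7
        omega
  · dsimp only
    have h2 := hmod (i + 1 + (N - 1)) (by omega)
    have e : (i + 1 + (N - 1)) % N = i := by omega
    rw [e, Nat.add_zero]
    tauto

lemma MMBip.complete {V : Type*} [Fintype V] [DecidableEq V] {G : SimpleGraph V} {n : ℕ}
    {X Y : Finset V} (h : MMBip G n X Y) (hn : 2 ≤ n)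
    (hc : ∀ x ∈ X, ∀ y ∈ Y, G.Adj x y) : MMCycle G (2 * n) := by
  have hdj : ∀ v, v ∈ X → v ∈ Y → False := fun v => by
    have := h.disj
    rw [Finset.disjoint_left] at this
    exact this (a := v)
  let a := X.equivFinOfCardEq h.hX
  let b := Y.equivFinOfCardEq h.hY
  have hlt : ∀ m, m % n < n := fun m => Nat.mod_lt _ (by omega)
  let f : ℕ → V := fun i => if i % 2 = 0 then (a.symm ⟨(i / 2) % n, hlt _⟩ : V)
    else (b.symm ⟨(i / 2) % n, hlt _⟩ : V)
  have fe : ∀ i, i % 2 = 0 → f i = (a.symm ⟨(i / 2) % n, hlt _⟩ : V) := fun i hi => if_pos hi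
  have fo : ∀ i, ¬ i % 2 = 0 → f i = (b.symm ⟨(i / 2) % n, hlt _⟩ : V) := fun i hi => if_neg hi
  have feX : ∀ i, i % 2 = 0 → f i ∈ X := fun i hi => by rw [fe i hi]; exact Subtype.prop _
  have foY : ∀ i, ¬ i % 2 = 0 → f i ∈ Y := fun i hi => by rw [fo i hi]; exact Subtype.prop _
  refine ⟨f, ⟨?_, ?_⟩, ?_⟩
  · intro i j hi hj hij
    by_cases h1 : i % 2 = 0 <;> by_cases h2 : j % 2 = 0
    · rw [fe i h1, fe j h2] at hij
      have := a.symm.injective (Subtype.ext hij)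
      simp only [Fin.mk.injEq] at this
      rw [Nat.mod_eq_of_lt (by omega), Nat.mod_eq_of_lt (by omega)] at this
      omega
    · exact (hdj _ (feX i h1) (hij ▸ foY j h2)).elim
    · exact (hdj _ (feX j h2) (hij ▸ foY i h1)).elim
    · rw [fo i h1, fo j h2] at hij
      have := b.symm.injective (Subtype.ext hij)
      simp only [Fin.mk.injEq] at this
      rw [Nat.mod_eq_of_lt (by omega), Nat.mod_eq_of_lt (by omega)] at this
      omega
  · intro i hi
    by_cases h1 : i % 2 = 0
    · exact hc _ (feX i h1) _ (foY (i + 1) (by omega))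
    · exact (hc _ (feX (i + 1) (by omega)) _ (foY i h1)).symm
  · exact (hc _ (feX 0 (by omega)) _ (foY _ (by omega))).symm

open Classical in
/-- The counting step, for one orientation. -/
lemma MMBip.count {V : Type*} [Fintype V] [DecidableEq V] {G : SimpleGraph V} {n r : ℕ}
    {X Y : Finset V} (h : MMBip G n X Y) (hr2 : r ≤ n / 2)
    (hδ : ∀ v : V, r ≤ (Finset.univ.filter (G.Adj v)).card) {x y : V} (hx : x ∈ X) (hy : y ∈ Y)
    (hle : (Finset.univ.filter (G.Adj x)).card ≤ (Finset.univ.filter (G.Adj y)).card)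
    (hsum : (Finset.univ.filter (G.Adj x)).card + (Finset.univ.filter (G.Adj y)).card ≤ n)
    (hmax : ∀ x' ∈ X, ¬ G.Adj x' y →
      (Finset.univ.filter (G.Adj x')).card ≤ (Finset.univ.filter (G.Adj x)).card) :
    ∑ v ∈ X, (Finset.univ.filter (G.Adj v)).card ≤ n * (n - r) + r ^ 2 := by
  have hdj : ∀ v, v ∈ X → v ∈ Y → False := fun v => by
    have := h.disj
    rw [Finset.disjoint_left] at this
    exact this (a := v)
  set k := (Finset.univ.filter (G.Adj x)).card with hk
  have hdeg : ∀ v ∈ X, (Finset.univ.filter (G.Adj v)).card ≤ n := by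
    intro v hv
    rw [← h.hY]
    apply Finset.card_le_card
    intro w hw
    simp only [Finset.mem_filter, Finset.mem_univ, true_and] at hw
    rcases h.bip _ _ hw with h1 | h1
    · exact h1.2
    · exact (hdj _ hv h1.1).elim
  have hS : k ≤ (X.filter (fun v => ¬ G.Adj v y)).card := by
    have h1 := Finset.card_filter_add_card_filter_not (s := X) (fun v => G.Adj v y)
    have h2 : (X.filter (fun v => G.Adj v y)).card ≤ (Finset.univ.filter (G.Adj y)).card := by
      apply Finset.card_le_card
      intro w hw
      simp only [Finset.mem_filter, Finset.mem_univ, true_and] at hw ⊢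
      exact hw.2.symm
    rw [h.hX] at h1
    omega
  obtain ⟨T, hT, hTc⟩ := Finset.exists_subset_card_eq hS
  have hTX : T ⊆ X := hT.trans (Finset.filter_subset _ _)
  have e1 : ∑ v ∈ T, (Finset.univ.filter (G.Adj v)).card ≤ T.card * k := by
    rw [← smul_eq_mul]
    refine Finset.sum_le_card_nsmul _ _ _ fun v hv => ?_
    have := hT hv
    simp only [Finset.mem_filter] at this
    exact hmax v this.1 this.2
  have e2 : ∑ v ∈ X \ T, (Finset.univ.filter (G.Adj v)).card ≤ (X \ T).card * n := by
    rw [← smul_eq_mul]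
    refine Finset.sum_le_card_nsmul _ _ _ fun v hv => ?_
    exact hdeg v (Finset.mem_sdiff.1 hv).1
  have e3 := Finset.sum_sdiff (f := fun v => (Finset.univ.filter (G.Adj v)).card) hTX
  rw [Finset.card_sdiff_of_subset hTX, h.hX, hTc] at e2
  rw [hTc] at e1
  have hrk : r ≤ k := hδ x
  have hkn : 2 * k ≤ n := by omega
  have hrn : r ≤ n := by omega
  have hkn' : k ≤ n := by omega
  rw [← e3]
  refine (add_le_add e2 e1).trans ?_
  zify [hrn, hkn'] at *
  nlinarith [mul_nonneg (sub_nonneg.2 hrk) (show (0 : ℤ) ≤ n - k - r by linarith)]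

/-- **Moon–Moser (1963).** Let `G` be a balanced bipartite graph on `2n` vertices with parts
`X` and `Y` of size `n`, and minimum degree at least `r` where `1 ≤ r ≤ n/2`.
If `e(G) > n(n-r) + r²`, then `G` contains a Hamilton cycle. -/
theorem stmt_2 {V : Type*} [Fintype V] [DecidableEq V]
    (G : SimpleGraph V) [DecidableRel G.Adj] (n r : ℕ)
    (X Y : Finset V) (hdisj : Disjoint X Y) (hunion : X ∪ Y = Finset.univ)
    (hX : X.card = n) (hY : Y.card = n)
    (hbip : ∀ x y : V, G.Adj x y → (x ∈ X ∧ y ∈ Y) ∨ (x ∈ Y ∧ y ∈ X))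
    (hr1 : 1 ≤ r) (hr2 : r ≤ n / 2)
    (hδ : ∀ v : V, r ≤ G.degree v)
    (he : n * (n - r) + r ^ 2 < G.edgeFinset.card) :
    ∃ (v : V) (c : G.Walk v v), c.IsHamiltonianCycle := by
  classical
  have hB : MMBip G n X Y := ⟨hdisj, hunion, hX, hY, hbip⟩
  have hn : 2 ≤ n := by omega
  by_cases hno : MMCycle G (2 * n)
  · exact hno.ham hB.card (by omega)
  exfalso
  obtain ⟨H, hGH, hH⟩ := Finite.exists_le_maximal
    (p := fun H : SimpleGraph V => MMBip H n X Y ∧ ¬ MMCycle H (2 * n)) ⟨hB, hno⟩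
  obtain ⟨⟨hHB, hHno⟩, hHmax⟩ := hH
  let d : V → ℕ := fun v => (Finset.univ.filter (H.Adj v)).card
  have hGd : ∀ v, G.degree v ≤ d v := by
    intro v
    rw [← SimpleGraph.card_neighborFinset_eq_degree]
    apply Finset.card_le_card
    intro w hw
    rw [SimpleGraph.mem_neighborFinset] at hw
    simp only [Finset.mem_filter, Finset.mem_univ, true_and]
    exact hGH hw
  have hδ' : ∀ v, r ≤ d v := fun v => (hδ v).trans (hGd v)
  have hGB : G.IsBipartiteWith (X : Set V) (Y : Set V) :=
    ⟨Finset.disjoint_coe.2 hdisj, fun v w hvw => by simpa using hbip v w hvw⟩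
  have heX : n * (n - r) + r ^ 2 < ∑ v ∈ X, d v := by
    refine lt_of_lt_of_le he ?_
    rw [← SimpleGraph.isBipartiteWith_sum_degrees_eq_card_edges hGB]
    exact Finset.sum_le_sum fun v _ => hGd v
  have heY : n * (n - r) + r ^ 2 < ∑ v ∈ Y, d v := by
    refine lt_of_lt_of_le he ?_
    rw [← SimpleGraph.isBipartiteWith_sum_degrees_eq_card_edges' hGB]
    exact Finset.sum_le_sum fun v _ => hGd v
  have hclos : ∀ x ∈ X, ∀ y ∈ Y, ¬ H.Adj x y → d x + d y ≤ n := by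
    intro x hx y hy hxy
    by_contra hlt
    push Not at hlt
    have hne : x ≠ y := fun hh => Finset.disjoint_left.1 hdisj hx (hh ▸ hy)
    have hB' : MMBip (H ⊔ SimpleGraph.edge x y) n X Y := by
      refine ⟨hdisj, hunion, hX, hY, fun u v huv => ?_⟩
      rw [SimpleGraph.sup_adj, SimpleGraph.edge_adj] at huv
      rcases huv with h1 | ⟨⟨rfl, rfl⟩ | ⟨rfl, rfl⟩, _⟩
      · exact hHB.bip u v h1
      · exact Or.inl ⟨hx, hy⟩
      · exact Or.inr ⟨hy, hx⟩
    have hcyc : MMCycle (H ⊔ SimpleGraph.edge x y) (2 * n) := by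
      by_contra hcon
      have := hHmax (y := H ⊔ SimpleGraph.edge x y) ⟨hB', hcon⟩ le_sup_left
      apply hxy
      apply this
      rw [SimpleGraph.sup_adj, SimpleGraph.edge_adj]
      exact Or.inr ⟨Or.inl ⟨rfl, rfl⟩, hne⟩
    obtain ⟨g, hg, ⟨h0, h1⟩ | ⟨h0, h1⟩⟩ := hcyc.remove (by omega) hHno
    · exact hHno (hHB.cross hg (h0 ▸ hx) (by rw [h0, h1]; exact hlt))
    · exact hHno (hHB.symm.cross hg (h0 ▸ hy) (by rw [h0, h1, add_comm]; exact hlt))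
  let S := (X ×ˢ Y).filter (fun p => ¬ H.Adj p.1 p.2)
  have hS : S.Nonempty := by
    by_contra hemp
    apply hHno
    apply hHB.complete hn
    intro x hx y hy
    by_contra hxy
    exact hemp ⟨(x, y), by simp [S, hx, hy, hxy]⟩
  obtain ⟨⟨x, y⟩, hp, hmax⟩ := Finset.exists_max_image S (fun p => d p.1 + d p.2) hS
  simp only [S, Finset.mem_filter, Finset.mem_product] at hp hmax
  obtain ⟨⟨hx, hy⟩, hxy⟩ := hp
  have hsum := hclos x hx y hy hxy
  rcases le_total (d x) (d y) with hle | hle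
  · refine absurd heX (not_lt.2 (hHB.count hr2 hδ' hx hy hle hsum ?_))
    intro x' hx' hna
    have := hmax (x', y) ⟨⟨hx', hy⟩, hna⟩
    exact Nat.le_of_add_le_add_right this
  · refine absurd heY (not_lt.2 (hHB.symm.count hr2 hδ' hy hx hle
      (by rw [add_comm]; exact hsum) ?_))
    intro y' hy' hna
    have := hmax (x, y') ⟨⟨hx, hy'⟩, fun hh => hna hh.symm⟩
    exact Nat.le_of_add_le_add_left this
end

section
/- Let G = (X, Y; E) be a bipartite graph with |X| = n, |Y| = b, where b ≥ n ≥ n-k ≥ 2. If e(G) > (b-1)(n-k-1) + n when n ≤ 2(n-k) - 2, or e(G) > (b - n + 2k + 3)(n-k-1) when n ≥ 2(n-k) - 2, then G contains a cycle of length at least 2n - 2k. -/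
namespace Jackson

open Finset

/-- `PathOn H u w S`: there is a path of `H` from `u` to `w` with vertex set exactly `S`. -/
inductive PathOn {V : Type*} [DecidableEq V] (H : SimpleGraph V) : V → V → Finset V → Prop
  | single (u : V) : PathOn H u u {u}
  | cons (u a w : V) (S : Finset V) (h : H.Adj u a) (hu : u ∉ S) (hp : PathOn H a w S) :
      PathOn H u w (insert u S)

section paths
variable {V : Type*} [DecidableEq V] {H : SimpleGraph V}

theorem PathOn.left_mem {u w : V} {S : Finset V} (h : PathOn H u w S) : u ∈ S := by
  cases h <;> simp

theorem PathOn.right_mem {u w : V} {S : Finset V} (h : PathOn H u w S) : w ∈ S := by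
  induction h with
  | single u => simp
  | cons u a w S h hu hp ih => simp [ih]

theorem PathOn.join_adj {u a b w : V} {S T : Finset V} (h1 : PathOn H u a S) (hab : H.Adj a b)
    (h2 : PathOn H b w T) (hd : ∀ z, z ∈ S → z ∈ T → False) : PathOn H u w (S ∪ T) := by
  induction h1 with
  | single u =>
    rw [← Finset.insert_eq]
    exact PathOn.cons _ _ _ _ hab (fun h => hd u (by simp) h) h2
  | cons u a' a S h hu hp ih =>
    rw [Finset.insert_union]
    refine PathOn.cons _ _ _ _ h ?_ (ih hab (fun z hz hz' => hd z (by simp [hz]) hz'))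
    intro hh
    rcases Finset.mem_union.1 hh with hh | hh
    · exact hu hh
    · exact hd u (by simp) hh

theorem PathOn.symm {u w : V} {S : Finset V} (h : PathOn H u w S) : PathOn H w u S := by
  induction h with
  | single u => exact PathOn.single u
  | cons u a w S h hu hp ih =>
    have := ih.join_adj h.symm (PathOn.single u) (by
      intro z hz hz'; simp at hz'; subst hz'; exact hu hz)
    rwa [Finset.union_comm, ← Finset.insert_eq] at this

/-- split a path after a vertex `z` which is not the last one -/
theorem PathOn.split {u w z : V} {S : Finset V} (h : PathOn H u w S) (hz : z ∈ S) :
    z = w ∨ ∃ z' S1 S2, PathOn H u z S1 ∧ H.Adj z z' ∧ PathOn H z' w S2 ∧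
      (∀ y, y ∈ S1 → y ∈ S2 → False) ∧ S = S1 ∪ S2 := by
  induction h with
  | single u => left; simpa using hz
  | cons u a w S h hu hp ih =>
    by_cases hzu : z = u
    · subst hzu
      right
      refine ⟨a, {z}, S, PathOn.single _, h, hp, ?_, by rw [← Finset.insert_eq]⟩
      intro y hy hy'; simp at hy; subst hy; exact hu hy'
    · have hz' : z ∈ S := by simpa [hzu] using hz
      rcases ih hz' with h1 | ⟨z', S1, S2, h1, h2, h3, h4, h5⟩
      · exact Or.inl h1
      · right
        refine ⟨z', insert u S1, S2, PathOn.cons _ _ _ _ h ?_ h1, h2, h3, ?_, ?_⟩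
        · intro hh; apply hu; rw [h5]; simp [hh]
        · intro y hy hy'
          rcases Finset.mem_insert.1 hy with rfl | hy
          · apply hu; rw [h5]; simp [hy']
          · exact h4 y hy hy'
        · rw [h5, Finset.insert_union]

/-- the part of the path from `z` on -/
theorem PathOn.drop {u w z : V} {S : Finset V} (h : PathOn H u w S) (hz : z ∈ S) :
    ∃ T ⊆ S, PathOn H z w T ∧ (z ≠ u → u ∉ T) := by
  induction h with
  | single u =>
    simp at hz; subst hz
    exact ⟨{z}, by simp, PathOn.single _, by simp⟩
  | cons u a w S h hu hp ih =>
    by_cases hzu : z = u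
    · subst hzu
      exact ⟨_, subset_rfl, PathOn.cons _ _ _ _ h hu hp, by simp⟩
    · have hz' : z ∈ S := by simpa [hzu] using hz
      obtain ⟨T, hT, h1, h2⟩ := ih hz'
      exact ⟨T, hT.trans (Finset.subset_insert _ _), h1, fun _ hh => hu (hT hh)⟩

theorem PathOn.unsnoc {u w : V} {S : Finset V} (h : PathOn H u w S) (hne : u ≠ w) :
    ∃ w', PathOn H u w' (S.erase w) ∧ H.Adj w' w := by
  have h' := h.symm
  cases h' with
  | single u => exact absurd rfl hne
  | cons _ a _ S hadj hu hp =>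
    refine ⟨a, ?_, hadj.symm⟩
    rw [Finset.erase_insert hu]; exact hp.symm

theorem PathOn.uncons {u w : V} {S : Finset V} (h : PathOn H u w S) (hne : u ≠ w) :
    ∃ u', PathOn H u' w (S.erase u) ∧ H.Adj u u' := by
  obtain ⟨w', h1, h2⟩ := h.symm.unsnoc hne.symm
  exact ⟨w', h1.symm, h2.symm⟩

theorem PathOn.join {u a w : V} {S T : Finset V} (h1 : PathOn H u a S)
    (h2 : PathOn H a w T) (hd : ∀ z, z ∈ S → z ∈ T → z = a) : PathOn H u w (S ∪ T) := by
  by_cases hne : a = w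
  · subst hne
    have : T = {a} := by
      cases h2 with
      | single => rfl
      | cons _ b _ T h hu hp => exact absurd hp.right_mem hu
    subst this
    rwa [Finset.union_eq_left.2 (by simpa using h1.right_mem)]
  · obtain ⟨a', h3, h4⟩ := h2.uncons hne
    have := h1.join_adj h4 h3 (by
      intro z hz hz'
      rw [Finset.mem_erase] at hz'
      exact hz'.1 (hd z hz hz'.2))
    convert this using 1
    ext z
    simp only [Finset.mem_union, Finset.mem_erase]
    constructor
    · rintro (h | h)
      · exact Or.inl h
      · by_cases hz : z = a
        · subst hz; exact Or.inl h1.right_mem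
        · exact Or.inr ⟨hz, h⟩
    · rintro (h | h)
      · exact Or.inl h
      · exact Or.inr h.2

/-- closed path (cycle, or a single edge) with vertex set `C` -/
def Cyc {V : Type*} [DecidableEq V] (H : SimpleGraph V) (C : Finset V) : Prop :=
  ∃ a b, PathOn H a b C ∧ H.Adj b a

theorem Cyc.of_two {u w : V} {S T : Finset V} (h1 : PathOn H u w S) (h2 : PathOn H u w T)
    (hne : u ≠ w) (hd : ∀ z, z ∈ S → z ∈ T → z = u ∨ z = w) : Cyc H (S ∪ T) := by
  obtain ⟨w', h3, h4⟩ := h2.unsnoc hne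
  have := h1.symm.join h3 (by
    intro z hz hz'
    rw [Finset.mem_erase] at hz'
    exact (hd z hz hz'.2).resolve_right hz'.1)
  refine ⟨w, w', ?_, h4⟩
  convert this using 1
  ext z
  simp only [Finset.mem_union, Finset.mem_erase]
  constructor
  · rintro (h | h)
    · exact Or.inl h
    · by_cases hz : z = w
      · subst hz; exact Or.inl h1.right_mem
      · exact Or.inr ⟨hz, h⟩
  · rintro (h | h)
    · exact Or.inl h
    · exact Or.inr h.2

theorem Cyc.rotate {C : Finset V} (h : Cyc H C) {u : V} (hu : u ∈ C) :
    ∃ c, PathOn H c u C := by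
  obtain ⟨a, b, hp, hba⟩ := h
  rcases hp.split hu with rfl | ⟨z', S1, S2, h1, h2, h3, h4, h5⟩
  · exact ⟨a, hp⟩
  · refine ⟨z', ?_⟩
    rw [h5, Finset.union_comm]
    exact h3.join_adj hba h1 (fun z hz hz' => h4 z hz' hz)

theorem PathOn.mono {H G : SimpleGraph V} (hle : ∀ a b, H.Adj a b → G.Adj a b) {u w : V}
    {S : Finset V} (h : PathOn H u w S) : PathOn G u w S := by
  induction h with
  | single u => exact PathOn.single u
  | cons u a w S h hu hp ih => exact PathOn.cons _ _ _ _ (hle _ _ h) hu ih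

theorem PathOn.exists_walk {u w : V} {S : Finset V} (h : PathOn H u w S) :
    ∃ p : H.Walk u w, p.IsPath ∧ (∀ z, z ∈ p.support ↔ z ∈ S) ∧ p.length + 1 = S.card := by
  induction h with
  | single u => exact ⟨SimpleGraph.Walk.nil, by simp, by simp, by simp⟩
  | cons u a w S h hu hp ih =>
    obtain ⟨p, h1, h2, h3⟩ := ih
    refine ⟨SimpleGraph.Walk.cons h p, ?_, ?_, ?_⟩
    · rw [SimpleGraph.Walk.cons_isPath_iff]
      exact ⟨h1, fun hh => hu ((h2 _).1 hh)⟩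
    · intro z; simp [h2]
    · rw [Finset.card_insert_of_notMem hu]; simp [h3]

theorem Cyc.exists_cycle {C : Finset V} (h : Cyc H C) (h3 : 3 ≤ C.card) :
    ∃ (v : V) (c : H.Walk v v), c.IsCycle ∧ c.length = C.card := by
  obtain ⟨a, b, hp, hba⟩ := h
  obtain ⟨p, h1, h2, h4⟩ := hp.exists_walk
  refine ⟨b, SimpleGraph.Walk.cons hba p, ?_, by simp [h4]⟩
  rw [SimpleGraph.Walk.cons_isCycle_iff]
  refine ⟨h1, fun hh => ?_⟩
  have hl : p.length = 1 := by
    have := h1.length_eq_one_of_mem_edges (by rwa [Sym2.eq_swap] at hh)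
    exact this
  omega

/-- number of vertices of `X` on a path in a bipartite graph -/
theorem PathOn.count {X : Finset V} (hX : ∀ a b, H.Adj a b → (a ∈ X ↔ b ∉ X)) {u w : V}
    {S : Finset V} (h : PathOn H u w S) :
    2 * (S.filter (· ∈ X)).card + 1 =
      S.card + (if u ∈ X then 1 else 0) + (if w ∈ X then 1 else 0) := by
  induction h with
  | single u =>
    by_cases hu : u ∈ X <;> simp [Finset.filter_singleton, hu]
  | cons u a w S h hu hp ih =>
    rw [Finset.card_insert_of_notMem hu, Finset.filter_insert]
    have h1 := hX _ _ h
    by_cases hu' : u ∈ X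
    · have h2 := h1.1 hu'
      rw [if_pos hu', Finset.card_insert_of_notMem (by simp [hu])]
      simp only [hu', h2, if_true, if_false] at ih ⊢
      omega
    · have h2 : a ∈ X := by
        by_contra h2; exact hu' (h1.2 h2)
      rw [if_neg hu']
      simp only [hu', h2, if_true, if_false] at ih ⊢
      omega

theorem Cyc.count {X : Finset V} (hX : ∀ a b, H.Adj a b → (a ∈ X ↔ b ∉ X)) {C : Finset V}
    (h : Cyc H C) : 2 * (C.filter (· ∈ X)).card = C.card := by
  obtain ⟨a, b, hp, hba⟩ := h
  have h1 := hp.count hX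
  have h2 := hX _ _ hba
  by_cases hb : b ∈ X
  · simp only [hb, h2.1 hb, if_true, if_false] at h1; omega
  · have h2 : a ∈ X := by
      by_contra h3; exact hb (h2.2 h3)
    simp only [hb, h2, if_true, if_false] at h1; omega

/-- segments of an indexed path -/
theorem PathOn.seg {v : ℕ → V} {N : ℕ} (hinj : ∀ i j, i ≤ N → j ≤ N → v i = v j → i = j)
    (hadj : ∀ i, i < N → H.Adj (v i) (v (i + 1))) (i j : ℕ) (hij : i ≤ j) (hj : j ≤ N) :
    PathOn H (v i) (v j) ((Finset.Icc i j).image v) := by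
  induction j, hij using Nat.le_induction with
  | base => simpa using PathOn.single (v i)
  | succ j hij ih =>
    have := (ih (by omega)).join_adj (hadj j (by omega)) (PathOn.single (v (j + 1))) (by
      intro z hz hz'
      simp at hz hz'
      obtain ⟨k, hk, rfl⟩ := hz
      have := hinj _ _ (by omega) (by omega) hz'
      omega)
    convert this using 1
    ext z
    simp only [Finset.mem_image, Finset.mem_Icc, Finset.mem_union, Finset.mem_singleton]
    constructor
    · rintro ⟨k, hk, rfl⟩
      rcases Nat.lt_or_ge k (j + 1) with h | h
      · exact Or.inl ⟨k, by omega, rfl⟩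
      · right; congr 1; omega
    · rintro (⟨k, hk, rfl⟩ | rfl)
      · exact ⟨k, by omega, rfl⟩
      · exact ⟨j + 1, by omega, rfl⟩

/-- indexing a path -/
theorem PathOn.exists_index {u w : V} {S : Finset V} (h : PathOn H u w S) :
    ∃ (v : ℕ → V) (N : ℕ), v 0 = u ∧ v N = w ∧
      (∀ i j, i ≤ N → j ≤ N → v i = v j → i = j) ∧
      (∀ i, i < N → H.Adj (v i) (v (i + 1))) ∧ S = (Finset.Icc 0 N).image v ∧ S.card = N + 1 := by
  induction h with
  | single u => exact ⟨fun _ => u, 0, rfl, rfl, by omega, by omega, by simp, by simp⟩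
  | cons u a w S h hu hp ih =>
    obtain ⟨v, N, h0, hN, hinj, hadj, hS, hc⟩ := ih
    have hmem : ∀ i, i ≤ N → v i ∈ S := fun i hi => by
      rw [hS]; exact Finset.mem_image_of_mem _ (by simp [hi])
    refine ⟨fun i => if i = 0 then u else v (i - 1), N + 1, by simp, by simp [hN], ?_, ?_, ?_, ?_⟩
    · intro i j hi hj hij
      rcases Nat.eq_zero_or_pos i with rfl | hi0 <;> rcases Nat.eq_zero_or_pos j with rfl | hj0
      · rfl
      · simp [hj0.ne'] at hij
        exact absurd (hij ▸ hmem (j - 1) (by omega)) hu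
      · simp [hi0.ne'] at hij
        exact absurd (hij ▸ hmem (i - 1) (by omega)) hu
      · simp [hi0.ne', hj0.ne'] at hij
        have := hinj _ _ (by omega) (by omega) hij
        omega
    · intro i hi
      rcases Nat.eq_zero_or_pos i with rfl | hi0
      · simpa [h0] using h
      · have := hadj (i - 1) (by omega)
        simp only [hi0.ne', if_false, Nat.add_sub_cancel, Nat.add_eq_zero_iff, one_ne_zero, and_false]
        rwa [show i - 1 + 1 = i by omega] at this
    · ext z
      simp only [Finset.mem_insert, hS, Finset.mem_image, Finset.mem_Icc]
      constructor
      · rintro (rfl | ⟨k, hk, rfl⟩)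
        · exact ⟨0, by omega, by simp⟩
        · exact ⟨k + 1, by omega, by simp⟩
      · rintro ⟨k, hk, rfl⟩
        rcases Nat.eq_zero_or_pos k with rfl | hk0
        · left; simp
        · right; exact ⟨k - 1, by omega, by simp [hk0.ne']⟩
    · rw [Finset.card_insert_of_notMem hu, hc]

end paths

section posa
variable {V : Type*} [DecidableEq V] {H : SimpleGraph V}

/-- removing any vertex of `Z` leaves `Z` connected -/
def TwoConn {V : Type*} [DecidableEq V] (H : SimpleGraph V) (Z : Finset V) : Prop :=
  ∀ v ∈ Z, ∀ S ⊆ Z.erase v, S.Nonempty → (Z.erase v \ S).Nonempty →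
    ∃ s ∈ S, ∃ t ∈ Z.erase v \ S, H.Adj s t

theorem TwoConn.reach {Z : Finset V} (hc : TwoConn H Z) {v : V} (hv : v ∈ Z) {A B : Finset V}
    {a b : V} (ha : a ∈ A) (haZ : a ∈ Z.erase v) (hb : b ∈ B) (hbZ : b ∈ Z.erase v) :
    ∃ u w R, PathOn H u w R ∧ v ∉ R ∧ u ∈ A ∧ w ∈ B ∧ (∀ z ∈ R, z ∈ A → z = u) ∧
      (∀ z ∈ R, z ∈ B → z = w) := by
  classical
  have hex : ∃ R, PathOn H a b R ∧ v ∉ R := by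
    by_contra hno
    set S := (Z.erase v).filter (fun w => ∃ R, PathOn H a w R ∧ v ∉ R) with hS
    obtain ⟨s, hs, t, ht, hst⟩ := hc v hv S (Finset.filter_subset _ _)
      ⟨a, by
        rw [hS, Finset.mem_filter]
        exact ⟨haZ, {a}, PathOn.single a, by
          simp only [Finset.mem_singleton]; rintro rfl; simp at haZ⟩⟩
      ⟨b, by
        rw [Finset.mem_sdiff, hS, Finset.mem_filter]
        exact ⟨hbZ, fun h => hno h.2⟩⟩
    rw [hS, Finset.mem_filter] at hs
    rw [Finset.mem_sdiff, hS, Finset.mem_filter] at ht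
    obtain ⟨hs1, R, hR, hvR⟩ := hs
    apply ht.2
    refine ⟨ht.1, ?_⟩
    by_cases htR : t ∈ R
    · obtain ⟨T, hT, h1, -⟩ := hR.symm.drop htR
      exact ⟨T, h1.symm, fun h => hvR (hT h)⟩
    · refine ⟨R ∪ {t}, hR.join_adj hst (PathOn.single t) ?_, ?_⟩
      · intro z hz hz'; simp at hz'; subst hz'; exact htR hz
      · have := ht.1
        simp only [Finset.mem_union, Finset.mem_singleton, not_or]
        refine ⟨hvR, ?_⟩
        rintro rfl; simp at this
  obtain ⟨R0, hR0, hvR0⟩ := hex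
  let P : ℕ → Prop := fun n => ∃ u w R, PathOn H u w R ∧ v ∉ R ∧ u ∈ A ∧ w ∈ B ∧ R.card = n
  have hP : ∃ n, P n := ⟨_, a, b, R0, hR0, hvR0, ha, hb, rfl⟩
  obtain ⟨u, w, R, h1, h2, h3, h4, h5⟩ := Nat.find_spec hP
  have hmin : ∀ u' w' R', PathOn H u' w' R' → v ∉ R' → u' ∈ A → w' ∈ B → R.card ≤ R'.card := by
    intro u' w' R' q1 q2 q3 q4
    rw [h5]
    exact Nat.find_min' hP ⟨u', w', R', q1, q2, q3, q4, rfl⟩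
  refine ⟨u, w, R, h1, h2, h3, h4, ?_, ?_⟩
  · intro z hz hzA
    by_contra hne
    obtain ⟨T, hT, q1, q2⟩ := h1.drop hz
    have := hmin z w T q1 (fun h => h2 (hT h)) hzA h4
    have hlt : T ⊂ R := (Finset.ssubset_iff_of_subset hT).2 ⟨u, h1.left_mem, q2 hne⟩
    have := Finset.card_lt_card hlt
    omega
  · intro z hz hzB
    by_contra hne
    obtain ⟨T, hT, q1, q2⟩ := h1.symm.drop hz
    have := hmin u z T q1.symm (fun h => h2 (hT h)) h3 hzB
    have hlt : T ⊂ R := (Finset.ssubset_iff_of_subset hT).2 ⟨w, h1.right_mem, q2 hne⟩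
    have := Finset.card_lt_card hlt
    omega

theorem two_paths {Z : Finset V} (hc : TwoConn H Z) {v : ℕ → V} {N : ℕ}
    (hinj : ∀ i j, i ≤ N → j ≤ N → v i = v j → i = j)
    (hadj : ∀ i, i < N → H.Adj (v i) (v (i + 1))) (hZ : ∀ i, i ≤ N → v i ∈ Z)
    {L : ℕ} (hL : L < N) :
    ∀ d i, i + d = L → 1 ≤ i → ∃ Q1 Q2 b1 b2 p q, p < i ∧ L < q ∧ q ≤ N ∧ PathOn H (v i) b1 Q1 ∧
      PathOn H (v p) b2 Q2 ∧ ((b1 = v L ∧ b2 = v q) ∨ (b1 = v q ∧ b2 = v L)) ∧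
      (∀ z, z ∈ Q1 → z ∈ Q2 → False) ∧
      (∀ k, k ≤ i → v k ∈ Q1 → k = i) ∧ (∀ k, k ≤ i → v k ∈ Q2 → k = p) ∧
      (∀ k, L ≤ k → k ≤ N → v k ∈ Q1 → v k = b1) ∧
      (∀ k, L ≤ k → k ≤ N → v k ∈ Q2 → v k = b2) := by
  have hne : ∀ i j, i ≤ N → j ≤ N → i ≠ j → v i ≠ v j := fun i j hi hj h h' => h (hinj i j hi hj h')
  have hmemA : ∀ i k, k ≤ i → v k ∈ (Finset.Icc 0 i).image v := fun i k hk =>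
    Finset.mem_image_of_mem _ (by simp [hk])
  intro d
  induction d with
  | zero =>
    intro i hi hi1
    have hiL : i = L := by omega
    subst hiL
    obtain ⟨u, w, R, h1, h2, h3, h4, h5, h6⟩ := hc.reach (hZ i (by omega))
      (A := (Finset.Icc 0 (i - 1)).image v) (B := (Finset.Icc (i + 1) N).image v)
      (a := v 0) (b := v N) (hmemA _ _ (by omega))
      (Finset.mem_erase.2 ⟨hne _ _ (by omega) (by omega) (by omega), hZ _ (by omega)⟩)
      (Finset.mem_image_of_mem _ (by simp; omega))
      (Finset.mem_erase.2 ⟨hne _ _ (by omega) (by omega) (by omega), hZ _ (by omega)⟩)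
    simp only [Finset.mem_image, Finset.mem_Icc] at h3 h4
    obtain ⟨p, hp, rfl⟩ := h3
    obtain ⟨q, hq, rfl⟩ := h4
    refine ⟨{v i}, R, v i, v q, p, q, by omega, by omega, by omega, PathOn.single _, h1,
      Or.inl ⟨rfl, rfl⟩, ?_, ?_, ?_, ?_, ?_⟩
    · intro z hz hz'; simp at hz; subst hz; exact h2 hz'
    · intro k hk hk'; simp at hk'; exact hinj _ _ (by omega) (by omega) hk'
    · intro k hk hk'
      have hki : k ≠ i := by rintro rfl; exact h2 hk'
      exact hinj _ _ (by omega) (by omega) (h5 _ hk' (hmemA _ _ (by omega)))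
    · intro k hk _ hk'; simpa using hk'
    · intro k hk hkN hk'
      have hki : k ≠ i := by rintro rfl; exact h2 hk'
      exact h6 _ hk' (Finset.mem_image_of_mem _ (by simp; omega))
  | succ d ih =>
    intro i hi hi1
    obtain ⟨Q1, Q2, b1, b2, p, q, hpi, hLq, hqN, hQ1, hQ2, hb, hdis, hA1, hA2, hB1, hB2⟩ :=
      ih (i + 1) (by omega) (by omega)
    have hviQ1 : v i ∉ Q1 := fun h => by have := hA1 i (by omega) h; omega
    have hcons : PathOn H (v i) b1 (insert (v i) Q1) :=
      PathOn.cons _ _ _ _ (hadj i (by omega)) hviQ1 hQ1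
    have hconsA : ∀ k, k ≤ i → v k ∈ insert (v i) Q1 → k = i := by
      intro k hk hk'
      rcases Finset.mem_insert.1 hk' with h | h
      · exact hinj _ _ (by omega) (by omega) h
      · have := hA1 k (by omega) h; omega
    have hconsB : ∀ k, L ≤ k → k ≤ N → v k ∈ insert (v i) Q1 → v k = b1 := by
      intro k hk hkN hk'
      rcases Finset.mem_insert.1 hk' with h | h
      · have := hinj _ _ (by omega) (by omega) h; omega
      · exact hB1 k hk hkN h
    by_cases hp : p = i
    · subst hp
      have hA2' : ∀ k, k ≤ p → v k ∈ Q2 → k = p := fun k hk h => hA2 k (by omega) h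
      obtain ⟨u, w, R, h1, h2, h3, h4, h5, h6⟩ := hc.reach (hZ p (by omega))
        (A := (Finset.Icc 0 (p - 1)).image v) (B := Q1 ∪ Q2 ∪ (Finset.Icc L N).image v)
        (a := v 0) (b := v N) (hmemA _ _ (by omega))
        (Finset.mem_erase.2 ⟨hne _ _ (by omega) (by omega) (by omega), hZ _ (by omega)⟩)
        (Finset.mem_union_right _ (Finset.mem_image_of_mem _ (by simp; omega)))
        (Finset.mem_erase.2 ⟨hne _ _ (by omega) (by omega) (by omega), hZ _ (by omega)⟩)
      simp only [Finset.mem_image, Finset.mem_Icc] at h3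
      obtain ⟨p', hp', rfl⟩ := h3
      have hRA : ∀ k, k ≤ p → v k ∈ R → k = p' := by
        intro k hk hk'
        have hki : k ≠ p := by rintro rfl; exact h2 hk'
        exact hinj _ _ (by omega) (by omega) (h5 _ hk' (hmemA _ _ (by omega)))
      have hRB : ∀ k, L ≤ k → k ≤ N → v k ∈ R → v k = w := by
        intro k hk hkN hk'
        exact h6 _ hk' (Finset.mem_union_right _ (Finset.mem_image_of_mem _ (by simp; omega)))
      have hR1 : ∀ z, z ∈ R → z ∈ Q1 → z = w := fun z hz hz' => h6 z hz (by simp [hz'])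
      have hR2 : ∀ z, z ∈ R → z ∈ Q2 → z = w := fun z hz hz' => h6 z hz (by simp [hz'])
      by_cases hw1 : w ∈ Q1
      · -- swap: Q2 starts at v p, new path R followed by the end of Q1
        obtain ⟨T, hT, q1, q2⟩ := hQ1.drop hw1
        refine ⟨Q2, R ∪ T, b2, b1, p', q, by omega, hLq, hqN, hQ2,
          h1.join q1 (fun z hz hz' => hR1 z hz (hT hz')), hb.symm.imp (fun h => ⟨h.2, h.1⟩)
            (fun h => ⟨h.2, h.1⟩), ?_, hA2', ?_, hB2, ?_⟩
        · intro z hz hz'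
          rcases Finset.mem_union.1 hz' with h | h
          · have := hR2 z h hz
            subst this; exact hdis _ hw1 hz
          · exact hdis _ (hT h) hz
        · intro k hk hk'
          rcases Finset.mem_union.1 hk' with h | h
          · exact hRA k hk h
          · have := hA1 k (by omega) (hT h); omega
        · intro k hk hkN hk'
          rcases Finset.mem_union.1 hk' with h | h
          · have := hRB k hk hkN h
            exact hB1 k hk hkN (this ▸ hw1)
          · exact hB1 k hk hkN (hT h)
      · by_cases hw2 : w ∈ Q2
        · obtain ⟨T, hT, q1, q2⟩ := hQ2.drop hw2
          have hwp : w ≠ v p := by rintro rfl; exact h2 h1.right_mem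
          have hvT := q2 hwp
          refine ⟨insert (v p) Q1, R ∪ T, b1, b2, p', q, by omega, hLq, hqN, hcons,
            h1.join q1 (fun z hz hz' => hR2 z hz (hT hz')), hb, ?_, hconsA, ?_, hconsB, ?_⟩
          · intro z hz hz'
            rcases Finset.mem_insert.1 hz with rfl | hz
            · rcases Finset.mem_union.1 hz' with h | h
              · exact h2 h
              · exact hvT h
            · rcases Finset.mem_union.1 hz' with h | h
              · have := hR1 z h hz
                subst this; exact hw1 hz
              · exact hdis z hz (hT h)
          · intro k hk hk'
            rcases Finset.mem_union.1 hk' with h | h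
            · exact hRA k hk h
            · have := hA2 k (by omega) (hT h)
              subst this; exact absurd h hvT
          · intro k hk hkN hk'
            rcases Finset.mem_union.1 hk' with h | h
            · have := hRB k hk hkN h
              exact hB2 k hk hkN (this ▸ hw2)
            · exact hB2 k hk hkN (hT h)
        · have hwB : w ∈ (Finset.Icc L N).image v := by
            rcases Finset.mem_union.1 h4 with h | h
            · rcases Finset.mem_union.1 h with h | h
              · exact absurd h hw1
              · exact absurd h hw2
            · exact h
          simp only [Finset.mem_image, Finset.mem_Icc] at hwB
          obtain ⟨q', hq', rfl⟩ := hwB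
          have hdR1 : ∀ z, z ∈ Q1 → z ∈ R → False := by
            intro z hz hz'
            have := hR1 z hz' hz
            subst this; exact hw1 hz
          have hdR2 : ∀ z, z ∈ Q2 → z ∈ R → False := by
            intro z hz hz'
            have := hR2 z hz' hz
            subst this; exact hw2 hz
          have hq'L : q' ≠ L := by
            rintro rfl
            rcases hb with ⟨h, -⟩ | ⟨-, h⟩
            · exact hw1 (h ▸ hQ1.right_mem)
            · exact hw2 (h ▸ hQ2.right_mem)
          rcases hb with ⟨hb1, -⟩ | ⟨-, hb2⟩
          · refine ⟨insert (v p) Q1, R, b1, v q', p', q', by omega, by omega, by omega, hcons, h1,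
              Or.inl ⟨hb1, rfl⟩, ?_, hconsA, hRA, hconsB, hRB⟩
            intro z hz hz'
            rcases Finset.mem_insert.1 hz with rfl | hz
            · exact h2 hz'
            · exact hdR1 z hz hz'
          · exact ⟨Q2, R, b2, v q', p', q', by omega, by omega, by omega, hQ2, h1,
              Or.inl ⟨hb2, rfl⟩, hdR2, hA2', hRA, hB2, hRB⟩
    · refine ⟨insert (v i) Q1, Q2, b1, b2, p, q, by omega, hLq, hqN, hcons, hQ2, hb, ?_, hconsA,
        ?_, hconsB, hB2⟩
      · intro z hz hz'
        rcases Finset.mem_insert.1 hz with rfl | hz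
        · have := hA2 i (by omega) hz'; omega
        · exact hdis z hz hz'
      · intro k hk hk'; exact hA2 k (by omega) hk'

/-- Pósa type lemma. -/
theorem posa {Z X : Finset V} (hX : ∀ a b, H.Adj a b → (a ∈ X ↔ b ∉ X))
    (hc : TwoConn H Z) {v : ℕ → V} {N m : ℕ}
    (hno : ∀ C, Cyc H C → C.card < 2 * m)
    (hinj : ∀ i j, i ≤ N → j ≤ N → v i = v j → i = j)
    (hadj : ∀ i, i < N → H.Adj (v i) (v (i + 1))) (hZ : ∀ i, i ≤ N → v i ∈ Z)
    (h0 : v 0 ∈ X) (hN : v N ∉ X) (I J : Finset ℕ)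
    (hI : ∀ i, i ∈ I ↔ i ≤ N ∧ H.Adj (v 0) (v i)) (hJ : ∀ i, i ∈ J ↔ i ≤ N ∧ H.Adj (v N) (v i))
    (hspan : ∀ i, i < N → H.Adj (v 0) (v (i + 1)) → H.Adj (v N) (v i) → False)
    (hcard : m + 1 ≤ I.card + J.card) : False := by
  have hN0 : N ≠ 0 := by rintro rfl; exact hN h0
  have hI1 : 1 ∈ I := (hI 1).2 ⟨by omega, hadj 0 (by omega)⟩
  have hJ1 : N - 1 ∈ J := (hJ _).2 ⟨by omega, by
    have := hadj (N - 1) (by omega)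
    rw [show N - 1 + 1 = N by omega] at this
    exact this.symm⟩
  have hIpos : ∀ i ∈ I, 1 ≤ i := by
    intro i hi
    rcases Nat.eq_zero_or_pos i with rfl | h
    · exact absurd ((hI 0).1 hi).2 (H.irrefl)
    · exact h
  have hJlt : ∀ j ∈ J, j < N := by
    intro j hj
    have h1 := (hJ j).1 hj
    rcases Nat.lt_or_ge j N with h | h
    · exact h
    · have : j = N := by omega
      subst this; exact absurd h1.2 (H.irrefl)
  have hIX : ∀ i ∈ I, v i ∉ X := fun i hi => (hX _ _ ((hI i).1 hi).2).1 h0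
  have hJX : ∀ j ∈ J, v j ∈ X := fun j hj => by
    by_contra h; exact hN ((hX _ _ ((hJ j).1 hj).2).2 h)
  -- counting lemma
  have key : ∀ C i0, Cyc H C → i0 ∈ I → (∀ j ∈ J, v j ∈ C) →
      (∀ i ∈ I, i ≠ i0 → v (i - 1) ∈ C) → False := by
    intro C i0 hC hi0 h1 h2
    have e1 := hC.count hX
    have e2 := hno C hC
    have hpc : ((I.erase i0).image (fun i => i - 1)).card = I.card - 1 := by
      rw [Finset.card_image_of_injOn, Finset.card_erase_of_mem hi0]
      intro a ha b hb hab
      simp at ha hb hab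
      have := hIpos a ha.1
      have := hIpos b hb.1
      omega
    have hdis : Disjoint J ((I.erase i0).image (fun i => i - 1)) := by
      rw [Finset.disjoint_left]
      intro j hj hj'
      simp only [Finset.mem_image, Finset.mem_erase] at hj'
      obtain ⟨i, ⟨-, hi⟩, rfl⟩ := hj'
      have q1 := hIpos i hi
      have q2 := (hI i).1 hi
      refine hspan (i - 1) (by omega) ?_ ((hJ _).1 hj).2
      rw [show i - 1 + 1 = i by omega]; exact q2.2
    have hsub : (J ∪ (I.erase i0).image (fun i => i - 1)).image v ⊆ C.filter (· ∈ X) := by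
      intro z hz
      simp only [Finset.mem_image, Finset.mem_union, Finset.mem_erase] at hz
      rw [Finset.mem_filter]
      obtain ⟨k, hk | ⟨i, ⟨hi0, hi⟩, rfl⟩, rfl⟩ := hz
      · exact ⟨h1 k hk, hJX k hk⟩
      · refine ⟨h2 i hi hi0, ?_⟩
        have q1 := hIpos i hi
        have q2 := (hI i).1 hi
        have q3 := hX _ _ (hadj (i - 1) (by omega))
        rw [show i - 1 + 1 = i by omega] at q3
        exact q3.2 (hIX i hi)
    have e3 := Finset.card_le_card hsub
    rw [Finset.card_image_of_injOn, Finset.card_union_of_disjoint hdis, hpc] at e3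
    · have : 1 ≤ I.card := Finset.card_pos.2 ⟨_, hI1⟩
      omega
    · intro a ha b hb hab
      have : ∀ c, c ∈ J ∪ (I.erase i0).image (fun i => i - 1) → c ≤ N := by
        intro c hc
        simp only [Finset.mem_image, Finset.mem_union, Finset.mem_erase] at hc
        rcases hc with hc | ⟨i, ⟨-, hi⟩, rfl⟩
        · exact ((hJ c).1 hc).1
        · have := ((hI i).1 hi).1; omega
      exact hinj a b (this a ha) (this b hb) hab
  have hmemseg : ∀ a b k, a ≤ k → k ≤ b → v k ∈ (Finset.Icc a b).image v := fun a b k h1 h2 =>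
    Finset.mem_image_of_mem _ (by simp [h1, h2])
  have hdisseg : ∀ a b c d, b ≤ N → d ≤ N → b < c → ∀ z, z ∈ (Finset.Icc a b).image v →
      z ∈ (Finset.Icc c d).image v → False := by
    intro a b c d hb hd hbc z hz hz'
    simp only [Finset.mem_image, Finset.mem_Icc] at hz hz'
    obtain ⟨k, hk, rfl⟩ := hz
    obtain ⟨k', hk', he⟩ := hz'
    have := hinj _ _ (by omega) (by omega) he
    omega
  by_cases hcross : ∃ g, ∃ i ∈ J, ∃ i' ∈ I, i < i' ∧ i' - i = g
  · classical
    obtain ⟨i, hi, i', hi', hlt, hg⟩ := Nat.find_spec hcross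
    have hmin : ∀ j ∈ J, ∀ j' ∈ I, j < j' → i' - i ≤ j' - j := by
      intro j hj j' hj' hlt'
      rw [hg]
      exact Nat.find_min' hcross ⟨j, hj, j', hj', hlt', rfl⟩
    have hi'N := ((hI i').1 hi').1
    have hp := (PathOn.seg hinj hadj 0 i (by omega) (by omega)).symm.join_adj ((hI i').1 hi').2
      (PathOn.seg hinj hadj i' N (by omega) le_rfl) (hdisseg _ _ _ _ (by omega) le_rfl hlt)
    refine key _ i' ⟨_, _, hp, ((hJ i).1 hi).2⟩ hi' ?_ ?_
    · intro j hj
      rw [Finset.mem_union]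
      by_cases h : j ≤ i
      · exact Or.inl (hmemseg _ _ _ (by omega) h)
      · right
        refine hmemseg _ _ _ ?_ (hJlt j hj).le
        by_contra h'
        have := hmin j hj i' hi' (by omega)
        omega
    · intro j hj hne
      rw [Finset.mem_union]
      by_cases h : j ≤ i
      · exact Or.inl (hmemseg _ _ _ (by omega) (by omega))
      · right
        have := ((hI j).1 hj).1
        refine hmemseg _ _ _ ?_ (by omega)
        by_contra h'
        have := hmin i hi j hj (by omega)
        omega
  · have hle : ∀ j ∈ J, ∀ i ∈ I, i < j := by
      intro j hj i hi
      by_contra h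
      by_cases hij : i = j
      · subst hij; exact hIX i hi (hJX i hj)
      · exact hcross ⟨_, j, hj, i, hi, by omega, rfl⟩
    have hIne : I.Nonempty := ⟨_, hI1⟩
    have hJne : J.Nonempty := ⟨_, hJ1⟩
    obtain ⟨K, hK, hKmax⟩ := I.exists_max_image id hIne
    obtain ⟨L, hL, hLmin⟩ := J.exists_min_image id hJne
    simp only [id] at hKmax hLmin
    have hKL := hle L hL K hK
    have hK1 := hIpos K hK
    have hLN := hJlt L hL
    obtain ⟨Q1, Q2, b1, b2, p, q, hpK, hLq, hqN, hQ1, hQ2, hb, hdis, hA1, hA2, hB1, hB2⟩ :=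
      two_paths hc hinj hadj hZ hLN (L - K) K (by omega) hK1
    obtain ⟨f, hf, hfmin⟩ := (I.filter (fun i => p < i)).exists_min_image id
      ⟨K, by simp [hK, hpK]⟩
    obtain ⟨s, hs, hsmax⟩ := (J.filter (fun i => i < q)).exists_max_image id
      ⟨L, by simp [hL, hLq]⟩
    simp only [id, Finset.mem_filter, and_imp] at hf hs hfmin hsmax
    have hfK := hKmax f hf.1
    have hLs := hLmin s hs.1
    -- left path
    have hleft := (PathOn.seg hinj hadj 0 p (by omega) (by omega)).symm.join_adj ((hI f).1 hf.1).2
      (PathOn.seg hinj hadj f K (by omega) (by omega)) (hdisseg _ _ _ _ (by omega) (by omega) hf.2)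
    have hright := (PathOn.seg hinj hadj L s (by omega) (by omega)).join_adj
      ((hJ s).1 hs.1).2.symm (PathOn.seg hinj hadj q N (by omega) (by omega)).symm
      (hdisseg _ _ _ _ (by omega) (by omega) hs.2)
    set AL := (Finset.Icc 0 p).image v ∪ (Finset.Icc f K).image v with hAL
    set BR := (Finset.Icc L s).image v ∪ (Finset.Icc q N).image v with hBR
    have memAL : ∀ z, z ∈ AL → ∃ k, k ≤ K ∧ z = v k := by
      intro z hz
      simp only [hAL, Finset.mem_union, Finset.mem_image, Finset.mem_Icc] at hz
      rcases hz with ⟨k, hk, rfl⟩ | ⟨k, hk, rfl⟩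
      · exact ⟨k, by omega, rfl⟩
      · exact ⟨k, by omega, rfl⟩
    have memBR : ∀ z, z ∈ BR → ∃ k, L ≤ k ∧ k ≤ N ∧ z = v k := by
      intro z hz
      simp only [hBR, Finset.mem_union, Finset.mem_image, Finset.mem_Icc] at hz
      rcases hz with ⟨k, hk, rfl⟩ | ⟨k, hk, rfl⟩
      · exact ⟨k, by omega, by omega, rfl⟩
      · exact ⟨k, by omega, by omega, rfl⟩
    have hright' : PathOn H b1 b2 BR := by
      rcases hb with ⟨rfl, rfl⟩ | ⟨rfl, rfl⟩
      · exact hright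
      · exact hright.symm
    have hpath1 := hleft.join hQ1 (by
      intro z hz hz'
      obtain ⟨k, hk, rfl⟩ := memAL z hz
      rw [hA1 k hk hz'])
    have hpath2 := hpath1.join hright' (by
      intro z hz hz'
      obtain ⟨k, hk1, hk2, rfl⟩ := memBR z hz'
      rcases Finset.mem_union.1 hz with hz | hz
      · obtain ⟨k', hk', he⟩ := memAL _ hz
        have := hinj _ _ (by omega) (by omega) he
        omega
      · exact hB1 k hk1 hk2 hz)
    have hcyc := Cyc.of_two hpath2 hQ2 (by
      intro he
      rcases hb with ⟨-, h⟩ | ⟨-, h⟩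
      · rw [h] at he; have := hinj _ _ (by omega) (by omega) he; omega
      · rw [h] at he; have := hinj _ _ (by omega) (by omega) he; omega) (by
      intro z hz hz'
      rcases Finset.mem_union.1 hz with hz | hz
      · rcases Finset.mem_union.1 hz with hz | hz
        · obtain ⟨k, hk, rfl⟩ := memAL z hz
          left; rw [hA2 k hk hz']
        · exact absurd hz' (fun h => hdis z hz h)
      · obtain ⟨k, hk1, hk2, rfl⟩ := memBR z hz
        right; exact hB2 k hk1 hk2 hz')
    refine key _ f hcyc hf.1 ?_ ?_
    · intro j hj
      apply Finset.mem_union_left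
      apply Finset.mem_union_right
      rw [hBR, Finset.mem_union]
      by_cases h : j < q
      · exact Or.inl (hmemseg _ _ _ (hLmin j hj) (hsmax j hj h))
      · exact Or.inr (hmemseg _ _ _ (by omega) (hJlt j hj).le)
    · intro i hi hne
      apply Finset.mem_union_left
      apply Finset.mem_union_left
      apply Finset.mem_union_left
      rw [hAL, Finset.mem_union]
      by_cases h : p < i
      · have := hfmin i hi h
        have := hKmax i hi
        exact Or.inr (hmemseg _ _ _ (by omega) (by omega))
      · exact Or.inl (hmemseg _ _ _ (by omega) (by omega))

end posa

section dfs
variable {V : Type*} [DecidableEq V] {H : SimpleGraph V}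

/-- Every union of components of `W` has an edge to `r`. -/
def Attached {V : Type*} [DecidableEq V] (H : SimpleGraph V) (W : Finset V) (r : V) : Prop :=
  ∀ W' ⊆ W, W'.Nonempty → (∀ s ∈ W', ∀ t ∈ W, t ∉ W' → ¬ H.Adj s t) → ∃ s ∈ W', H.Adj r s

theorem exists_comp {W : Finset V} {r : V} (hr : r ∈ W) :
    ∃ D ⊆ W, r ∈ D ∧ (∀ s ∈ D, ∀ t ∈ W, t ∉ D → ¬ H.Adj s t) ∧ Attached H (D.erase r) r := by
  classical
  let F := W.powerset.filter (fun D => r ∈ D ∧ ∀ s ∈ D, ∀ t ∈ W, t ∉ D → ¬ H.Adj s t)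
  have hF : F.Nonempty := ⟨W, by simp only [F, Finset.mem_filter, Finset.mem_powerset]; 
                                  exact ⟨subset_rfl, hr, fun s _ t ht ht' => absurd ht ht'⟩⟩
  obtain ⟨D, hD, hmin⟩ := Finset.exists_min_image F Finset.card hF
  simp only [F, Finset.mem_filter, Finset.mem_powerset] at hD hmin
  obtain ⟨hDW, hrD, hcl⟩ := hD
  refine ⟨D, hDW, hrD, hcl, ?_⟩
  intro W' hW' hne hW'cl
  by_contra hcon
  push Not at hcon
  have hW'D : W' ⊆ D := hW'.trans (Finset.erase_subset _ _)
  have hrW' : r ∉ W' := fun h => by simpa using hW' h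
  have := hmin (D \ W') ⟨Finset.sdiff_subset.trans hDW, by simp [hrD, hrW'], by
    intro s hs t ht htD hadj
    rw [Finset.mem_sdiff] at hs htD
    by_cases htD' : t ∈ D
    · have htW' : t ∈ W' := by tauto
      by_cases hsr : s = r
      · exact hcon t htW' (hsr ▸ hadj)
      · exact hW'cl t htW' s (by simp [hsr, hs.1]) hs.2 hadj.symm
    · exact hcl s hs.1 t ht htD' hadj⟩
  have hlt : (D \ W').card < D.card := by
    apply Finset.card_lt_card
    refine ⟨Finset.sdiff_subset, fun h => ?_⟩
    obtain ⟨w, hw⟩ := hne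
    have := h (hW'D hw)
    simp [hw] at this
  omega

theorem Attached.sdiff {W D : Finset V} {r : V} (h : Attached H W r)
    (hcl : ∀ s ∈ D, ∀ t ∈ W, t ∉ D → ¬ H.Adj s t) : Attached H (W \ D) r := by
  intro W' hW' hne hc
  refine h W' (hW'.trans Finset.sdiff_subset) hne ?_
  intro s hs t ht htW hadj
  have hs' := Finset.mem_sdiff.1 (hW' hs)
  by_cases htD : t ∈ D
  · exact hcl t htD s hs'.1 hs'.2 hadj.symm
  · exact hc s hs t (by simp [ht, htD]) htW hadj

theorem card_split {W D : Finset V} {r : V} (hD : D ⊆ W) (hr : r ∈ D) (p : V → Prop)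
    [DecidablePred p] : (W.filter p).card
      = ((D.erase r).filter p).card + (if p r then 1 else 0) + ((W \ D).filter p).card := by
  have h1 : W = insert r (D.erase r) ∪ (W \ D) := by
    rw [Finset.insert_erase hr, Finset.union_sdiff_of_subset hD]
  conv_lhs => rw [h1]
  rw [Finset.filter_union, Finset.card_union_of_disjoint]
  · rw [Finset.filter_insert]
    split_ifs
    · rw [Finset.card_insert_of_notMem (by simp)]
    · simp
  · rw [Finset.insert_erase hr]
    exact Finset.disjoint_filter_filter Finset.disjoint_sdiff

theorem dfs {X : Finset V} (hX : ∀ a b, H.Adj a b → (a ∈ X ↔ b ∉ X)) :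
    ∀ (c : ℕ) (W : Finset V) (r : V), W.card = c → Attached H W r →
    (∃ h y S, PathOn H h y S ∧ S ⊆ W ∧ H.Adj r h ∧ y ∉ X ∧ ∀ w ∈ W, H.Adj y w → w ∈ S) ∨
    ((r ∈ X → (W.filter (· ∉ X)).card ≤ (W.filter (· ∈ X)).card) ∧
     (r ∉ X → W = ∅ ∨ (W.filter (· ∉ X)).card + 1 ≤ (W.filter (· ∈ X)).card)) := by
  intro c
  induction c using Nat.strong_induction_on with
  | _ c ih =>
  intro W r hc hat
  rcases W.eq_empty_or_nonempty with rfl | hne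
  · right; simp
  obtain ⟨r', hr', hadj⟩ := hat W subset_rfl hne (fun s _ t ht ht' => absurd ht ht')
  obtain ⟨D, hDW, hrD, hcl, hat1⟩ := exists_comp (H := H) hr'
  have hlt1 : (D.erase r').card < c := by
    have := Finset.card_le_card hDW
    rw [Finset.card_erase_of_mem hrD]
    have := Finset.card_pos.2 ⟨r', hrD⟩
    omega
  have hlt2 : (W \ D).card < c := by
    rw [← hc]
    apply Finset.card_lt_card
    refine ⟨Finset.sdiff_subset, fun h => ?_⟩
    have := h hr'
    simp [hrD] at this
  rcases ih _ hlt1 (D.erase r') r' rfl hat1 with ⟨h, y, S, hp, hS, hh, hy, hN⟩ | hA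
  · left
    refine ⟨r', y, insert r' S, PathOn.cons _ _ _ _ hh (fun h => by simpa using hS h) hp, ?_, hadj,
      hy, ?_⟩
    · intro z hz
      rcases Finset.mem_insert.1 hz with rfl | hz
      · exact hr'
      · exact hDW (Finset.mem_of_mem_erase (hS hz))
    · intro w hw hyw
      have hyD : y ∈ D := Finset.mem_of_mem_erase (hS hp.right_mem)
      have hwD : w ∈ D := by
        by_contra hwD
        exact hcl y hyD w hw hwD hyw
      by_cases hwr : w = r'
      · simp [hwr]
      · exact Finset.mem_insert_of_mem (hN w (by simp [hwr, hwD]) hyw)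
  rcases ih _ hlt2 (W \ D) r rfl (hat.sdiff hcl) with ⟨h, y, S, hp, hS, hh, hy, hN⟩ | hB
  · left
    refine ⟨h, y, S, hp, hS.trans Finset.sdiff_subset, hh, hy, ?_⟩
    intro w hw hyw
    have hyD := Finset.mem_sdiff.1 (hS hp.right_mem)
    refine hN w ?_ hyw
    refine Finset.mem_sdiff.2 ⟨hw, fun hwD => hcl w hwD y hyD.1 hyD.2 hyw.symm⟩
  by_cases hempty : r' ∉ X ∧ D.erase r' = ∅
  · left
    refine ⟨r', r', {r'}, PathOn.single _, by simpa using hr', hadj, hempty.1, ?_⟩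
    intro w hw hyw
    by_contra hwr
    have : w ∉ D := by
      intro hwD
      have : w ∈ D.erase r' := Finset.mem_erase.2 ⟨by simpa using hwr, hwD⟩
      rw [hempty.2] at this
      simp at this
    exact hcl r' hrD w hw this hyw
  right
  have e1 := card_split hDW hrD (· ∈ X)
  have e2 := card_split hDW hrD (· ∉ X)
  have hf := hX r r' hadj
  constructor
  · intro hr
    have hr'X : r' ∉ X := hf.1 hr
    have h1 := hA.2 hr'X
    have h2 := hB.1 hr
    have h1' := h1.resolve_left (fun h => hempty ⟨hr'X, h⟩)
    simp only [hr'X, if_false, if_true, not_false_eq_true] at e1 e2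
    omega
  · intro hr
    right
    have hr'X : r' ∈ X := by tauto
    have h1 := hA.1 hr'X
    simp only [hr'X, if_false, if_true, not_true_eq_false] at e1 e2
    rcases hB.2 hr with h2 | h2
    · rw [h2] at e1 e2
      simp at e1 e2
      omega
    · omega

/-- Depth-first search along an initial path. -/
theorem dfs_path {X : Finset V} (hX : ∀ a b, H.Adj a b → (a ∈ X ↔ b ∉ X)) {p : ℕ → V} {M : ℕ}
    (hinj : ∀ i j, i ≤ M → j ≤ M → p i = p j → i = j)
    (hadj : ∀ i < M, H.Adj (p i) (p (i + 1))) (hM : p M ∈ X) :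
    ∀ (c j : ℕ), j + c = M → ∀ (W : Finset V), (∀ i, i ≤ j → p i ∉ W) →
    (∀ i, j < i → i ≤ M → p i ∈ W) → Attached H W (p j) →
    (∃ j', j ≤ j' ∧ j' ≤ M ∧ ∃ h y S, PathOn H h y S ∧ S ⊆ W ∧ (∀ i, i ≤ M → p i ∉ S) ∧
      H.Adj (p j') h ∧ y ∉ X ∧
      ∀ w ∈ W, H.Adj y w → w ∈ S ∨ ∃ i, i ≤ j' ∧ p i = w) ∨
    ((p j ∈ X → (W.filter (· ∉ X)).card ≤ (W.filter (· ∈ X)).card) ∧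
     (p j ∉ X → (W.filter (· ∉ X)).card + 1 ≤ (W.filter (· ∈ X)).card)) := by
  intro c
  induction c with
  | zero =>
    intro j hj W hW1 hW2 hat
    have hjM : j = M := by omega
    subst hjM
    rcases dfs hX _ W (p j) rfl hat with ⟨h, y, S, hp, hS, hh, hy, hN⟩ | hB
    · left
      exact ⟨j, le_rfl, le_rfl, h, y, S, hp, hS, fun i hi hi' => hW1 i hi (hS hi'), hh, hy,
        fun w hw hyw => Or.inl (hN w hw hyw)⟩
    · right
      exact ⟨hB.1, fun h => absurd hM h⟩
  | succ c ih =>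
    intro j hj W hW1 hW2 hat
    have hr' : p (j + 1) ∈ W := hW2 _ (by omega) (by omega)
    obtain ⟨D, hDW, hrD, hcl, hat1⟩ := exists_comp (H := H) hr'
    have hpD : ∀ i, j + 1 ≤ i → i ≤ M → p i ∈ D := by
      intro i hi
      induction i, hi using Nat.le_induction with
      | base => intro _; exact hrD
      | succ i hi ihi =>
        intro hiM
        by_contra hnot
        exact hcl (p i) (ihi (by omega)) (p (i + 1)) (hW2 _ (by omega) hiM) hnot
          (hadj i (by omega))
    have hq1 : ∀ i, i ≤ j + 1 → p i ∉ D.erase (p (j + 1)) := by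
      intro i hi hmem
      rcases Nat.lt_or_ge j i with hij | hij
      · have : i = j + 1 := by omega
        simp [this] at hmem
      · exact hW1 i hij (hDW (Finset.mem_of_mem_erase hmem))
    have hq2 : ∀ i, j + 1 < i → i ≤ M → p i ∈ D.erase (p (j + 1)) := by
      intro i hi hiM
      refine Finset.mem_erase.2 ⟨fun h => ?_, hpD i (by omega) hiM⟩
      have := hinj i (j + 1) hiM (by omega) h
      omega
    rcases ih (j + 1) (by omega) (D.erase (p (j + 1))) hq1 hq2 hat1 with
      ⟨j', hj', hj'M, h, y, S, hp, hS, hSp, hh, hy, hN⟩ | hA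
    · left
      refine ⟨j', by omega, hj'M, h, y, S, hp, 
        (hS.trans (Finset.erase_subset _ _)).trans hDW, hSp, hh, hy, ?_⟩
      intro w hw hyw
      have hyD : y ∈ D := Finset.mem_of_mem_erase (hS hp.right_mem)
      have hwD : w ∈ D := by
        by_contra hwD
        exact hcl y hyD w hw hwD hyw
      by_cases hwr : w = p (j + 1)
      · exact Or.inr ⟨j + 1, hj', hwr.symm⟩
      · exact hN w (by simp [hwr, hwD]) hyw
    · rcases dfs hX _ (W \ D) (p j) rfl (hat.sdiff hcl) with ⟨h, y, S, hp, hS, hh, hy, hN⟩ | hB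
      · left
        refine ⟨j, le_rfl, by omega, h, y, S, hp, hS.trans Finset.sdiff_subset, ?_, hh, hy, ?_⟩
        · intro i hi hiS
          have := Finset.mem_sdiff.1 (hS hiS)
          rcases Nat.lt_or_ge j i with hij | hij
          · exact this.2 (hpD i hij hi)
          · exact hW1 i hij this.1
        intro w hw hyw
        have hyD := Finset.mem_sdiff.1 (hS hp.right_mem)
        refine Or.inl (hN w ?_ hyw)
        refine Finset.mem_sdiff.2 ⟨hw, fun hwD => hcl w hwD y hyD.1 hyD.2 hyw.symm⟩
      · right
        have e1 := card_split hDW hrD (· ∈ X)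
        have e2 := card_split hDW hrD (· ∉ X)
        have hf := hX (p j) (p (j + 1)) (hadj j (by omega))
        constructor
        · intro hr
          have hr'X := hf.1 hr
          have h1 := hA.2 hr'X
          have h2 := hB.1 hr
          simp only [hr'X, if_false, if_true, not_false_eq_true] at e1 e2
          omega
        · intro hr
          have hr'X : p (j + 1) ∈ X := by tauto
          have h1 := hA.1 hr'X
          simp only [hr'X, if_false, if_true, not_true_eq_false] at e1 e2
          rcases hB.2 hr with h2 | h2
          · rw [h2] at e1 e2
            simp at e1 e2
            omega
          · omega

end dfs

section core
variable {V : Type*} [DecidableEq V] {H : SimpleGraph V}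

theorem image_seg_card {v : ℕ → V} {N : ℕ} (hinj : ∀ i j, i ≤ N → j ≤ N → v i = v j → i = j)
    (i j : ℕ) (hj : j ≤ N) : ((Finset.Icc i j).image v).card = j + 1 - i := by
  rw [Finset.card_image_of_injOn, Nat.card_Icc]
  intro a ha b hb hab
  simp at ha hb
  exact hinj a b (by omega) (by omega) hab

theorem Cyc.crossing {v : ℕ → V} {N : ℕ} (hinj : ∀ i j, i ≤ N → j ≤ N → v i = v j → i = j)
    (hadj : ∀ i, i < N → H.Adj (v i) (v (i + 1))) {i : ℕ} (hi : i < N)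
    (h1 : H.Adj (v 0) (v (i + 1))) (h2 : H.Adj (v N) (v i)) :
    Cyc H ((Finset.Icc 0 N).image v) := by
  refine ⟨v i, v N, ?_, h2⟩
  have := (PathOn.seg hinj hadj 0 i (by omega) (by omega)).symm.join_adj h1
    (PathOn.seg hinj hadj (i + 1) N (by omega) le_rfl) (by
      intro z hz hz'
      simp only [Finset.mem_image, Finset.mem_Icc] at hz hz'
      obtain ⟨a, ha, rfl⟩ := hz
      obtain ⟨b, hb, hab⟩ := hz'
      have := hinj _ _ (by omega) (by omega) hab
      omega)
  convert this using 1
  rw [← Finset.image_union]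
  congr 1
  ext z; simp only [Finset.mem_union, Finset.mem_Icc]; omega

theorem card_nbr_le [DecidableRel H.Adj] {Z : Finset V} {v : ℕ → V} {N : ℕ} {x : V}
    (h : ∀ w ∈ Z, H.Adj x w → ∃ i, i ≤ N ∧ v i = w) :
    (Z.filter (H.Adj x ·)).card ≤ ((Finset.range (N + 1)).filter (fun i => H.Adj x (v i))).card := by
  refine le_trans (Finset.card_le_card ?_) (Finset.card_image_le (f := v))
  intro w hw
  rw [Finset.mem_filter] at hw
  obtain ⟨i, hi, rfl⟩ := h w hw.1 hw.2
  exact Finset.mem_image_of_mem _ (by simp [hw.2]; omega)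

theorem core_aux [DecidableRel H.Adj] {Z X : Finset V} {m : ℕ}
    (hX : ∀ a b, H.Adj a b → (a ∈ X ↔ b ∉ X))
    (hc : TwoConn H Z) (hno : ∀ C, Cyc H C → C.card < 2 * m) (hm : 2 * m ≤ Z.card)
    (hbal : (Z.filter (· ∈ X)).card = (Z.filter (· ∉ X)).card)
    (hdeg : ∀ x ∈ Z, x ∈ X → ∀ y ∈ Z, y ∉ X →
      m + 1 ≤ (Z.filter (H.Adj x ·)).card + (Z.filter (H.Adj y ·)).card)
    {p : ℕ → V} {M : ℕ} (hinj : ∀ i j, i ≤ M → j ≤ M → p i = p j → i = j)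
    (hadj : ∀ i, i < M → H.Adj (p i) (p (i + 1))) (hpZ : ∀ i, i ≤ M → p i ∈ Z)
    (hlong : ∀ a b T, PathOn H a b T → T ⊆ Z → T.card ≤ M + 1)
    (hM : 1 ≤ M) (h0 : p 0 ∈ X) : False := by
  have hPZ : ∀ i j, j ≤ M → (Finset.Icc i j).image p ⊆ Z := by
    intro i j hj z hz
    simp only [Finset.mem_image, Finset.mem_Icc] at hz
    obtain ⟨a, ha, rfl⟩ := hz
    exact hpZ a (by omega)
  have hN0 : ∀ w ∈ Z, H.Adj (p 0) w → ∃ i, i ≤ M ∧ p i = w := by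
    intro w hw hadj0
    by_contra hcon
    push Not at hcon
    have hnot : w ∉ (Finset.Icc 0 M).image p := by
      simp only [Finset.mem_image, Finset.mem_Icc]
      rintro ⟨i, hi, h⟩
      exact hcon i hi.2 h
    have := hlong _ _ _ (PathOn.cons w _ _ _ hadj0.symm hnot
      (PathOn.seg hinj hadj 0 M (by omega) le_rfl))
      (Finset.insert_subset hw (hPZ 0 M le_rfl))
    rw [Finset.card_insert_of_notMem hnot, image_seg_card hinj _ _ le_rfl] at this
    omega
  have hd0 := card_nbr_le hN0
  by_cases hpM : p M ∈ X
  swap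
  · have hNM : ∀ w ∈ Z, H.Adj (p M) w → ∃ i, i ≤ M ∧ p i = w := by
      intro w hw hadj0
      by_contra hcon
      push Not at hcon
      have hnot : w ∉ (Finset.Icc 0 M).image p := by
        simp only [Finset.mem_image, Finset.mem_Icc]
        rintro ⟨i, hi, h⟩
        exact hcon i hi.2 h
      have := hlong _ _ _ (PathOn.cons w _ _ _ hadj0.symm hnot
        (PathOn.seg hinj hadj 0 M (by omega) le_rfl).symm)
        (Finset.insert_subset hw (hPZ 0 M le_rfl))
      rw [Finset.card_insert_of_notMem hnot, image_seg_card hinj _ _ le_rfl] at this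
      omega
    have hdM := card_nbr_le hNM
    have hd := hdeg _ (hpZ 0 (by omega)) h0 _ (hpZ M le_rfl) hpM
    refine posa hX hc hno hinj hadj hpZ h0 hpM _ _ (fun i => ?_) (fun i => ?_) ?_
      (hd.trans (Nat.add_le_add hd0 hdM))
    · simp
    · simp
    intro i hi h1 h2
    have hcyc := Cyc.crossing hinj hadj hi h1 h2
    have hcard := image_seg_card hinj 0 M le_rfl
    have hnc := hno _ hcyc
    set P := (Finset.Icc 0 M).image p with hP
    have hp0P : p 0 ∈ P := Finset.mem_image_of_mem _ (by simp)
    have hp1P : p 1 ∈ P := Finset.mem_image_of_mem _ (by simp [hM])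
    have hsub : P ⊆ Z := hPZ 0 M le_rfl
    obtain ⟨s, hs, t, ht, hst⟩ := hc (p 0) (hpZ 0 (by omega)) (P.erase (p 0))
      (Finset.erase_subset_erase _ hsub)
      ⟨p 1, Finset.mem_erase.2 ⟨fun h => by
        have := hinj 1 0 hM (by omega) h; omega, hp1P⟩⟩ (by
        by_contra hemp
        rw [Finset.not_nonempty_iff_eq_empty, Finset.sdiff_eq_empty_iff_subset] at hemp
        have h3 := Finset.card_le_card hemp
        rw [Finset.card_erase_of_mem hp0P, Finset.card_erase_of_mem (hsub hp0P)] at h3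
        omega)
    have hsP := Finset.mem_of_mem_erase hs
    rw [Finset.mem_sdiff, Finset.mem_erase, Finset.mem_erase] at ht
    have htP : t ∉ P := fun h => ht.2 ⟨ht.1.1, h⟩
    obtain ⟨c, hcs⟩ := hcyc.rotate hsP
    have := hlong _ _ _ (PathOn.cons t _ _ _ hst.symm htP hcs.symm)
      (Finset.insert_subset ht.1.2 hsub)
    rw [Finset.card_insert_of_notMem htP] at this
    omega
  -- the end of the path lies in `X`
  have hat : Attached H (Z.erase (p 0)) (p 0) := by
    intro W' hW' hne hcl
    by_cases hfull : (Z.erase (p 0) \ W').Nonempty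
    · obtain ⟨s, hs, t, ht, hst⟩ := hc (p 0) (hpZ 0 (by omega)) W' hW' hne hfull
      rw [Finset.mem_sdiff] at ht
      exact absurd hst (hcl s hs t ht.1 ht.2)
    · rw [Finset.not_nonempty_iff_eq_empty, Finset.sdiff_eq_empty_iff_subset] at hfull
      refine ⟨p 1, hfull (Finset.mem_erase.2 ⟨fun h => ?_, hpZ 1 hM⟩), hadj 0 (by omega)⟩
      have := hinj 1 0 hM (by omega) h
      omega
  rcases dfs_path hX hinj hadj hpM M 0 (by omega) (Z.erase (p 0))
    (by intro i hi; have : i = 0 := by omega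
        simp [this])
    (by intro i hi hiM
        refine Finset.mem_erase.2 ⟨fun h => ?_, hpZ i hiM⟩
        have := hinj i 0 hiM (by omega) h
        omega) hat with ⟨j, -, hjM, h, y, S, hp, hSW, hSp, hh, hy, hN⟩ | hB
  swap
  · have h1 := hB.1 h0
    have hpX : p 0 ∈ Z.filter (· ∈ X) := by simp [h0, hpZ 0 (by omega)]
    have hpY : p 0 ∉ Z.filter (· ∉ X) := by simp [h0]
    rw [Finset.filter_erase, Finset.filter_erase, Finset.erase_eq_of_notMem hpY,
      Finset.card_erase_of_mem hpX] at h1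
    have := Finset.card_pos.2 ⟨_, hpX⟩
    omega
  have hSZ : S ⊆ Z := hSW.trans (Finset.erase_subset _ _)
  have hyZ : y ∈ Z := hSZ hp.right_mem
  have hNy : ∀ w ∈ Z, H.Adj y w → w ∈ S ∨ ∃ i, i ≤ j ∧ p i = w := by
    intro w hw hyw
    by_cases hw0 : w = p 0
    · exact Or.inr ⟨0, by omega, hw0.symm⟩
    · exact hN w (by simp [hw0, hw]) hyw
  have hSpos : 1 ≤ S.card := Finset.card_pos.2 ⟨_, hp.left_mem⟩
  have hdisjS : ∀ a b, b ≤ M → ∀ z, z ∈ (Finset.Icc a b).image p → z ∈ S → False := by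
    intro a b hb z hz hzS
    simp only [Finset.mem_image, Finset.mem_Icc] at hz
    obtain ⟨i, hi, rfl⟩ := hz
    exact hSp i (by omega) hzS
  have hR := (PathOn.seg hinj hadj 0 j (by omega) hjM).join_adj hh hp (hdisjS 0 j hjM)
  set R := (Finset.Icc 0 j).image p ∪ S with hRdef
  have hRZ : R ⊆ Z := Finset.union_subset (hPZ 0 j hjM) hSZ
  have hRcard : R.card = j + 1 + S.card := by
    rw [hRdef, Finset.card_union_of_disjoint (Finset.disjoint_left.2 (hdisjS 0 j hjM)),
      image_seg_card hinj _ _ hjM]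
    omega
  have hjM' : j < M := by
    by_contra hcon
    have := hlong _ _ _ hR hRZ
    omega
  have hd := hdeg _ (hpZ 0 (by omega)) h0 _ hyZ hy
  by_cases hall : ∀ i, i ≤ M → H.Adj (p 0) (p i) → i ≤ j
  · obtain ⟨v, N, hv0, hvN, hvinj, hvadj, hvS, hvc⟩ := hR.exists_index
    have hmemR : ∀ w ∈ R, ∃ i, i ≤ N ∧ v i = w := by
      intro w hw
      rw [hvS] at hw
      simp only [Finset.mem_image, Finset.mem_Icc] at hw
      obtain ⟨i, hi, rfl⟩ := hw
      exact ⟨i, hi.2, rfl⟩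
    have hd1 : (Z.filter (H.Adj (p 0) ·)).card ≤ _ := card_nbr_le (v := v) (N := N) (x := p 0) (by
      intro w hw hpw
      obtain ⟨i, hi, rfl⟩ := hN0 w hw hpw
      apply hmemR
      exact Finset.mem_union_left _ (Finset.mem_image_of_mem _ (by simp [hall i hi hpw])))
    have hd2 : (Z.filter (H.Adj y ·)).card ≤ _ := card_nbr_le (v := v) (N := N) (x := y) (by
      intro w hw hpw
      apply hmemR
      rcases hNy w hw hpw with hwS | ⟨i, hi, rfl⟩
      · exact Finset.mem_union_right _ hwS
      · exact Finset.mem_union_left _ (Finset.mem_image_of_mem _ (by simp [hi])))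
    have hd' := hd.trans (Nat.add_le_add hd1 hd2)
    rw [← hv0, ← hvN] at hd'
    refine posa hX hc hno hvinj hvadj ?_ (by rw [hv0]; exact h0) (by rw [hvN]; exact hy) _ _
      (fun i => ?_) (fun i => ?_) ?_ hd'
    · intro i hi
      apply hRZ
      rw [hvS]
      exact Finset.mem_image_of_mem _ (by simp [hi])
    · simp
    · simp
    intro i hi h1 h2
    have hcyc := Cyc.crossing hvinj hvadj hi h1 h2
    rw [← hvS] at hcyc
    have hpjR : p j ∈ R := Finset.mem_union_left _ (Finset.mem_image_of_mem _ (by simp))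
    obtain ⟨c, hcj⟩ := hcyc.rotate hpjR
    have hdj : ∀ z, z ∈ R → z ∈ (Finset.Icc (j + 1) M).image p → False := by
      intro z hz hz'
      rcases Finset.mem_union.1 hz with hz | hz
      · simp only [Finset.mem_image, Finset.mem_Icc] at hz hz'
        obtain ⟨a, ha, rfl⟩ := hz
        obtain ⟨b, hb, hab⟩ := hz'
        have := hinj _ _ (by omega) (by omega) hab
        omega
      · exact hdisjS _ _ le_rfl z hz' hz
    have := hlong _ _ _ (hcj.join_adj (hadj j hjM')
      (PathOn.seg hinj hadj (j + 1) M (by omega) le_rfl) hdj)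
      (Finset.union_subset hRZ (hPZ _ _ le_rfl))
    rw [Finset.card_union_of_disjoint (Finset.disjoint_left.2 hdj), hRcard,
      image_seg_card hinj _ _ le_rfl] at this
    omega
  -- the gap argument
  push Not at hall
  obtain ⟨i0, hi0M, hi0adj, hi0j⟩ := hall
  set I := (Finset.range (M + 1)).filter (fun i => H.Adj (p 0) (p i)) with hI
  have hmemI : ∀ i, i ∈ I ↔ i ≤ M ∧ H.Adj (p 0) (p i) := by
    intro i; simp [hI]
  have hIpos : ∀ i ∈ I, 1 ≤ i := by
    intro i hi
    rcases Nat.eq_zero_or_pos i with rfl | h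
    · exact absurd ((hmemI 0).1 hi).2 (H.irrefl)
    · exact h
  obtain ⟨i', hi', hi'min⟩ := Finset.exists_min_image (I.filter (fun i => j < i)) id
    ⟨i0, by simp only [Finset.mem_filter, hmemI]; exact ⟨⟨hi0M, hi0adj⟩, hi0j⟩⟩
  obtain ⟨K, hK, hKmax⟩ := Finset.exists_max_image I id
    ⟨i0, by simp only [hmemI]; exact ⟨hi0M, hi0adj⟩⟩
  simp only [Finset.mem_filter, id] at hi' hi'min hKmax
  obtain ⟨hi'I, hji'⟩ := hi'
  have hi'M := ((hmemI _).1 hi'I).1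
  have hi'adj := ((hmemI _).1 hi'I).2
  have hKM := ((hmemI _).1 hK).1
  have hi'K := hKmax _ hi'I
  have hgap : S.card + j + 1 ≤ i' := by
    have hdj : ∀ z, z ∈ (Finset.Icc i' M).image p → z ∈ R → False := by
      intro z hz hz'
      rcases Finset.mem_union.1 hz' with hz' | hz'
      · simp only [Finset.mem_image, Finset.mem_Icc] at hz hz'
        obtain ⟨a, ha, rfl⟩ := hz
        obtain ⟨b, hb, hab⟩ := hz'
        have := hinj _ _ (by omega) (by omega) hab
        omega
      · exact hdisjS _ _ le_rfl z hz hz'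
    have := hlong _ _ _ ((PathOn.seg hinj hadj i' M hi'M le_rfl).symm.join_adj hi'adj.symm hR hdj)
      (Finset.union_subset (hPZ _ _ le_rfl) hRZ)
    rw [Finset.card_union_of_disjoint (Finset.disjoint_left.2 hdj), hRcard,
      image_seg_card hinj _ _ le_rfl] at this
    omega
  have hnocross : ∀ i, i ≤ j → H.Adj y (p i) → H.Adj (p 0) (p (i + 1)) → False := by
    intro i hi hyi hpi
    have hdj : ∀ z, z ∈ (Finset.Icc (i + 1) M).image p → z ∈ (Finset.Icc 0 i).image p → False := by
      intro z hz hz'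
      simp only [Finset.mem_image, Finset.mem_Icc] at hz hz'
      obtain ⟨a, ha, rfl⟩ := hz
      obtain ⟨b, hb, hab⟩ := hz'
      have := hinj _ _ (by omega) (by omega) hab
      omega
    have hpath := (PathOn.seg hinj hadj (i + 1) M (by omega) le_rfl).symm.join_adj hpi.symm
      (PathOn.seg hinj hadj 0 i (by omega) (by omega)) hdj
    have hyn : y ∉ (Finset.Icc (i + 1) M).image p ∪ (Finset.Icc 0 i).image p := by
      intro hy'
      rcases Finset.mem_union.1 hy' with hy' | hy'
      · exact hdisjS _ _ le_rfl _ hy' hp.right_mem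
      · exact hdisjS _ _ (by omega) _ hy' hp.right_mem
    have := hlong _ _ _ (PathOn.cons y _ _ _ hyi hyn hpath.symm)
      (Finset.insert_subset hyZ (Finset.union_subset (hPZ _ _ le_rfl) (hPZ _ _ (by omega))))
    rw [Finset.card_insert_of_notMem hyn,
      Finset.card_union_of_disjoint (Finset.disjoint_left.2 hdj),
      image_seg_card hinj _ _ le_rfl, image_seg_card hinj _ _ (by omega)] at this
    omega
  -- counting
  have hpi'X : p i' ∉ X := (hX _ _ hi'adj).1 h0
  have hprev : ∀ i, 1 ≤ i → i ≤ M → p i ∉ X → p (i - 1) ∈ X := by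
    intro i hi hiM hiX
    have := hadj (i - 1) (by omega)
    rw [show i - 1 + 1 = i by omega] at this
    exact (hX _ _ this).2 hiX
  have hcS := hp.count hX
  have hcL := (PathOn.seg hinj hadj (j + 1) (i' - 1) (by omega) (by omega)).count hX
  rw [image_seg_card hinj _ _ (by omega), if_pos (hprev i' (by omega) hi'M hpi'X)] at hcL
  rw [if_neg hy] at hcS
  have hside : h ∈ X ↔ p (j + 1) ∈ X := by
    have h1 := hX _ _ hh
    have h2 := hX _ _ (hadj j hjM')
    tauto
  simp only [hside] at hcS
  have hLS : (S.filter (· ∈ X)).card + 1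
      ≤ (((Finset.Icc (j + 1) (i' - 1)).image p).filter (· ∈ X)).card := by omega
  let A := (Finset.range (j + 1)).filter (fun i => H.Adj y (p i))
  let B := (I.erase i').image (fun i => i - 1)
  let L := (Finset.Icc (j + 1) (i' - 1)).filter (fun i => p i ∈ X)
  have hLcard : (((Finset.Icc (j + 1) (i' - 1)).image p).filter (· ∈ X)).card ≤ L.card := by
    refine le_trans (Finset.card_le_card ?_) (Finset.card_image_le (f := p))
    intro w hw
    rw [Finset.mem_filter, Finset.mem_image] at hw
    obtain ⟨⟨i, hi, rfl⟩, hw2⟩ := hw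
    exact Finset.mem_image_of_mem _ (Finset.mem_filter.2 ⟨hi, hw2⟩)
  have hBcard : B.card + 1 = I.card := by
    have : B.card = (I.erase i').card := by
      apply Finset.card_image_of_injOn
      intro a ha b hb hab
      have h1 := hIpos a (Finset.mem_of_mem_erase ha)
      have h2 := hIpos b (Finset.mem_of_mem_erase hb)
      simp only at hab
      omega
    rw [this, Finset.card_erase_add_one hi'I]
  have hAcard : (Z.filter (H.Adj y ·)).card ≤ A.card + (S.filter (· ∈ X)).card := by
    refine le_trans (Finset.card_le_card (t := A.image p ∪ S.filter (· ∈ X)) ?_)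
      (le_trans (Finset.card_union_le _ _) (Nat.add_le_add_right Finset.card_image_le _))
    intro w hw
    rw [Finset.mem_filter] at hw
    rcases hNy w hw.1 hw.2 with hwS | ⟨i, hi, rfl⟩
    · refine Finset.mem_union_right _ (Finset.mem_filter.2 ⟨hwS, ?_⟩)
      exact (hX _ _ hw.2.symm).2 hy
    · refine Finset.mem_union_left _ (Finset.mem_image_of_mem _ ?_)
      simp only [A, Finset.mem_filter, Finset.mem_range]
      exact ⟨by omega, hw.2⟩
  have hAm : ∀ i ∈ A, i ≤ j ∧ H.Adj y (p i) := by
    intro i hi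
    simp only [A, Finset.mem_filter, Finset.mem_range] at hi
    exact ⟨by omega, hi.2⟩
  have hBm : ∀ i ∈ B, i + 1 ∈ I ∧ i + 1 ≠ i' := by
    intro i hi
    simp only [B, Finset.mem_image, Finset.mem_erase] at hi
    obtain ⟨k, ⟨hk1, hk2⟩, rfl⟩ := hi
    have := hIpos k hk2
    rw [show k - 1 + 1 = k by omega]
    exact ⟨hk2, hk1⟩
  have hLm : ∀ i ∈ L, j + 1 ≤ i ∧ i ≤ i' - 1 ∧ p i ∈ X := by
    intro i hi
    simp only [L, Finset.mem_filter, Finset.mem_Icc] at hi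
    tauto
  have hAB : Disjoint A B := by
    rw [Finset.disjoint_left]
    intro i hiA hiB
    exact hnocross i (hAm i hiA).1 (hAm i hiA).2 ((hmemI _).1 (hBm i hiB).1).2
  have hABL : Disjoint (A ∪ B) L := by
    rw [Finset.disjoint_left]
    intro i hi hiL
    have h3 := hLm i hiL
    rcases Finset.mem_union.1 hi with hiA | hiB
    · have := (hAm i hiA).1
      omega
    · have h4 := hBm i hiB
      have := hi'min (i + 1) ⟨h4.1, by omega⟩
      omega
  have hcyc : Cyc H ((Finset.Icc 0 K).image p) :=
    ⟨_, _, PathOn.seg hinj hadj 0 K (by omega) hKM, ((hmemI _).1 hK).2.symm⟩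
  have hcc := hcyc.count hX
  have hcn := hno _ hcyc
  have hmem : ∀ i ∈ (A ∪ B) ∪ L, i ≤ K ∧ p i ∈ X := by
    intro i hi
    rcases Finset.mem_union.1 hi with hi | hi
    · rcases Finset.mem_union.1 hi with hi | hi
      · have h3 := hAm i hi
        exact ⟨by omega, (hX _ _ h3.2.symm).2 hy⟩
      · have h3 := hBm i hi
        have h4 := hKmax _ h3.1
        have h5 := (hmemI _).1 h3.1
        have h6 := hprev (i + 1) (by omega) h5.1 ((hX _ _ h5.2).1 h0)
        exact ⟨by omega, by simpa using h6⟩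
    · have h3 := hLm i hi
      exact ⟨by omega, h3.2.2⟩
  have hfin : ((A ∪ B) ∪ L).card ≤ (((Finset.Icc 0 K).image p).filter (· ∈ X)).card := by
    rw [← Finset.card_image_of_injOn (f := p) (s := (A ∪ B) ∪ L)]
    · apply Finset.card_le_card
      intro w hw
      obtain ⟨i, hi, rfl⟩ := Finset.mem_image.1 hw
      have := hmem i hi
      exact Finset.mem_filter.2 ⟨Finset.mem_image_of_mem _ (by simp [this.1]), this.2⟩
    · intro a ha b hb hab
      have h1 := hmem a ha
      have h2 := hmem b hb
      exact hinj a b (by omega) (by omega) hab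
  rw [Finset.card_union_of_disjoint hABL, Finset.card_union_of_disjoint hAB] at hfin
  omega


theorem exists_longest {Z : Finset V} (hne : Z.Nonempty) :
    ∃ (p : ℕ → V) (M : ℕ), (∀ i j, i ≤ M → j ≤ M → p i = p j → i = j) ∧
    (∀ i, i < M → H.Adj (p i) (p (i + 1))) ∧ (∀ i, i ≤ M → p i ∈ Z) ∧
    (∀ a b T, PathOn H a b T → T ⊆ Z → T.card ≤ M + 1) := by
  classical
  obtain ⟨z, hz⟩ := hne
  obtain ⟨S, hS, hmax⟩ := Finset.exists_max_image
    (Z.powerset.filter (fun S => ∃ a b, PathOn H a b S)) Finset.card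
    ⟨{z}, by
      simp only [Finset.mem_filter, Finset.mem_powerset, Finset.singleton_subset_iff]
      exact ⟨hz, z, z, PathOn.single z⟩⟩
  simp only [Finset.mem_filter, Finset.mem_powerset] at hS hmax
  obtain ⟨hSZ, a, b, hp⟩ := hS
  obtain ⟨v, N, hv0, hvN, hvinj, hvadj, hvS, hvc⟩ := hp.exists_index
  refine ⟨v, N, hvinj, hvadj, ?_, ?_⟩
  · intro i hi
    apply hSZ
    rw [hvS]
    exact Finset.mem_image_of_mem _ (by simp [hi])
  · intro a b T hT hTZ
    have := hmax T ⟨hTZ, a, b, hT⟩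
    omega

theorem core [DecidableRel H.Adj] {Z X : Finset V} {m : ℕ}
    (hX : ∀ a b, H.Adj a b → (a ∈ X ↔ b ∉ X)) (hZ : ∀ a b, H.Adj a b → a ∈ Z)
    (hc : TwoConn H Z) (hno : ∀ C, Cyc H C → C.card < 2 * m) (hm : 2 * m ≤ Z.card) (hm1 : 1 ≤ m)
    (hbal : (Z.filter (· ∈ X)).card = (Z.filter (· ∉ X)).card)
    (hdeg : ∀ x ∈ Z, x ∈ X → ∀ y ∈ Z, y ∉ X →
      m + 1 ≤ (Z.filter (H.Adj x ·)).card + (Z.filter (H.Adj y ·)).card) : False := by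
  have hsum := Finset.card_filter_add_card_filter_not (s := Z) (· ∈ X)
  have hZne : Z.Nonempty := Finset.card_pos.1 (by omega)
  obtain ⟨p, M, hinj, hadj, hpZ, hlong⟩ := exists_longest (H := H) hZne
  have hM : 1 ≤ M := by
    obtain ⟨x, hx⟩ := Finset.card_pos.1 (show 0 < (Z.filter (· ∈ X)).card by omega)
    obtain ⟨y, hy⟩ := Finset.card_pos.1 (show 0 < (Z.filter (· ∉ X)).card by omega)
    rw [Finset.mem_filter] at hx hy
    have hd := hdeg x hx.1 hx.2 y hy.1 hy.2
    have : ∃ a b, H.Adj a b := by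
      by_contra hcon
      push Not at hcon
      simp [hcon] at hd
    obtain ⟨a, b, hab⟩ := this
    have hne : a ∉ ({b} : Finset V) := by simpa using hab.ne
    have := hlong _ _ _ (PathOn.cons a b b {b} hab hne (PathOn.single b)) (by
      intro z hz
      simp only [Finset.mem_insert, Finset.mem_singleton] at hz
      rcases hz with rfl | rfl
      · exact hZ _ _ hab
      · exact hZ _ _ hab.symm)
    rw [Finset.card_insert_of_notMem hne] at this
    simpa using this
  by_cases h0 : p 0 ∈ X
  · exact core_aux hX hc hno hm hbal hdeg hinj hadj hpZ hlong hM h0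
  · have hf1 : Z.filter (· ∈ Z \ X) = Z.filter (· ∉ X) := by
      ext z; simp only [Finset.mem_filter, Finset.mem_sdiff]; tauto
    have hf2 : Z.filter (· ∉ Z \ X) = Z.filter (· ∈ X) := by
      ext z; simp only [Finset.mem_filter, Finset.mem_sdiff]; tauto
    refine core_aux (X := Z \ X) ?_ hc hno hm ?_ ?_ hinj hadj hpZ hlong hM 
      (by simp [h0, hpZ 0 (by omega)])
    · intro a b hab
      have := hX a b hab
      have h1 := hZ a b hab
      have h2 := hZ b a hab.symm
      simp only [Finset.mem_sdiff]
      tauto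
    · rw [hf1, hf2, hbal]
    · intro x hx hxX y hy hyX
      simp only [Finset.mem_sdiff] at hxX hyX
      have := hdeg y hy (by tauto) x hx hxX.2
      omega

theorem easy [DecidableRel H.Adj] {Z X : Finset V} {m : ℕ}
    (hX : ∀ a b, H.Adj a b → (a ∈ X ↔ b ∉ X)) 
    (hno : ∀ C, Cyc H C → C.card < 2 * m) (hm1 : 1 ≤ m) (hZne : Z.Nonempty)
    (hdeg : ∀ x ∈ Z, m ≤ (Z.filter (H.Adj x ·)).card) : False := by
  obtain ⟨p, M, hinj, hadj, hpZ, hlong⟩ := exists_longest (H := H) hZne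
  have hPZ : (Finset.Icc 0 M).image p ⊆ Z := by
    intro z hz
    simp only [Finset.mem_image, Finset.mem_Icc] at hz
    obtain ⟨a, ha, rfl⟩ := hz
    exact hpZ a (by omega)
  have hN0 : ∀ w ∈ Z, H.Adj (p 0) w → ∃ i, i ≤ M ∧ p i = w := by
    intro w hw hadj0
    by_contra hcon
    push Not at hcon
    have hnot : w ∉ (Finset.Icc 0 M).image p := by
      simp only [Finset.mem_image, Finset.mem_Icc]
      rintro ⟨i, hi, h⟩
      exact hcon i hi.2 h
    have := hlong _ _ _ (PathOn.cons w _ _ _ hadj0.symm hnot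
      (PathOn.seg hinj hadj 0 M (by omega) le_rfl))
      (Finset.insert_subset hw hPZ)
    rw [Finset.card_insert_of_notMem hnot, image_seg_card hinj _ _ le_rfl] at this
    omega
  have hd := hdeg _ (hpZ 0 (by omega))
  have hd0 := card_nbr_le hN0
  set I := (Finset.range (M + 1)).filter (fun i => H.Adj (p 0) (p i)) with hI
  have hmemI : ∀ i, i ∈ I ↔ i ≤ M ∧ H.Adj (p 0) (p i) := by
    intro i; simp [hI]
  obtain ⟨K, hK, hKmax⟩ := Finset.exists_max_image I id (Finset.card_pos.1 (by omega))
  simp only [id] at hKmax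
  have hcyc : Cyc H ((Finset.Icc 0 K).image p) :=
    ⟨_, _, PathOn.seg hinj hadj 0 K (by omega) ((hmemI _).1 hK).1, ((hmemI _).1 hK).2.symm⟩
  have hcc := hcyc.count hX
  have hcn := hno _ hcyc
  set C := (Finset.Icc 0 K).image p with hC
  have hsum := Finset.card_filter_add_card_filter_not (s := C) (· ∈ X)
  have hNC : ∀ w ∈ Z, H.Adj (p 0) w → w ∈ C := by
    intro w hw hpw
    obtain ⟨i, hi, rfl⟩ := hN0 w hw hpw
    exact Finset.mem_image_of_mem _ (by simpa using hKmax i ((hmemI i).2 ⟨hi, hpw⟩))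
  by_cases h0 : p 0 ∈ X
  · have : (Z.filter (H.Adj (p 0) ·)).card ≤ (C.filter (· ∉ X)).card := by
      apply Finset.card_le_card
      intro w hw
      rw [Finset.mem_filter] at hw ⊢
      exact ⟨hNC w hw.1 hw.2, (hX _ _ hw.2).1 h0⟩
    omega
  · have : (Z.filter (H.Adj (p 0) ·)).card ≤ (C.filter (· ∈ X)).card := by
      apply Finset.card_le_card
      intro w hw
      rw [Finset.mem_filter] at hw ⊢
      exact ⟨hNC w hw.1 hw.2, (hX _ _ hw.2.symm).2 h0⟩
    omega

end core

section numeric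

/-- The extremal function. -/
def F (t a b : ℕ) : ℕ :=
  if min a b ≤ t then min a b * max a b
  else if min a b ≤ 2 * t then t * max a b + (min a b - t)
  else t * (min a b + max a b - 2 * t + 1)

theorem F_comm (t a b : ℕ) : F t a b = F t b a := by
  unfold F; rw [min_comm, max_comm]

theorem F_small {t a b : ℕ} (h : a ≤ b) (h1 : a ≤ t) : F t a b = a * b := by
  unfold F; rw [min_eq_left h, max_eq_right h, if_pos h1]

theorem F_mid {t a b : ℕ} (h : a ≤ b) (h1 : t < a) (h2 : a ≤ 2 * t) :
    F t a b + t = t * b + a := by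
  unfold F; rw [min_eq_left h, max_eq_right h, if_neg (by omega), if_pos h2]; omega

theorem F_large {t a b : ℕ} (h : a ≤ b) (h1 : t < a) (h2 : 2 * t ≤ a) :
    F t a b = t * (a + b - 2 * t + 1) := by
  unfold F; rw [min_eq_left h, max_eq_right h, if_neg (by omega)]
  split_ifs with h3
  · have : a = 2 * t := by omega
    subst this
    rw [show 2 * t + b - 2 * t + 1 = b + 1 by omega, show 2 * t - t = t by omega]
    ring
  · rfl

theorem F_drop {t a b : ℕ} (h : a ≤ b) (ht : 1 ≤ t) (h2 : 2 * t < a) :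
    F t (a - 1) b + t = F t a b ∧ F t a (b - 1) + t = F t a b := by
  have e0 := F_large h (by omega) h2.le
  have e1 : F t (a - 1) b = t * (a + b - 2 * t) := by
    rw [F_large (by omega) (by omega) (by omega)]
    congr 1; omega
  have e2 : F t a (b - 1) = t * (a + b - 2 * t) := by
    rcases Nat.lt_or_ge a b with hab | hab
    · rw [F_large (by omega) (by omega) (by omega)]
      congr 1; omega
    · rw [F_comm, F_large (by omega) (by omega) (by omega)]
      congr 1; omega
  rw [e0, e1, e2]
  constructor <;> ring

theorem F_cut_aux {t N a1 a2 b1 b2 : ℕ} (ha : a1 + a2 = N + 1) (hb : b1 + b2 = N) (h1 : 1 ≤ a1)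
    (h2 : 1 ≤ a2) (ht : t < N) (hN : N ≤ 2 * t) (hab : a1 ≤ b1) :
    F t a1 b1 + F t a2 b2 ≤ F t N N := by
  have e0 := F_mid (le_refl N) ht hN
  rw [F_comm t a2 b2]
  have hba : b2 ≤ a2 := by omega
  rcases Nat.lt_or_ge t a1 with h3 | h3
  · have e1 := F_mid hab h3 (by omega)
    rw [F_small hba (by omega)]
    have h4 : a2 ≤ t := by omega
    have := Nat.mul_le_mul_left b2 h4
    have : t * N = t * b1 + b2 * t := by rw [← hb]; ring
    omega
  rw [F_small hab h3]
  rcases Nat.lt_or_ge t b2 with h5 | h5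
  · have e2 := F_mid hba h5 (by omega)
    have h6 : b1 ≤ t := by omega
    obtain ⟨c, rfl⟩ : ∃ c, a1 = c + 1 := ⟨a1 - 1, by omega⟩
    have h7 : N = c + a2 := by omega
    have h8 : t * N = t * c + t * a2 := by rw [h7]; ring
    have h9 := Nat.mul_le_mul_left c h6
    have h10 : (c + 1) * b1 = c * b1 + b1 := by ring
    have h11 : c * t = t * c := by ring
    omega
  · rw [F_small hba h5]
    zify at *
    have hb1 : (b1 : ℤ) = N - b2 := by linarith
    have ha2 : (a2 : ℤ) = N + 1 - a1 := by linarith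
    rw [hb1, ha2]
    rcases le_total (2 * (a1 : ℤ)) (N + 1) with h6 | h6
    · nlinarith [mul_nonneg (sub_nonneg.2 h5) (sub_nonneg.2 h6),
        mul_nonneg (sub_nonneg.2 h1) (sub_nonneg.2 hN)]
    · nlinarith [mul_nonneg (sub_nonneg.2 h6) (Int.natCast_nonneg b2),
        mul_nonneg (sub_nonneg.2 h3) (Int.natCast_nonneg N)]

theorem F_cut {t N a1 a2 b1 b2 : ℕ} (ha : a1 + a2 = N + 1) (hb : b1 + b2 = N) (h1 : 1 ≤ a1)
    (h2 : 1 ≤ a2) (ht : t < N) (hN : N ≤ 2 * t) :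
    F t a1 b1 + F t a2 b2 ≤ F t N N := by
  rcases Nat.lt_or_ge b1 a1 with h | h
  · rw [add_comm]
    exact F_cut_aux (by omega) (by omega) h2 h1 ht hN (by omega)
  · exact F_cut_aux ha hb h1 h2 ht hN h

end numeric

section main
variable {V : Type*} [DecidableEq V] (G : SimpleGraph V) [DecidableRel G.Adj]

/-- number of neighbours in `Y` -/
def dd (x : V) (Y : Finset V) : ℕ := (Y.filter (G.Adj x ·)).card

/-- number of edges between `X` and `Y` -/
def ee (X Y : Finset V) : ℕ := ∑ x ∈ X, dd G x Y

theorem ee_comm (X Y : Finset V) : ee G X Y = ee G Y X := by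
  unfold ee dd
  simp only [Finset.card_filter]
  rw [Finset.sum_comm]
  simp only [G.adj_comm]

theorem ee_erase {X Y : Finset V} {x : V} (hx : x ∈ X) :
    ee G X Y = ee G (X.erase x) Y + dd G x Y := by
  unfold ee
  rw [Finset.sum_erase_add _ _ hx]

theorem ee_erase_right {X Y : Finset V} {y : V} (hy : y ∈ Y) :
    ee G X Y = ee G X (Y.erase y) + dd G y X := by
  rw [ee_comm, ee_erase G hy, ee_comm]

theorem ee_le_mul (X Y : Finset V) : ee G X Y ≤ X.card * Y.card := by
  unfold ee
  rw [← smul_eq_mul]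
  exact Finset.sum_le_card_nsmul _ _ _ (fun x _ => Finset.card_filter_le _ _)

theorem dd_mono {X Y : Finset V} (h : X ⊆ Y) (x : V) : dd G x X ≤ dd G x Y :=
  Finset.card_le_card (Finset.filter_subset_filter _ h)

/-- the bipartite subgraph between `X` and `Y` -/
def bip (X Y : Finset V) : SimpleGraph V where
  Adj a b := G.Adj a b ∧ ((a ∈ X ∧ b ∈ Y) ∨ (a ∈ Y ∧ b ∈ X))
  symm := ⟨fun a b h => ⟨h.1.symm, by tauto⟩⟩
  loopless := ⟨fun a h => G.irrefl h.1⟩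

instance (X Y : Finset V) : DecidableRel (bip G X Y).Adj := fun a b =>
  inferInstanceAs (Decidable (G.Adj a b ∧ ((a ∈ X ∧ b ∈ Y) ∨ (a ∈ Y ∧ b ∈ X))))

theorem bip_adj {X Y : Finset V} {a b : V} :
    (bip G X Y).Adj a b ↔ G.Adj a b ∧ ((a ∈ X ∧ b ∈ Y) ∨ (a ∈ Y ∧ b ∈ X)) := Iff.rfl

theorem bip_X {X Y : Finset V} (hd : Disjoint X Y) (a b : V) (h : (bip G X Y).Adj a b) :
    a ∈ X ↔ b ∉ X := by
  rw [Finset.disjoint_left] at hd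
  have h1 := @hd a
  have h2 := @hd b
  rw [bip_adj] at h
  tauto

theorem bip_deg_X {X Y : Finset V} (hd : Disjoint X Y) {x : V} (hx : x ∈ X) :
    ((X ∪ Y).filter ((bip G X Y).Adj x ·)).card = dd G x Y := by
  unfold dd
  congr 1
  ext w
  rw [Finset.disjoint_left] at hd
  have h1 := @hd x hx
  simp only [Finset.mem_filter, Finset.mem_union, bip_adj]
  tauto

theorem bip_deg_Y {X Y : Finset V} (hd : Disjoint X Y) {y : V} (hy : y ∈ Y) :
    ((X ∪ Y).filter ((bip G X Y).Adj y ·)).card = dd G y X := by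
  unfold dd
  congr 1
  ext w
  rw [Finset.disjoint_right] at hd
  have h1 := @hd y hy
  simp only [Finset.mem_filter, Finset.mem_union, bip_adj]
  tauto

theorem bip_cyc {X Y C : Finset V} (h : Cyc (bip G X Y) C) : Cyc G C := by
  obtain ⟨a, b, hp, hba⟩ := h
  exact ⟨a, b, hp.mono (fun a b h => ((bip_adj G).1 h).1), hba.1⟩

theorem ee_cut {X Y S T : Finset V} {v : V} (hv : v ∈ X) (hvY : v ∉ Y) 
    (hST : ∀ z, z ∈ X ∪ Y → z = v ∨ z ∈ S ∨ z ∈ T)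
    (hno1 : ∀ x ∈ X, x ∈ S → ∀ y ∈ Y, y ∈ T → ¬ G.Adj x y)
    (hno2 : ∀ x ∈ X, x ∈ T → ∀ y ∈ Y, y ∈ S → ¬ G.Adj x y) :
    ee G X Y ≤ ee G (insert v (X ∩ S)) (Y ∩ S) + ee G (insert v (X ∩ T)) (Y ∩ T) := by
  have key : ∀ A B : Finset V, ee G A B = ((A ×ˢ B).filter (fun z => G.Adj z.1 z.2)).card := by
    intro A B
    unfold ee dd
    simp only [Finset.card_filter]
    rw [Finset.sum_product]
  rw [key, key, key]
  refine le_trans (Finset.card_le_card ?_) (Finset.card_union_le _ _)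
  rintro ⟨x, y⟩ hxy
  simp only [Finset.mem_filter, Finset.mem_product, Finset.mem_union, Finset.mem_insert,
    Finset.mem_inter] at hxy hST ⊢
  obtain ⟨⟨hx, hy⟩, hadj⟩ := hxy
  have h1 := hST x (Or.inl hx)
  have h2 := hST y (Or.inr hy)
  have hyv : y ≠ v := fun h => hvY (h ▸ hy)
  have h3 := hno1 x hx
  have h4 := hno2 x hx
  have h5 : y ∈ T → x ∈ S → False := fun a b => h3 b y hy a hadj
  have h6 : y ∈ S → x ∈ T → False := fun a b => h4 b y hy a hadj
  tauto

/-- the counting inequality for one cut vertex in `X` -/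
theorem cut_bound {t N : ℕ} {X Y S T : Finset V} {v : V} (hd : Disjoint X Y)
    (ih : ∀ X' Y' : Finset V, X'.card + Y'.card < X.card + Y.card → Disjoint X' Y' →
      ee G X' Y' ≤ F t X'.card Y'.card)
    (hXN : X.card = N) (hYN : Y.card = N) (ht : t < N) (hN : N ≤ 2 * t) (hv : v ∈ X)
    (hS : S.Nonempty) (hT : T.Nonempty) (hdST : Disjoint S T)
    (hST : S ∪ T = (X ∪ Y).erase v)
    (hno : ∀ s ∈ S, ∀ t ∈ T, ¬ (bip G X Y).Adj s t) : ee G X Y ≤ F t N N := by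
  have hdl := Finset.disjoint_left.1 hd
  have hvY : v ∉ Y := hdl hv
  have hmem : ∀ z, z ∈ S ∨ z ∈ T ↔ z ≠ v ∧ (z ∈ X ∨ z ∈ Y) := by
    intro z
    rw [← Finset.mem_union, hST, Finset.mem_erase, Finset.mem_union]
  have hvS : v ∉ S := fun h => ((hmem v).1 (Or.inl h)).1 rfl
  have hvT : v ∉ T := fun h => ((hmem v).1 (Or.inr h)).1 rfl
  have h1 := ee_cut G (S := S) (T := T) hv hvY (by
      intro z hz
      rw [Finset.mem_union] at hz
      have := hmem z
      tauto)
    (by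
      intro x hx hxS y hy hyT hadj
      exact hno x hxS y hyT ⟨hadj, Or.inl ⟨hx, hy⟩⟩)
    (by
      intro x hx hxT y hy hyS hadj
      exact hno y hyS x hxT ⟨hadj.symm, Or.inr ⟨hy, hx⟩⟩)
  have c1 : (insert v (X ∩ S)).card = (X ∩ S).card + 1 :=
    Finset.card_insert_of_notMem (by simp [hvS])
  have c2 : (insert v (X ∩ T)).card = (X ∩ T).card + 1 :=
    Finset.card_insert_of_notMem (by simp [hvT])
  have c3 : (X ∩ S).card + (X ∩ T).card + 1 = N := by
    rw [← hXN, ← Finset.card_erase_add_one hv, ← Finset.card_union_of_disjoint]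
    · congr 2
      ext z
      have := hmem z
      have := @hdl z
      simp only [Finset.mem_union, Finset.mem_inter, Finset.mem_erase]
      tauto
    · exact Finset.disjoint_of_subset_left Finset.inter_subset_right
        (Finset.disjoint_of_subset_right Finset.inter_subset_right hdST)
  have c4 : (Y ∩ S).card + (Y ∩ T).card = N := by
    rw [← hYN, ← Finset.card_union_of_disjoint]
    · congr 1
      ext z
      have := hmem z
      have : z ∈ Y → z ≠ v := fun h h' => hvY (h' ▸ h)
      simp only [Finset.mem_union, Finset.mem_inter]
      tauto
    · exact Finset.disjoint_of_subset_left Finset.inter_subset_right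
        (Finset.disjoint_of_subset_right Finset.inter_subset_right hdST)
  have pos : ∀ U : Finset V, U.Nonempty → (∀ z ∈ U, z ∈ S ∨ z ∈ T) →
      1 ≤ (X ∩ U).card + (Y ∩ U).card := by
    rintro U ⟨z, hz⟩ hU
    have h3 := (hmem z).1 (hU z hz)
    rcases h3.2 with h | h
    · have : 0 < (X ∩ U).card := Finset.card_pos.2 ⟨z, by simp [h, hz]⟩
      omega
    · have : 0 < (Y ∩ U).card := Finset.card_pos.2 ⟨z, by simp [h, hz]⟩
      omega
  have p1 := pos S hS (fun z hz => Or.inl hz)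
  have p2 := pos T hT (fun z hz => Or.inr hz)
  have hdd : ∀ U, Disjoint (insert v (X ∩ U)) (Y ∩ U) := by
    intro U
    rw [Finset.disjoint_left]
    intro z hz hz'
    simp only [Finset.mem_insert, Finset.mem_inter] at hz hz'
    rcases hz with rfl | hz
    · exact hvY hz'.1
    · exact hdl hz.1 hz'.1
  have i1 := ih (insert v (X ∩ S)) (Y ∩ S) (by omega) (hdd S)
  have i2 := ih (insert v (X ∩ T)) (Y ∩ T) (by omega) (hdd T)
  refine h1.trans ((Nat.add_le_add i1 i2).trans ?_)
  exact F_cut (by omega) (by omega) (by omega) (by omega) ht hN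

theorem step {t : ℕ} (ht : 1 ≤ t) (hno : ∀ C, Cyc G C → C.card < 2 * (t + 1)) (X Y : Finset V)
    (ih : ∀ X' Y' : Finset V, X'.card + Y'.card < X.card + Y.card → Disjoint X' Y' →
      ee G X' Y' ≤ F t X'.card Y'.card)
    (hd : Disjoint X Y) (hab : X.card ≤ Y.card) : ee G X Y ≤ F t X.card Y.card := by
  rcases Nat.lt_or_ge t X.card with hta | hta
  swap
  · rw [F_small hab hta]
    exact ee_le_mul G X Y
  by_contra hcon
  push Not at hcon
  have hnoH : ∀ C, Cyc (bip G X Y) C → C.card < 2 * (t + 1) := fun C hC => hno C (bip_cyc G hC)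
  have eraseX : ∀ x ∈ X, ee G X Y ≤ F t (X.card - 1) Y.card + dd G x Y := by
    intro x hx
    have h0 := Finset.card_erase_of_mem hx
    have h1 := ih (X.erase x) Y (by rw [h0]; omega)
      (Finset.disjoint_of_subset_left (Finset.erase_subset _ _) hd)
    rw [h0] at h1
    rw [ee_erase G hx]
    omega
  have eraseY : ∀ y ∈ Y, ee G X Y ≤ F t X.card (Y.card - 1) + dd G y X := by
    intro y hy
    have h0 := Finset.card_erase_of_mem hy
    have h1 := ih X (Y.erase y) (by rw [h0]; omega)
      (Finset.disjoint_of_subset_right (Finset.erase_subset _ _) hd)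
    rw [h0] at h1
    rw [ee_erase_right G hy]
    omega
  rcases Nat.lt_or_ge (2 * t) X.card with h2t | h2t
  · obtain ⟨d1, d2⟩ := F_drop hab ht h2t
    refine easy (Z := X ∪ Y) (bip_X G hd) hnoH (by omega) ?_ ?_
    · obtain ⟨x, hx⟩ := Finset.card_pos.1 (show 0 < X.card by omega)
      exact ⟨x, Finset.mem_union_left _ hx⟩
    · intro z hz
      rcases Finset.mem_union.1 hz with hz | hz
      · rw [bip_deg_X G hd hz]
        have := eraseX z hz
        omega
      · rw [bip_deg_Y G hd hz]
        have := eraseY z hz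
        omega
  rcases Nat.lt_or_ge X.card Y.card with hlt | hge
  · obtain ⟨y, hy, hmin⟩ := Finset.exists_min_image Y (fun y => dd G y X)
      (Finset.card_pos.1 (by omega))
    have h1 := eraseY y hy
    have e0 := F_mid hab hta h2t
    have e1 := F_mid (show X.card ≤ Y.card - 1 by omega) hta h2t
    have h2 : Y.card * dd G y X ≤ ee G X Y := by
      rw [ee_comm, ← smul_eq_mul]
      exact Finset.card_nsmul_le_sum _ _ _ hmin
    obtain ⟨c, hc⟩ : ∃ c, Y.card = c + 1 := ⟨Y.card - 1, by omega⟩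
    rw [hc] at h1 h2 e0 e1 hlt hcon
    rw [Nat.add_sub_cancel] at h1 e1
    have hdt : t + 1 ≤ dd G y X := by
      have : t * (c + 1) = t * c + t := by ring
      omega
    have h3 : (c + 1) * dd G y X = c * dd G y X + dd G y X := by ring
    have h4 := Nat.mul_le_mul_left c hdt
    have h5 : c * (t + 1) = t * c + c := by ring
    omega
  have hYX : Y.card = X.card := by omega
  have eraseXY : ∀ x ∈ X, ∀ y ∈ Y, t + 1 + 1 ≤ dd G x Y + dd G y X := by
    intro x hx y hy
    have h0 := Finset.card_erase_of_mem hx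
    have h0' := Finset.card_erase_of_mem hy
    have h1 := ih (X.erase x) (Y.erase y) (by rw [h0, h0']; omega)
      (Finset.disjoint_of_subset_left (Finset.erase_subset _ _)
        (Finset.disjoint_of_subset_right (Finset.erase_subset _ _) hd))
    rw [h0, h0', hYX] at h1
    rw [ee_erase G hx, ee_erase_right G hy, hYX] at hcon
    have h2 := dd_mono G (Finset.erase_subset x X) y
    have e0 := F_mid (le_refl X.card) hta h2t
    have e1 : F t (X.card - 1) (X.card - 1) + (t + 1) = F t X.card X.card := by
      obtain ⟨c, hc⟩ : ∃ c, X.card = c + 1 := ⟨X.card - 1, by omega⟩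
      rw [hc] at e0 hta h2t ⊢
      rw [Nat.add_sub_cancel]
      have h3 : t * (c + 1) = t * c + t := by ring
      rcases Nat.lt_or_ge t c with htc | htc
      · have e2 := F_mid (le_refl c) htc (by omega)
        omega
      · have : c = t := by omega
        subst this
        rw [F_small (le_refl c) le_rfl]
        omega
    omega
  have hmem : ∀ z, z ∈ X → z ∉ Y := fun z hz => Finset.disjoint_left.1 hd hz
  have hf1 : (X ∪ Y).filter (· ∈ X) = X := by
    ext z; simp only [Finset.mem_filter, Finset.mem_union]; tauto
  have hf2 : (X ∪ Y).filter (· ∉ X) = Y := by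
    ext z; have := hmem z; simp only [Finset.mem_filter, Finset.mem_union]; tauto
  refine core (Z := X ∪ Y) (bip_X G hd) ?_ ?_ hnoH ?_ (by omega) ?_ ?_
  · intro a b hab
    rw [bip_adj] at hab
    rw [Finset.mem_union]
    tauto
  · intro v hv S hS hSne hTne
    by_contra hno'
    push Not at hno'
    rw [hYX] at hcon
    have hST : S ∪ ((X ∪ Y).erase v \ S) = (X ∪ Y).erase v := Finset.union_sdiff_of_subset hS
    rcases Finset.mem_union.1 hv with hvX | hvY
    · exact absurd (cut_bound G hd ih rfl hYX hta h2t hvX hSne hTne Finset.disjoint_sdiff hST hno')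
        (by omega)
    · refine absurd (cut_bound G (X := Y) (Y := X) (t := t) hd.symm ?_ hYX rfl hta h2t hvY hSne hTne
        Finset.disjoint_sdiff (by rw [hST, Finset.union_comm]) ?_) (by rw [ee_comm]; omega)
      · intro X' Y' h1 h2
        exact ih X' Y' (by omega) h2
      · intro s hs t ht hadj
        refine hno' s hs t ht ?_
        rw [bip_adj] at hadj ⊢
        tauto
  · rw [Finset.card_union_of_disjoint hd]
    omega
  · rw [hf1, hf2, hYX]
  · intro x hx hxX y hy hyX
    have hyY : y ∈ Y := by
      rw [Finset.mem_union] at hy; tauto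
    rw [bip_deg_X G hd hxX, bip_deg_Y G hd hyY]
    exact eraseXY x hxX y hyY

theorem main {t : ℕ} (ht : 1 ≤ t) (hno : ∀ C, Cyc G C → C.card < 2 * (t + 1)) :
    ∀ (s : ℕ) (X Y : Finset V), X.card + Y.card = s → Disjoint X Y →
      ee G X Y ≤ F t X.card Y.card := by
  intro s
  induction s using Nat.strong_induction_on with
  | _ s ih =>
  intro X Y hs hd
  rcases le_total X.card Y.card with h | h
  · exact step G ht hno X Y (fun X' Y' h1 h2 => ih _ (by omega) X' Y' rfl h2) hd h
  · rw [ee_comm, F_comm]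
    exact step G ht hno Y X (fun X' Y' h1 h2 => ih _ (by omega) X' Y' rfl h2) hd.symm h

theorem edges_le [Fintype V] {X Y : Finset V} 
    (hbip : ∀ x y : V, G.Adj x y → (x ∈ X ∧ y ∈ Y) ∨ (x ∈ Y ∧ y ∈ X)) :
    G.edgeFinset.card ≤ ee G X Y := by
  have key : ee G X Y = ((X ×ˢ Y).filter (fun z => G.Adj z.1 z.2)).card := by
    unfold ee dd
    simp only [Finset.card_filter]
    rw [Finset.sum_product]
  rw [key]
  refine le_trans (Finset.card_le_card ?_) (Finset.card_image_le (f := fun z => s(z.1, z.2)))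
  intro e he
  rw [SimpleGraph.mem_edgeFinset] at he
  induction e using Sym2.ind with
  | _ x y =>
  rw [SimpleGraph.mem_edgeSet] at he
  rw [Finset.mem_image]
  rcases hbip x y he with h | h
  · exact ⟨(x, y), by simp [h, he], rfl⟩
  · exact ⟨(y, x), by simp [h, he.symm], Sym2.eq_swap⟩

end main

end Jackson

/-- **Jackson (1985).** Let `G = (X, Y; E)` be a bipartite graph with `|X| = n`, `|Y| = b`,
where `b ≥ n ≥ n - k ≥ 2`. If `e(G) > (b-1)(n-k-1) + n` when `n ≤ 2(n-k) - 2`, and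
`e(G) > (b-n+2k+3)(n-k-1)` when `n ≥ 2(n-k) - 2`, then `G` contains a cycle of length
at least `2n - 2k`. -/
theorem stmt_3 {V : Type*} [Fintype V] [DecidableEq V]
    (G : SimpleGraph V) [DecidableRel G.Adj] (n b k : ℕ)
    (X Y : Finset V) (hdisj : Disjoint X Y) (hunion : X ∪ Y = Finset.univ)
    (hX : X.card = n) (hY : Y.card = b)
    (hbip : ∀ x y : V, G.Adj x y → (x ∈ X ∧ y ∈ Y) ∨ (x ∈ Y ∧ y ∈ X))
    (hbn : n ≤ b) (hk : 2 ≤ n - k) (hkn : k ≤ n)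
    (he : (if n ≤ 2 * (n - k) - 2 then (b - 1) * (n - k - 1) + n
           else (b - n + 2 * k + 3) * (n - k - 1)) < G.edgeFinset.card) :
    ∃ (v : V) (c : G.Walk v v), c.IsCycle ∧ 2 * (n - k) ≤ c.length := by
  by_contra hcon
  push Not at hcon
  have hno : ∀ C, Jackson.Cyc G C → C.card < 2 * ((n - k - 1) + 1) := by
    intro C hC
    by_contra hlt
    push Not at hlt
    obtain ⟨v, c, hc, hl⟩ := hC.exists_cycle (by omega)
    have := hcon v c hc
    omega
  have h1 := Jackson.main G (show 1 ≤ n - k - 1 by omega) hno _ X Y rfl hdisj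
  have h2 := Jackson.edges_le G hbip
  rw [hX, hY] at h1
  obtain ⟨t, ht⟩ : ∃ t, n - k - 1 = t := ⟨_, rfl⟩
  rw [ht] at h1 he
  split_ifs at he with hif
  · rcases Nat.lt_or_ge t n with htn | htn
    · have e := Jackson.F_mid hbn htn (by omega)
      obtain ⟨c, rfl⟩ : ∃ c, b = c + 1 := ⟨b - 1, by omega⟩
      rw [Nat.add_sub_cancel] at he
      have : t * (c + 1) = c * t + t := by ring
      omega
    · omega
  · have e := Jackson.F_large hbn (show t < n by omega) (by omega)
    rw [show n + b - 2 * t + 1 = b - n + 2 * k + 3 by omega, mul_comm] at e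
    omega
end

section
/- Let G be a 2-connected graph on n vertices and P a path in G on m vertices with endpoints x and y. Then G contains a cycle of length at least min{m, d_P(x) + d_P(y)}, where d_P(v) denotes the number of neighbors of v lying on P. -/
/-- A finite simple graph is 2-connected if it has at least 3 vertices and
deleting any single vertex leaves a connected graph. -/
def IsTwoConnected {V : Type*} [Fintype V] (G : SimpleGraph V) : Prop :=
  3 ≤ Fintype.card V ∧
    ∀ v : V, ((⊤ : G.Subgraph).deleteVerts {v}).coe.Connected

namespace Posa
open SimpleGraph

variable {V : Type*} [DecidableEq V] {G : SimpleGraph V}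

def PathOn (G : SimpleGraph V) (S : Finset V) (u v : V) : Prop :=
  ∃ p : G.Walk u v, p.IsPath ∧ p.support.toFinset = S

lemma PathOn.left {S : Finset V} {u v : V} (h : PathOn G S u v) : u ∈ S := by
  obtain ⟨p, -, rfl⟩ := h; simp

lemma PathOn.right {S : Finset V} {u v : V} (h : PathOn G S u v) : v ∈ S := by
  obtain ⟨p, -, rfl⟩ := h; simp

lemma PathOn.symm {S : Finset V} {u v : V} (h : PathOn G S u v) : PathOn G S v u := by
  obtain ⟨p, hp, rfl⟩ := h
  exact ⟨p.reverse, hp.reverse, by simp⟩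

lemma PathOn.single (u : V) : PathOn G {u} u u := ⟨Walk.nil, by simp, by simp⟩

lemma PathOn.cons {S : Finset V} {u v w : V} (h : PathOn G S v w) (ha : G.Adj u v) (hu : u ∉ S) :
    PathOn G (insert u S) u w := by
  obtain ⟨p, hp, rfl⟩ := h
  exact ⟨Walk.cons ha p, by simpa [Walk.cons_isPath_iff, hp] using hu, by simp⟩

lemma PathOn.snoc {S : Finset V} {u v w : V} (h : PathOn G S u v) (ha : G.Adj v w) (hu : w ∉ S) :
    PathOn G (insert w S) u w := (h.symm.cons ha.symm hu).symm

lemma PathOn.append {S T : Finset V} {u v w : V} (h : PathOn G S u v) (h' : PathOn G T v w)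
    (hST : ∀ z ∈ S, z ∈ T → z = v) : PathOn G (S ∪ T) u w := by
  obtain ⟨p, hp, rfl⟩ := h
  induction p with
  | nil =>
    have := h'.left
    simpa [Finset.insert_eq_of_mem this] using h'
  | cons ha q ih =>
    rw [Walk.cons_isPath_iff] at hp
    have h1 := ih h' hp.1 (fun z hz hz' => hST z (by simp at hz ⊢; tauto) hz')
    have := h1.cons ha (by
      simp only [Finset.mem_union, List.mem_toFinset, not_or]
      refine ⟨hp.2, fun hh => ?_⟩
      have := hST _ (by simp) hh
      exact hp.2 (this ▸ q.end_mem_support))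
    simpa [Finset.insert_union] using this

lemma PathOn.uncons {S : Finset V} {u v : V} (h : PathOn G S u v) (huv : u ≠ v) :
    ∃ w, G.Adj u w ∧ PathOn G (S.erase u) w v := by
  obtain ⟨p, hp, rfl⟩ := h
  cases p with
  | nil => exact absurd rfl huv
  | cons ha q =>
    rw [Walk.cons_isPath_iff] at hp
    refine ⟨_, ha, q, hp.1, ?_⟩
    ext z
    simp only [List.mem_toFinset, Walk.support_cons, Finset.mem_erase, List.mem_cons]
    grind

lemma PathOn.split {S : Finset V} {u v z : V} (h : PathOn G S u v) (hz : z ∈ S) :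
    ∃ S₁ S₂, PathOn G S₁ u z ∧ PathOn G S₂ z v ∧ S₁ ∪ S₂ = S ∧ ∀ w ∈ S₁, w ∈ S₂ → w = z := by
  obtain ⟨p, hp, rfl⟩ := h
  induction p with
  | nil =>
    simp at hz; subst hz
    exact ⟨_, _, .single _, .single _, by simp, by simp⟩
  | @cons u' v' w' ha q ih =>
    rw [Walk.cons_isPath_iff] at hp
    by_cases hzu : z = u'
    · subst hzu
      refine ⟨{z}, _, .single _, ⟨Walk.cons ha q, by simp [Walk.cons_isPath_iff, hp], rfl⟩, by simp, by simp⟩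
    · obtain ⟨S₁, S₂, h1, h2, h3, h4⟩ := ih hp.1 (by simpa [hzu] using hz)
      have hu : u' ∉ S₁ ∪ S₂ := by rw [h3]; simpa using hp.2
      refine ⟨insert u' S₁, S₂, h1.cons ha (by grind), h2, ?_, by grind⟩
      rw [Finset.insert_union, h3]; simp

/-- Trim a path at the first vertex of `Z`. -/
lemma PathOn.trim {S : Finset V} {u v : V} (h : PathOn G S u v) (Z : Finset V) (hv : v ∈ Z) :
    ∃ z ∈ Z, ∃ S' ⊆ S, PathOn G S' u z ∧ ∀ w ∈ S', w ∈ Z → w = z := by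
  obtain ⟨p, hp, rfl⟩ := h
  induction p with
  | nil => exact ⟨_, hv, _, by simp, .single _, by simp⟩
  | @cons u' v' w' ha q ih =>
    rw [Walk.cons_isPath_iff] at hp
    by_cases hu : u' ∈ Z
    · exact ⟨_, hu, {u'}, by simp, .single _, by simp⟩
    · obtain ⟨z, hz, S', hS, h1, h2⟩ := ih hv hp.1
      have : u' ∉ S' := fun hh => hp.2 (by simpa using hS hh)
      refine ⟨z, hz, insert u' S', ?_, h1.cons ha this, by grind⟩
      intro w hw
      simp only [Finset.mem_insert] at hw
      rcases hw with rfl | hw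
      · simp
      · have := hS hw; simp at this; simp [this]

lemma PathOn.card_eq_two {u v : V} (p : G.Walk u v) (hp : p.IsPath)
    (h : s(u, v) ∈ p.edges) : p.support.toFinset.card ≤ 2 := by
  cases p with
  | nil => simp at h
  | @cons _ v' _ ha q =>
    rw [Walk.cons_isPath_iff] at hp
    simp only [Walk.edges_cons, List.mem_cons] at h
    rcases h with h | h
    · have : v = v' := by
        rw [Sym2.eq_iff] at h
        rcases h with ⟨_, h⟩ | ⟨h, h'⟩
        · exact h
        · exact absurd h ha.ne
      subst this
      have : q = Walk.nil := (Walk.isPath_iff_nil.1 hp.1).eq_nil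
      subst this
      simp
      exact Finset.card_le_two
    · exact absurd (Walk.fst_mem_support_of_mem_edges _ h) hp.2

def HasCycle (G : SimpleGraph V) (n : ℕ) : Prop :=
  ∃ (v : V) (c : G.Walk v v), c.IsCycle ∧ n ≤ c.length

lemma PathOn.close {S : Finset V} {u v : V} (h : PathOn G S u v) (ha : G.Adj v u)
    (hS : 3 ≤ S.card) : HasCycle G S.card := by
  obtain ⟨p, hp, rfl⟩ := h
  refine ⟨v, Walk.cons ha p, ?_, ?_⟩
  · rw [Walk.cons_isCycle_iff]
    refine ⟨hp, fun h => ?_⟩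
    rw [Sym2.eq_swap] at h
    have := PathOn.card_eq_two p hp h
    omega
  · rw [List.toFinset_card_of_nodup hp.support_nodup]; simp

lemma PathOn.close2 {S T : Finset V} {u v : V} (h : PathOn G S u v) (h' : PathOn G T u v)
    (huv : u ≠ v) (hST : ∀ z ∈ S, z ∈ T → z = u ∨ z = v) (hc : 3 ≤ (S ∪ T).card) :
    HasCycle G (S ∪ T).card := by
  obtain ⟨w, ha, h1⟩ := h'.uncons huv
  have h2 := h.append h1.symm (by grind)
  have : S ∪ T.erase u = S ∪ T := by
    have := h.left
    ext z; grind
  rw [this] at h2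
  exact h2.close ha.symm hc

/-- Every two vertices other than `w` are joined avoiding `w`. -/
def TC (G : SimpleGraph V) : Prop :=
  ∀ w u v : V, u ≠ w → v ≠ w → ∃ S, PathOn G S u v ∧ w ∉ S

lemma fan (hG : TC G) (A : Finset V) (g : ℕ → V) (a0 : V) (h0 : g 0 ∈ A) (ha0 : a0 ∈ A)
    (hne : a0 ≠ g 0) (K : ℕ) (hadj : ∀ i ≤ K, G.Adj (g i) (g (i+1)))
    (hA : ∀ i ≤ K, g (i+1) ∉ A) :
    ∃ s ∈ A, s ≠ g 0 ∧ ∃ R₁ R₂, PathOn G R₁ (g 0) (g (K+1)) ∧ PathOn G R₂ s (g (K+1)) ∧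
      (∀ z ∈ R₁, z ∈ R₂ → z = g (K+1)) ∧ (∀ z ∈ R₁, z ∈ A → z = g 0) ∧
      (∀ z ∈ R₂, z ∈ A → z = s) := by
  induction K with
  | zero =>
    have hadj0 := hadj 0 le_rfl
    have hA0 := hA 0 le_rfl
    simp only [Nat.zero_add] at *
    obtain ⟨S, hS, hS'⟩ := hG (g 0) (g 1) a0 hadj0.ne' hne
    obtain ⟨s, hs, S', hSS, h1, h2⟩ := hS.trim A ha0
    have := h1.right
    refine ⟨s, hs, by grind, _, S', (PathOn.single (g 0)).snoc hadj0 (by grind), h1.symm, ?_, ?_, ?_⟩ <;> grind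
  | succ K ih =>
    obtain ⟨s, hs, hsa, R₁, R₂, h1, h2, h12, hA1, hA2⟩ := ih (fun i hi => hadj i (by omega))
      (fun i hi => hA i (by omega))
    have hwadj := hadj (K+1) le_rfl
    have hw'A := hA (K+1) le_rfl
    have hwA := hA K (by omega)
    generalize g (K+1+1) = w' at *
    generalize g (K+1) = w at *
    generalize g 0 = a at *
    have e1 := h1.left; have e2 := h1.right; have e3 := h2.left; have e4 := h2.right
    have hww := hwadj.ne
    by_cases c1 : w' ∈ R₁
    · obtain ⟨S₁, S₂, p1, p2, p3, p4⟩ := h1.split c1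
      have q := p2.right
      exact ⟨s, hs, hsa, S₁, _, p1, h2.snoc hwadj (by grind), by grind, by grind, by grind⟩
    by_cases c2 : w' ∈ R₂
    · obtain ⟨S₁, S₂, p1, p2, p3, p4⟩ := h2.split c2
      have q := p2.right
      exact ⟨s, hs, hsa, _, S₁, h1.snoc hwadj (by grind), p1, by grind, by grind, by grind⟩
    obtain ⟨S0, hS0, hS0'⟩ := hG w w' a hww.symm (by grind)
    obtain ⟨z, hz, S, hSS, k1, k2⟩ := hS0.trim (R₁ ∪ R₂ ∪ A) (by grind)
    have hwS : w ∉ S := fun h => hS0' (hSS h)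
    have f1 := k1.left; have f2 := k1.right
    by_cases d1 : z ∈ R₁
    · obtain ⟨S₁, S₂, p1, p2, p3, p4⟩ := h1.split d1
      have q := p2.right
      have q' := p1.right
      refine ⟨s, hs, hsa, _, _, p1.append k1.symm ?_, h2.snoc hwadj c2, ?_, ?_, ?_⟩ <;> grind
    by_cases d2 : z ∈ R₂
    · obtain ⟨S₁, S₂, p1, p2, p3, p4⟩ := h2.split d2
      have q := p2.right
      have q' := p1.right
      refine ⟨s, hs, hsa, _, _, h1.snoc hwadj c1, p1.append k1.symm ?_, ?_, ?_, ?_⟩ <;> grind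
    refine ⟨z, by grind, by grind, _, _, h1.snoc hwadj c1, k1.symm, ?_, ?_, ?_⟩ <;> grind

lemma link (hG : TC G) (A B : Finset V) (a b b0 : V) (hbB : b ∈ B)
    (hb0 : b0 ∈ B) (hbne : b0 ≠ b) (haA : a ∈ A) (hAB : Disjoint A B)
    (Q : Finset V) (hQ : PathOn G Q a b) (hQA : ∀ z ∈ Q, z ∈ A → z = a)
    (hQB : ∀ z ∈ Q, z ∈ B → z = b)
    (hfan : ∃ s ∈ A, s ≠ a ∧ ∃ R₁ R₂, PathOn G R₁ a b ∧ PathOn G R₂ s b ∧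
      (∀ z ∈ R₁, z ∈ R₂ → z = b) ∧ (∀ z ∈ R₁, z ∈ A → z = a) ∧
      (∀ z ∈ R₂, z ∈ A → z = s)) :
    ∃ s ∈ A, s ≠ a ∧ ∃ t ∈ B, t ≠ b ∧ ∃ t₁ t₂, ((t₁ = b ∧ t₂ = t) ∨ (t₁ = t ∧ t₂ = b)) ∧
      ∃ S₁ S₂, PathOn G S₁ a t₁ ∧ PathOn G S₂ s t₂ ∧ Disjoint S₁ S₂ ∧
      (∀ z ∈ S₁, z ∈ A → z = a) ∧ (∀ z ∈ S₂, z ∈ A → z = s) ∧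
      (∀ z ∈ S₁, z ∈ B → z = t₁) ∧ (∀ z ∈ S₂, z ∈ B → z = t₂) := by
  simp only [Finset.disjoint_left] at *
  obtain ⟨s, hs, hsa, R₁, R₂, h1, h2, h12, hA1, hA2⟩ := hfan
  obtain ⟨t₁, ht1, S₁, hS1, k1, l1⟩ := h1.trim B hbB
  obtain ⟨t₂, ht2, S₂, hS2, k2, l2⟩ := h2.trim B hbB
  have e1 := k1.left; have e2 := k1.right; have e3 := k2.left; have e4 := k2.right
  have hA1' : ∀ z ∈ S₁, z ∈ A → z = a := fun z hz => hA1 z (hS1 hz)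
  have hA2' : ∀ z ∈ S₂, z ∈ A → z = s := fun z hz => hA2 z (hS2 hz)
  have h12' : ∀ z ∈ S₁, z ∈ S₂ → z = b := fun z hz hz' => h12 z (hS1 hz) (hS2 hz')
  clear h12 hA1 hA2 h1 h2 hS1 hS2
  by_cases c1 : t₁ = b <;> by_cases c2 : t₂ = b
  · subst c1; subst c2
    obtain ⟨S0, hS0, hS0'⟩ := hG t₂ b0 a hbne (by grind)
    obtain ⟨z, hz, S, hSS, m1, m2⟩ := hS0.trim (S₁ ∪ S₂ ∪ A) (by grind)
    obtain ⟨t, ht, T, hTS, n1, n2⟩ := m1.symm.trim B hb0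
    have f1 := n1.left; have f2 := n1.right
    have hbT : t₂ ∉ T := fun h => hS0' (hSS (hTS h))
    have m2' : ∀ w ∈ T, w ∈ S₁ ∪ S₂ ∪ A → w = z := fun w hw => m2 w (hTS hw)
    clear m2 hTS hSS hS0 hS0'
    by_cases d1 : z ∈ S₁
    · obtain ⟨U₁, U₂, p1, p2, p3, p4⟩ := k1.split d1
      have q := p2.right
      have q' := p1.right
      refine ⟨s, hs, hsa, t, ht, by grind, t, t₂, by simp, _, _, p1.append n1 ?_, k2, ?_, ?_, ?_, ?_, ?_⟩ <;> grind
    by_cases d2 : z ∈ S₂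
    · obtain ⟨U₁, U₂, p1, p2, p3, p4⟩ := k2.split d2
      have q := p2.right
      have q' := p1.right
      refine ⟨s, hs, hsa, t, ht, by grind, t₂, t, by simp, _, _, k1, p1.append n1 ?_, ?_, ?_, ?_, ?_, ?_⟩ <;> grind
    refine ⟨z, by grind, by grind, t, ht, by grind, t₂, t, by simp, _, _, k1, n1, ?_, ?_, ?_, ?_, ?_⟩ <;> grind
  · refine ⟨s, hs, hsa, t₂, ht2, c2, t₁, t₂, by simp [c1], S₁, S₂, k1, k2, ?_, ?_, ?_, ?_, ?_⟩ <;> grind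
  · refine ⟨s, hs, hsa, t₁, ht1, c1, t₁, t₂, by simp [c2], S₁, S₂, k1, k2, ?_, ?_, ?_, ?_, ?_⟩ <;> grind
  · obtain ⟨z, hz, T, hTS, n1, n2⟩ := hQ.symm.trim (S₁ ∪ S₂) (by grind)
    have f1 := n1.left; have f2 := n1.right
    have hTA : ∀ z ∈ T, z ∈ A → z = a := fun z hz => hQA z (hTS hz)
    have hTB : ∀ z ∈ T, z ∈ B → z = b := fun z hz => hQB z (hTS hz)
    clear hQA hQB hTS hQ
    by_cases d1 : z ∈ S₁
    · obtain ⟨U₁, U₂, p1, p2, p3, p4⟩ := k1.split d1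
      have q := p2.right
      have q' := p1.right
      refine ⟨s, hs, hsa, t₂, ht2, c2, b, t₂, by simp, _, _, p1.append n1.symm ?_, k2, ?_, ?_, ?_, ?_, ?_⟩ <;> grind
    · obtain ⟨U₁, U₂, p1, p2, p3, p4⟩ := k2.split (z := z) (by grind)
      have q := p2.right
      have q' := p1.right
      refine ⟨s, hs, hsa, t₁, ht1, c1, t₁, b, by simp, _, _, k1, p1.append n1.symm ?_, ?_, ?_, ?_, ?_, ?_⟩ <;> grind


lemma seg (f : ℕ → V) (n : ℕ) (hinj : ∀ i ≤ n, ∀ j ≤ n, f i = f j → i = j)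
    (hadj : ∀ i < n, G.Adj (f i) (f (i+1))) (i j : ℕ) (hij : i ≤ j) (hj : j ≤ n) :
    PathOn G ((Finset.Icc i j).image f) (f i) (f j) := by
  induction j, hij using Nat.le_induction with
  | base => simpa using PathOn.single (G := G) (f i)
  | succ j hij ih =>
    have h := (ih (by omega)).snoc (hadj j (by omega)) (by
      simp only [Finset.mem_image, Finset.mem_Icc, not_exists, not_and]
      intro k hk hkj
      have := hinj k (by omega) (j+1) hj hkj
      omega)
    rw [← Finset.image_insert, Finset.insert_Icc_right_eq_Icc_add_one (by omega)] at h
    exact h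

lemma side (f : ℕ → V) (n : ℕ) (hinj : ∀ i ≤ n, ∀ j ≤ n, f i = f j → i = j)
    (hadj : ∀ i < n, G.Adj (f i) (f (i+1))) (a s : ℕ) (ha : a ≤ n) (hs : s < a)
    (haa : G.Adj (f 0) (f a)) :
    ∃ T, PathOn G T (f s) (f a) ∧ T ⊆ (Finset.Icc 0 a).image f ∧ f 0 ∈ T ∧
      ∀ i ≤ a, G.Adj (f 0) (f i) → f i ∈ T := by
  classical
  have hex : ∃ j, s < j ∧ G.Adj (f 0) (f j) := ⟨a, hs, haa⟩
  obtain ⟨j, ⟨hj1, hj2⟩, hjmin⟩ : ∃ j, (s < j ∧ G.Adj (f 0) (f j)) ∧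
      ∀ k, s < k → G.Adj (f 0) (f k) → j ≤ k :=
    ⟨Nat.find hex, Nat.find_spec hex, fun k h1 h2 => Nat.find_min' hex ⟨h1, h2⟩⟩
  have hja := hjmin a hs haa
  have p1 := seg f n hinj hadj 0 s (by omega) (by omega)
  have p2 := (seg f n hinj hadj j a hja ha).cons hj2 (by
    simp only [Finset.mem_image, Finset.mem_Icc, not_exists, not_and]
    intro k hk hkj
    have := hinj k (by omega) 0 (by omega) hkj
    omega)
  have p3 := p1.symm.append p2 (by
    simp only [Finset.mem_image, Finset.mem_Icc, Finset.mem_insert]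
    rintro z ⟨i, hi, rfl⟩ (h | ⟨k, hk, hki⟩)
    · exact h
    · have := hinj k (by omega) i (by omega) hki
      omega)
  refine ⟨_, p3, ?_, ?_, ?_⟩
  · intro z
    simp only [Finset.mem_image, Finset.mem_Icc, Finset.mem_insert, Finset.mem_union]
    rintro (⟨i, hi, rfl⟩ | rfl | ⟨i, hi, rfl⟩)
    · exact ⟨i, by omega, rfl⟩
    · exact ⟨0, by omega, rfl⟩
    · exact ⟨i, by omega, rfl⟩
  · simp
  · intro i hi hai
    simp only [Finset.mem_image, Finset.mem_Icc, Finset.mem_insert, Finset.mem_union]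
    by_cases h : i ≤ s
    · exact Or.inl ⟨i, by omega, rfl⟩
    · exact Or.inr (Or.inr ⟨i, ⟨hjmin i (by omega) hai, hi⟩, rfl⟩)

lemma HasCycle.mono {m n : ℕ} (h : HasCycle G n) (hmn : m ≤ n) : HasCycle G m := by
  obtain ⟨v, c, hc, h⟩ := h
  exact ⟨v, c, hc, hmn.trans h⟩

/-- Abstract glueing for the non-crossing case. -/
lemma glue {A B TA TB S₁ S₂ : Finset V} {a b s t t₁ t₂ : V} (hsa : s ≠ a)
    (hTA : PathOn G TA s a) (hTB : PathOn G TB t b) (hA : TA ⊆ A) (hB : TB ⊆ B)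
    (hAB : ∀ z ∈ A, z ∈ B → z = a ∧ z = b)
    (ht : (t₁ = b ∧ t₂ = t) ∨ (t₁ = t ∧ t₂ = b))
    (h1 : PathOn G S₁ a t₁) (h2 : PathOn G S₂ s t₂) (hd : Disjoint S₁ S₂)
    (hA1 : ∀ z ∈ S₁, z ∈ A → z = a) (hA2 : ∀ z ∈ S₂, z ∈ A → z = s)
    (hB1 : ∀ z ∈ S₁, z ∈ B → z = t₁) (hB2 : ∀ z ∈ S₂, z ∈ B → z = t₂)
    (cA cB : ℕ) (hcA : cA + 1 ≤ TA.card) (hcB : cB + 1 ≤ TB.card) (hA0 : 1 ≤ cA) (hB0 : 1 ≤ cB) :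
    HasCycle G (cA + cB) := by
  simp only [Finset.disjoint_left] at hd
  have hW : PathOn G (S₂ ∪ TB ∪ S₁) s a := by
    have e1 := h1.right
    have e2 := h2.right
    rcases ht with ⟨rfl, rfl⟩ | ⟨rfl, rfl⟩
    · exact (h2.append hTB (by grind)).append h1.symm (by grind)
    · exact (h2.append hTB.symm (by grind)).append h1.symm (by grind)
  have hcard : cA + cB + 1 ≤ (TA ∪ TB).card := by
    have := Finset.card_union_add_card_inter TA TB
    have h : (TA ∩ TB).card ≤ 1 := by
      rw [Finset.card_le_one]
      intro z hz w hw
      simp only [Finset.mem_inter] at hz hw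
      rw [(hAB z (hA hz.1) (hB hz.2)).1, (hAB w (hA hw.1) (hB hw.2)).1]
    omega
  have hcard2 : (TA ∪ TB).card ≤ (TA ∪ (S₂ ∪ TB ∪ S₁)).card :=
    Finset.card_le_card (by intro z; simp only [Finset.mem_union]; tauto)
  exact (hTA.close2 hW hsa (by grind) (by omega)).mono (by omega)

lemma crossing (f : ℕ → V) (n : ℕ) (hn : 2 ≤ n) (hinj : ∀ i ≤ n, ∀ j ≤ n, f i = f j → i = j)
    (hadj : ∀ i < n, G.Adj (f i) (f (i+1))) [DecidableRel G.Adj]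
    (hc : ∃ i j, i < j ∧ j ≤ n ∧ G.Adj (f n) (f i) ∧ G.Adj (f 0) (f j)) :
    HasCycle G (min (n+1) (((Finset.range (n+1)).filter (fun i => G.Adj (f 0) (f i))).card +
      ((Finset.range (n+1)).filter (fun i => G.Adj (f n) (f i))).card)) := by
  have hex : ∃ d, ∃ i, i + d + 1 ≤ n ∧ G.Adj (f n) (f i) ∧ G.Adj (f 0) (f (i+d+1)) := by
    obtain ⟨i, j, hij, hj, h1, h2⟩ := hc
    refine ⟨j - i - 1, i, by omega, h1, ?_⟩
    rwa [show i + (j-i-1) + 1 = j by omega]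
  obtain ⟨d, ⟨i, hi, h1, h2⟩, hmin⟩ : ∃ d, (∃ i, i + d + 1 ≤ n ∧ G.Adj (f n) (f i) ∧
      G.Adj (f 0) (f (i+d+1))) ∧ ∀ e k, k + e + 1 ≤ n → G.Adj (f n) (f k) →
        G.Adj (f 0) (f (k+e+1)) → d ≤ e := by
    classical
    exact ⟨Nat.find hex, Nat.find_spec hex, fun e k a b c => Nat.find_min' hex ⟨k, a, b, c⟩⟩
  have p1 := seg f n hinj hadj 0 i (by omega) (by omega)
  have p2 := seg f n hinj hadj (i+d+1) n (by omega) (by omega)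
  have hdisj : Disjoint ((Finset.Icc 0 i).image f) ((Finset.Icc (i+d+1) n).image f) := by
    rw [Finset.disjoint_left]
    simp only [Finset.mem_image, Finset.mem_Icc, not_exists, not_and]
    rintro z ⟨k, hk, rfl⟩ l hl hkl
    have := hinj l (by omega) k (by omega) hkl
    omega
  have hf0 : f n ∉ (Finset.Icc 0 i).image f := fun h =>
    Finset.disjoint_left.1 hdisj h (by simp only [Finset.mem_image, Finset.mem_Icc]; exact ⟨n, by omega, rfl⟩)
  have p3 := (p1.snoc h1.symm hf0).append p2.symm (by
    intro z hz hz'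
    rcases Finset.mem_insert.1 hz with h | h
    · exact h
    · exact absurd hz' (Finset.disjoint_left.1 hdisj h))
  have hins : insert (f n) ((Finset.Icc 0 i).image f) ∪ (Finset.Icc (i+d+1) n).image f
      = (Finset.Icc 0 i).image f ∪ (Finset.Icc (i+d+1) n).image f := by
    rw [Finset.insert_union]
    exact Finset.insert_eq_of_mem (Finset.mem_union_right _ p2.right)
  rw [hins] at p3
  have hcard : ((Finset.Icc 0 i).image f ∪ (Finset.Icc (i+d+1) n).image f).card = n + 1 - d := by
    rw [Finset.card_union_of_disjoint hdisj, Finset.card_image_of_injOn, Finset.card_image_of_injOn]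
    · simp; omega
    · intro a ha b hb hab
      simp only [Finset.coe_Icc, Set.mem_Icc] at ha hb
      exact hinj a (by omega) b (by omega) hab
    · intro a ha b hb hab
      simp only [Finset.coe_Icc, Set.mem_Icc] at ha hb
      exact hinj a (by omega) b (by omega) hab
  have h3 : 3 ≤ n + 1 - d := by
    by_cases hi0 : i = 0
    · subst hi0
      have := hmin 0 0 (by omega) h1 (hadj 0 (by omega))
      omega
    · omega
  have hcyc := p3.close h2.symm (by omega)
  rw [hcard] at hcyc
  refine hcyc.mono ?_
  rcases Nat.eq_zero_or_pos d with hd | hd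
  · omega
  refine (min_le_right _ _).trans ?_
  have hx0 : ∀ k, G.Adj (f 0) (f k) → k ≠ 0 := by
    rintro k hk rfl; exact hk.ne rfl
  have hyn : ∀ k, G.Adj (f n) (f k) → k ≠ n := by
    rintro k hk rfl; exact hk.ne rfl
  have e1 : ((Finset.range (n+1)).filter (fun i => G.Adj (f 0) (f i))).card =
      (((Finset.range (n+1)).filter (fun i => G.Adj (f 0) (f i))).image (fun k => k - 1)).card := by
    rw [Finset.card_image_of_injOn]
    intro a ha b hb hab
    simp only [Finset.coe_filter, Finset.mem_range, Set.mem_ofPred_eq] at ha hb hab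
    have := hx0 a ha.2
    have := hx0 b hb.2
    omega
  rw [e1, ← Finset.card_union_of_disjoint]
  · have hsub : ((Finset.range (n+1)).filter (fun i => G.Adj (f 0) (f i))).image (fun k => k - 1) ∪
        (Finset.range (n+1)).filter (fun i => G.Adj (f n) (f i)) ⊆
        Finset.range n \ Finset.Ico (i+1) (i+d) := by
      intro z
      simp only [Finset.mem_union, Finset.mem_image, Finset.mem_filter, Finset.mem_range,
        Finset.mem_sdiff, Finset.mem_Ico]
      rintro (⟨k, ⟨hk, hk'⟩, rfl⟩ | ⟨hk, hk'⟩)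
      · have := hx0 k hk'
        refine ⟨by omega, fun hh => ?_⟩
        have := hmin (k - i - 1) i (by omega) h1 (by rwa [show i + (k-i-1) + 1 = k by omega])
        omega
      · have := hyn z hk'
        refine ⟨by omega, fun hh => ?_⟩
        have := hmin (i+d-z) z (by omega) hk' (by rwa [show z + (i+d-z) + 1 = i+d+1 by omega])
        omega
    refine (Finset.card_le_card hsub).trans ?_
    rw [Finset.card_sdiff_of_subset]
    · simp; omega
    · intro z; simp only [Finset.mem_Ico, Finset.mem_range]; omega
  · rw [Finset.disjoint_left]
    intro z
    simp only [Finset.mem_image, Finset.mem_filter, Finset.mem_range]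
    rintro ⟨k, ⟨hk, hk'⟩, rfl⟩ ⟨hz, hz'⟩
    have := hx0 k hk'
    have := hmin 0 (k-1) (by omega) hz' (by rwa [show k - 1 + 0 + 1 = k by omega])
    omega

lemma card_side (f : ℕ → V) (n : ℕ) (hinj : ∀ i ≤ n, ∀ j ≤ n, f i = f j → i = j)
    (p : ℕ) (hp : p ≤ n) [DecidableRel G.Adj] (T : Finset V) (h0 : f p ∈ T)
    (h : ∀ i ≤ n, G.Adj (f p) (f i) → f i ∈ T) :
    ((Finset.range (n+1)).filter (fun i => G.Adj (f p) (f i))).card + 1 ≤ T.card := by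
  rw [← Finset.card_insert_of_notMem (a := p) (by simp)]
  rw [← Finset.card_image_of_injOn (f := f)]
  · apply Finset.card_le_card
    intro z
    simp only [Finset.mem_image, Finset.mem_insert, Finset.mem_filter, Finset.mem_range]
    rintro ⟨k, rfl | ⟨hk, hk'⟩, rfl⟩
    · exact h0
    · exact h k (by omega) hk'
  · intro a ha b hb hab
    simp only [Finset.coe_insert, Finset.coe_filter, Finset.mem_range, Set.mem_insert_iff,
      Set.mem_ofPred_eq] at ha hb
    exact hinj a (by omega) b (by omega) hab

lemma noncrossing (hG : TC G) (f : ℕ → V) (n : ℕ) (hn : 2 ≤ n)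
    (hinj : ∀ i ≤ n, ∀ j ≤ n, f i = f j → i = j)
    (hadj : ∀ i < n, G.Adj (f i) (f (i+1))) [DecidableRel G.Adj]
    (hc : ∀ i j, i ≤ n → j ≤ n → G.Adj (f n) (f i) → G.Adj (f 0) (f j) → j ≤ i) :
    HasCycle G (((Finset.range (n+1)).filter (fun i => G.Adj (f 0) (f i))).card +
      ((Finset.range (n+1)).filter (fun i => G.Adj (f n) (f i))).card) := by
  have hx1 : G.Adj (f 0) (f 1) := hadj 0 (by omega)
  have hy1 : G.Adj (f n) (f (n-1)) := by
    have := hadj (n-1) (by omega)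
    rw [show n - 1 + 1 = n by omega] at this
    exact this.symm
  obtain ⟨a, ha, hamax⟩ := Finset.exists_max_image
    ((Finset.range (n+1)).filter (fun i => G.Adj (f 0) (f i))) id ⟨1, by simp [hx1]; omega⟩
  obtain ⟨b, hb, hbmin⟩ := Finset.exists_min_image
    ((Finset.range (n+1)).filter (fun i => G.Adj (f n) (f i))) id ⟨n-1, by simp [hy1]⟩
  simp only [Finset.mem_filter, Finset.mem_range, id] at ha hamax hb hbmin
  have ha1 : 1 ≤ a := hamax 1 ⟨by omega, hx1⟩
  have hb1 : b ≤ n - 1 := hbmin (n-1) ⟨by omega, hy1⟩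
  have hab : a ≤ b := hc b a (by omega) (by omega) hb.2 ha.2
  have hmemA : ∀ z, z ∈ (Finset.Icc 0 a).image f ↔ ∃ i ≤ a, f i = z := by simp
  have hmemB : ∀ z, z ∈ (Finset.Icc b n).image f ↔ ∃ i, (b ≤ i ∧ i ≤ n) ∧ f i = z := by simp
  generalize hAdef : (Finset.Icc 0 a).image f = A at *
  generalize hBdef : (Finset.Icc b n).image f = B at *
  have hAB : ∀ z ∈ A, z ∈ B → z = f a ∧ z = f b := by
    intro z hz hz'
    obtain ⟨i, hi, rfl⟩ := (hmemA z).1 hz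
    obtain ⟨j, hj, hij⟩ := (hmemB _).1 hz'
    have := hinj j (by omega) i (by omega) hij
    have e1 : i = a := by omega
    have e2 : i = b := by omega
    exact ⟨by rw [e1], by rw [e2]⟩
  have haA : f a ∈ A := (hmemA _).2 ⟨a, le_rfl, rfl⟩
  have h0A : f 0 ∈ A := (hmemA _).2 ⟨0, by omega, rfl⟩
  have hbB : f b ∈ B := (hmemB _).2 ⟨b, by omega, rfl⟩
  have hnB : f n ∈ B := (hmemB _).2 ⟨n, by omega, rfl⟩
  have h0a : f 0 ≠ f a := fun h => by have := hinj 0 (by omega) a (by omega) h; omega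
  have hnb : f n ≠ f b := fun h => by have := hinj n (by omega) b (by omega) h; omega
  have hlink : ∃ s ∈ A, s ≠ f a ∧ ∃ t ∈ B, t ≠ f b ∧
      ∃ t₁ t₂, ((t₁ = f b ∧ t₂ = t) ∨ (t₁ = t ∧ t₂ = f b)) ∧
      ∃ S₁ S₂, PathOn G S₁ (f a) t₁ ∧ PathOn G S₂ s t₂ ∧ Disjoint S₁ S₂ ∧
      (∀ z ∈ S₁, z ∈ A → z = f a) ∧ (∀ z ∈ S₂, z ∈ A → z = s) ∧
      (∀ z ∈ S₁, z ∈ B → z = t₁) ∧ (∀ z ∈ S₂, z ∈ B → z = t₂) := by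
    rcases hab.eq_or_lt with rfl | hlt
    · obtain ⟨S0, hS0, hS0'⟩ := hG (f a) (f 0) (f n) h0a hnb
      obtain ⟨t, ht, S, hSS, m1, m2⟩ := hS0.trim B hnB
      obtain ⟨s, hs, T, hTS, n1, n2⟩ := m1.symm.trim A h0A
      have f1 := n1.left; have f2 := n1.right
      have haT : f a ∉ T := fun h => hS0' (hSS (hTS h))
      refine ⟨s, hs, fun h => haT (h ▸ f2), t, ht, fun h => haT (h ▸ f1), f a, t, by simp,
        {f a}, T, .single _, n1.symm, by simpa using haT, by simp, n2, by simp,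
        fun z hz => m2 z (hTS hz)⟩
    · have hQ := seg f n hinj hadj a b hab (by omega)
      refine link hG A B (f a) (f b) (f n) hbB hnB hnb haA ?_ _ hQ ?_ ?_ ?_
      · rw [Finset.disjoint_left]
        intro z h1 h2
        have := hAB z h1 h2
        have := hinj a (by omega) b (by omega) (this.1.symm.trans this.2)
        omega
      · intro z hz hz'
        simp only [Finset.mem_image, Finset.mem_Icc] at hz
        obtain ⟨k, hk, rfl⟩ := hz
        obtain ⟨i, hi, hik⟩ := (hmemA _).1 hz'
        have := hinj i (by omega) k (by omega) hik
        congr 1; omega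
      · intro z hz hz'
        simp only [Finset.mem_image, Finset.mem_Icc] at hz
        obtain ⟨k, hk, rfl⟩ := hz
        obtain ⟨i, hi, hik⟩ := (hmemB _).1 hz'
        have := hinj i (by omega) k (by omega) hik
        congr 1; omega
      · have := fan hG A (fun i => f (a + i)) (f 0) haA h0A h0a (b - a - 1)
          (fun i hi => hadj (a+i) (by omega)) (fun i hi hh => by
            obtain ⟨k, hk, hki⟩ := (hmemA _).1 hh
            have := hinj k (by omega) (a + (i+1)) (by omega) hki
            omega)
        simp only [show a + (b - a - 1 + 1) = b by omega, Nat.add_zero] at this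
        exact this
  obtain ⟨s, hs, hsa, t, ht, htb, t₁, t₂, htt, S₁, S₂, h1, h2, hd, hA1, hA2, hB1, hB2⟩ := hlink
  obtain ⟨s, hs', rfl⟩ := (hmemA _).1 hs
  obtain ⟨t, ht', rfl⟩ := (hmemB _).1 ht
  have hsa' : s < a := lt_of_le_of_ne hs' (fun h => hsa (by rw [h]))
  have htb' : b < t := lt_of_le_of_ne ht'.1 (fun h => htb (by rw [h]))
  obtain ⟨TA, hTA, hTAA, hTA0, hTAn⟩ := side f n hinj hadj a s (by omega) hsa' ha.2
  obtain ⟨TB, hTB, hTBB, hTB0, hTBn⟩ := side (fun i => f (n - i)) n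
    (fun i hi j hj hij => by have := hinj (n-i) (by omega) (n-j) (by omega) hij; omega)
    (fun i hi => by
      have := hadj (n-(i+1)) (by omega)
      rw [show n - (i+1) + 1 = n - i by omega] at this
      exact this.symm) (n - b) (n - t) (by omega) (by omega)
    (by simpa [show n - (n - b) = b by omega] using hb.2)
  simp only [show n - (n - b) = b by omega, show n - (n - t) = t by omega, Nat.sub_zero] at hTB hTB0 hTBn
  rw [hAdef] at hTAA
  have hTBB' : TB ⊆ B := by
    intro z hz
    have := hTBB hz
    simp only [Finset.mem_image, Finset.mem_Icc] at this
    obtain ⟨k, hk, rfl⟩ := this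
    exact (hmemB _).2 ⟨n - k, by omega, rfl⟩
  refine glue hsa hTA hTB hTAA hTBB' hAB htt h1 h2 hd hA1 hA2 hB1 hB2 _ _
    (card_side f n hinj 0 (by omega) TA hTA0 fun i hi h => hTAn i (hamax i ⟨by omega, h⟩) h)
    (card_side f n hinj n le_rfl TB hTB0 fun i hi h => ?_) ?_ ?_
  · have hbi := hbmin i ⟨by omega, h⟩
    have := hTBn (n - i) (by omega)
    rw [show n - (n - i) = i by omega] at this
    exact this h
  · exact Finset.card_pos.2 ⟨a, by simp [ha]⟩
  · exact Finset.card_pos.2 ⟨b, by simp [hb]⟩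

lemma anyCycle [Fintype V] (hcard : 3 ≤ Fintype.card V) (hG : TC G) : HasCycle G 3 := by
  have ex : ∀ u w : V, ∃ z, z ≠ u ∧ z ≠ w := by
    intro u w
    by_contra hcon
    push Not at hcon
    have : (Finset.univ : Finset V) ⊆ {u, w} := by
      intro z _
      by_cases h : z = u
      · simp [h]
      · simp [hcon z h]
    have h1 := Finset.card_le_card this
    have h2 : ({u, w} : Finset V).card ≤ 2 := Finset.card_le_two
    rw [Finset.card_univ] at h1
    omega
  have nb : ∀ u w : V, u ≠ w → ∃ z, z ≠ w ∧ G.Adj u z := by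
    intro u w huw
    obtain ⟨z, hz1, hz2⟩ := ex u w
    obtain ⟨S, hS, hw⟩ := hG w u z huw hz2
    obtain ⟨q, hq, hq'⟩ := hS.uncons hz1.symm
    refine ⟨q, fun h => hw ?_, hq⟩
    have := hq'.left
    rw [h] at this
    exact Finset.mem_of_mem_erase this
  have : Nonempty V := Fintype.card_pos_iff.1 (by omega)
  obtain ⟨u⟩ := this
  obtain ⟨w0, hw0, -⟩ := ex u u
  obtain ⟨w1, -, h1⟩ := nb u w0 hw0.symm
  obtain ⟨w2, hw2, h2⟩ := nb u w1 h1.ne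
  obtain ⟨S, hS, hu⟩ := hG u w1 w2 h1.ne' h2.ne'
  have hc : 3 ≤ (insert u S).card := by
    rw [Finset.card_insert_of_notMem hu]
    have : 1 < S.card := Finset.one_lt_card.2 ⟨w1, hS.left, w2, hS.right, hw2.symm⟩
    omega
  exact ((hS.cons h1 hu).close h2.symm hc).mono hc

end Posa

open Posa SimpleGraph in
lemma IsTwoConnected.tc {V : Type*} [Fintype V] [DecidableEq V] {G : SimpleGraph V}
    (hG : IsTwoConnected G) : TC G := by
  intro w u v hu hv
  obtain ⟨p⟩ := (hG.2 w).preconnected ⟨u, by simpa using hu⟩ ⟨v, by simpa using hv⟩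
  let q : G.Walk u v := p.map (((⊤ : G.Subgraph).deleteVerts {w}).hom)
  refine ⟨_, ⟨q.bypass, q.bypass_isPath, rfl⟩, ?_⟩
  intro h
  have h1 : w ∈ q.support := q.support_bypass_subset_support (by simpa using h)
  have h2 := List.mem_map.1 ((Walk.support_map _ p) ▸ h1 : w ∈ p.support.map _)
  obtain ⟨z, -, hz⟩ := h2
  have := z.2
  exact this.2 hz

/-- **Pósa's lemma.** If `G` is 2-connected and `P` is a path on `m` vertices with
endpoints `x` and `y`, then `G` contains a cycle of length at least
`min m (d_P(x) + d_P(y))`, where `d_P(v)` is the number of neighbours of `v` on `P`. -/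
theorem stmt_4 {V : Type*} [Fintype V] [DecidableEq V]
    (G : SimpleGraph V) [DecidableRel G.Adj]
    (hG : IsTwoConnected G) (x y : V) (P : G.Walk x y) (hP : P.IsPath)
    (m : ℕ) (hm : P.support.length = m) :
    ∃ (v : V) (c : G.Walk v v), c.IsCycle ∧
      min m ((P.support.toFinset ∩ G.neighborFinset x).card
             + (P.support.toFinset ∩ G.neighborFinset y).card) ≤ c.length := by
  have hTC := hG.tc
  rw [SimpleGraph.Walk.length_support] at hm
  by_cases hn : 2 ≤ P.length
  · have hinj : ∀ i ≤ P.length, ∀ j ≤ P.length, P.getVert i = P.getVert j → i = j :=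
      fun i hi j hj h => hP.getVert_injOn hi hj h
    have hadj : ∀ i < P.length, G.Adj (P.getVert i) (P.getVert (i+1)) :=
      fun i hi => P.adj_getVert_succ hi
    have hdeg : ∀ z, (P.support.toFinset ∩ G.neighborFinset z).card =
        ((Finset.range (P.length+1)).filter (fun i => G.Adj z (P.getVert i))).card := by
      intro z
      rw [← Finset.card_image_of_injOn (f := P.getVert)]
      · congr 1
        ext w
        simp only [Finset.mem_inter, List.mem_toFinset, SimpleGraph.mem_neighborFinset,
          Finset.mem_image, Finset.mem_filter, Finset.mem_range,
          SimpleGraph.Walk.mem_support_iff_exists_getVert]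
        constructor
        · rintro ⟨⟨k, rfl, hk⟩, h⟩
          exact ⟨k, ⟨by omega, h⟩, rfl⟩
        · rintro ⟨k, ⟨hk, h⟩, rfl⟩
          exact ⟨⟨k, rfl, by omega⟩, h⟩
      · intro a ha b hb hab
        simp only [Finset.coe_filter, Finset.mem_range, Set.mem_ofPred_eq] at ha hb
        exact hinj a (by omega) b (by omega) hab
    rw [hdeg, hdeg, ← hm]
    by_cases hc : ∃ i j, i < j ∧ j ≤ P.length ∧ G.Adj (P.getVert P.length) (P.getVert i) ∧
        G.Adj (P.getVert 0) (P.getVert j)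
    · have := Posa.crossing P.getVert P.length hn hinj hadj hc
      simp only [SimpleGraph.Walk.getVert_zero, SimpleGraph.Walk.getVert_length] at this
      exact this
    · have := Posa.noncrossing hTC P.getVert P.length hn hinj hadj (by
        intro i j hi hj h1 h2
        by_contra hlt
        exact hc ⟨i, j, by omega, hj, h1, h2⟩)
      have := this.mono (min_le_right (P.length + 1) _)
      simp only [SimpleGraph.Walk.getVert_zero, SimpleGraph.Walk.getVert_length] at this
      exact this
  · exact (Posa.anyCycle hG.1 hTC).mono ((min_le_left _ _).trans (by omega))
end
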